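/- Let $G$ be a $4.5$-tough $(P_4 \cup P_1)$-free graph and let $S \subseteq V(G)$ be a minimal cutset of $G$. Then $G$ has a cycle whose vertex set contains all of $V(G) \setminus S$. -/

import Mathlib

open SimpleGraph

/-- The number of connected components of `G - S`. -/
noncomputable def ncomps {V : Type*} (G : SimpleGraph V) (S : Set V) : ℕ :=
  Nat.card (G.induce Sᶜ).ConnectedComponent

/-- The graph `P₄ ∪ P₁`: a path on four vertices plus an isolated vertex. -/
def P4P1 : SimpleGraph (Fin 5) :=
  SimpleGraph.fromEdgeSet {s((0 : Fin 5), (1 : Fin 5)), s((1 : Fin 5), (2 : Fin 5)),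
    s((2 : Fin 5), (3 : Fin 5))}

/-- `G` has no induced subgraph isomorphic to `P₄ ∪ P₁`. -/
def P4P1Free {V : Type*} (G : SimpleGraph V) : Prop := IsEmpty (P4P1 ↪g G)

/-- `G` has no induced subgraph isomorphic to `P₄`. -/
def P4Free {V : Type*} (G : SimpleGraph V) : Prop := IsEmpty (SimpleGraph.pathGraph 4 ↪g G)

/-- `G` is `t`-tough. -/
def Tough {V : Type*} (t : ℝ) (G : SimpleGraph V) : Prop :=
  ∀ S : Set V, 2 ≤ ncomps G S → t * (ncomps G S : ℝ) ≤ (S.ncard : ℝ)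

/-- `S` is a cutset of `G`, i.e. `G - S` is disconnected. -/
def IsCutset {V : Type*} (G : SimpleGraph V) (S : Set V) : Prop :=
  2 ≤ ncomps G S

/-- `S` is a scattering set of `G`. -/
def IsScatSet {V : Type*} (G : SimpleGraph V) (S : Set V) : Prop :=
  2 ≤ ncomps G S ∧ ∀ T : Set V, 2 ≤ ncomps G T →
    (ncomps G T : ℤ) - (T.ncard : ℤ) ≤ (ncomps G S : ℤ) - (S.ncard : ℤ)

/-- `S` is a maximal scattering set of `G`. -/
def IsMaxScatSet {V : Type*} (G : SimpleGraph V) (S : Set V) : Prop :=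
  IsScatSet G S ∧ ∀ T : Set V, IsScatSet G T → S ⊆ T → S = T

/-- `G` is `t`-tough with respect to `S`. -/
def ToughWrt {V : Type*} (t : ℝ) (G : SimpleGraph V) (S : Set V) : Prop :=
  ∀ W : Set V, 2 ≤ ncomps G W →
    (∀ c : (G.induce Sᶜ).ConnectedComponent,
      ∃ v : ↥Sᶜ, (G.induce Sᶜ).connectedComponentMk v = c ∧ (v : V) ∉ W) →
    t * (ncomps G W : ℝ) ≤ (W.ncard : ℝ)

open Classical in
/-- The number of consecutive pairs of a list that are not adjacent. -/
noncomputable def breaks {V : Type*} (G : SimpleGraph V) : List V → ℕ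
  | [] => 0
  | [_] => 0
  | x :: y :: l => (if G.Adj x y then 0 else 1) + breaks G (y :: l)

section Lists

variable {V : Type*} {G : SimpleGraph V}

theorem breaks_cons_le (x : V) (l : List V) : breaks G l ≤ breaks G (x :: l) := by
  cases l <;> simp [breaks]

theorem breaks_cons_le_succ (x : V) (l : List V) : breaks G (x :: l) ≤ breaks G l + 1 := by
  cases l with
  | nil => simp [breaks]
  | cons y l => simp only [breaks]; split_ifs <;> omega

theorem breaks_eq_zero_iff (l : List V) : breaks G l = 0 ↔ l.IsChain G.Adj := by
  induction l with
  | nil => simp [breaks]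
  | cons x l ih =>
    cases l with
    | nil => simp [breaks]
    | cons y l => by_cases h : G.Adj x y <;> simp [breaks, h, ih]

theorem breaks_append_ge (l₁ l₂ : List V) :
    breaks G l₁ + breaks G l₂ ≤ breaks G (l₁ ++ l₂) := by
  induction l₁ with
  | nil => simp [breaks]
  | cons x l ih =>
    cases l with
    | nil => simpa [breaks] using breaks_cons_le x l₂
    | cons y l => simp only [breaks, List.cons_append] at *; omega

theorem breaks_append_le (l₁ l₂ : List V) :
    breaks G (l₁ ++ l₂) ≤ breaks G l₁ + breaks G l₂ + 1 := by
  induction l₁ with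
  | nil => simp [breaks]
  | cons x l ih =>
    cases l with
    | nil => simpa [breaks] using breaks_cons_le_succ x l₂
    | cons y l => simp only [breaks, List.cons_append] at *; omega

theorem breaks_append_eq {l₁ : List V} {y : V} {l₂ : List V} (h₁ : l₁ ≠ [])
    (h : ∀ x ∈ l₁, ¬ G.Adj x y) :
    breaks G (l₁ ++ y :: l₂) = breaks G l₁ + breaks G (y :: l₂) + 1 := by
  induction l₁ with
  | nil => simp at h₁
  | cons x l ih =>
    cases l with
    | nil => simp [breaks, h x (by simp)]; omega
    | cons z l =>
      have := ih (by simp) (fun w hw => h w (by simp at hw ⊢; tauto))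
      simp only [breaks, List.cons_append] at *; omega

theorem breaks_reverse (l : List V) : breaks G l.reverse = breaks G l := by
  induction l with
  | nil => rfl
  | cons x l ih =>
    cases l with
    | nil => rfl
    | cons y l =>
      have key : ∀ (l₁ : List V) (a b : V), breaks G (l₁ ++ [a, b]) =
          breaks G (l₁ ++ [a]) + breaks G [a, b] := by
        intro l₁ a b
        induction l₁ with
        | nil => simp [breaks]
        | cons z l₁ ih =>
          cases l₁ with
          | nil => simp [breaks]
          | cons w l₁ => simp only [breaks, List.cons_append] at *; omega
      have := key l.reverse y x
      simp only [List.reverse_cons, List.append_assoc, List.cons_append, List.nil_append] at *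
      rw [this, ih]
      by_cases h : G.Adj x y
      · simp [breaks, h, h.symm]
      · have h' : ¬ G.Adj y x := fun e => h e.symm
        simp [breaks, h, h']; omega

theorem breaks_lt_length {l : List V} (h : l ≠ []) : breaks G l + 1 ≤ l.length := by
  induction l with
  | nil => simp at h
  | cons x l ih =>
    cases l with
    | nil => simp [breaks]
    | cons y l =>
      have := ih (by simp)
      simp only [breaks, List.length_cons] at *
      split_ifs <;> omega

/-- Filling breaks of `l` with vertices complete to `l`. -/
theorem exists_fill_breaks (l : List V) : ∀ B : List V, B.length ≤ breaks G l →
    (∀ b ∈ B, ∀ a ∈ l, G.Adj a b) →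
    ∃ l' : List V, l'.Perm (l ++ B) ∧ breaks G l' + B.length = breaks G l ∧
      l'.head? = l.head? := by
  induction l with
  | nil =>
    intro B hB _
    have : B = [] := by simpa [breaks] using hB
    exact ⟨[], by simp [this], by simp [this], rfl⟩
  | cons x l ih =>
    cases l with
    | nil =>
      intro B hB _
      have : B = [] := by simpa [breaks] using hB
      exact ⟨[x], by simp [this], by simp [this], rfl⟩
    | cons y r =>
      intro B hB hAB
      by_cases hxy : G.Adj x y
      · obtain ⟨l', h1, h2, h3⟩ := ih B (by simpa [breaks, hxy] using hB)
          (fun b hb a ha => hAB b hb a (by simp at ha ⊢; tauto))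
        cases l' with
        | nil => simp at h3
        | cons z l' =>
          obtain rfl : z = y := by simpa using h3
          exact ⟨x :: z :: l', by simpa using h1, by simpa [breaks, hxy] using h2, rfl⟩
      · cases B with
        | nil => exact ⟨x :: y :: r, by simp, by simp, rfl⟩
        | cons b B =>
          obtain ⟨l', h1, h2, h3⟩ := ih B (by simp [breaks, hxy] at hB; omega)
            (fun b hb a ha => hAB b (by simp [hb]) a (by simp at ha ⊢; tauto))
          cases l' with
          | nil => simp at h3
          | cons z l' =>
            obtain rfl : z = y := by simpa using h3
            refine ⟨x :: b :: z :: l', ?_, ?_, rfl⟩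
            · have : (b :: (z :: l')).Perm (b :: (z :: r ++ B)) := h1.cons b
              refine (this.trans ?_).cons x
              exact List.perm_middle.symm
            · have e1 := hAB b (by simp) x (by simp)
              have e2 := (hAB b (by simp) z (by simp)).symm
              simp [breaks, hxy, e1, e2] at h2 ⊢; omega

/-- Interleaving two orders whose ground sets are complete to each other, so that the result is a
path. -/
theorem exists_weave (n : ℕ) : ∀ lA lB : List V, lA.length + lB.length ≤ n →
    (∀ a ∈ lA, ∀ b ∈ lB, G.Adj a b) → lA ≠ [] → lB ≠ [] →
    (breaks G lA + 1 ≤ lB.length → breaks G lB + 1 ≤ lA.length →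
      ∃ l : List V, l.Perm (lA ++ lB) ∧ l.IsChain G.Adj ∧ l.head? = lA.head? ∧
        l.getLast? = lB.getLast?) ∧
    (breaks G lA ≤ lB.length → breaks G lB + 2 ≤ lA.length →
      ∃ l : List V, l.Perm (lA ++ lB) ∧ l.IsChain G.Adj ∧ l.head? = lA.head? ∧
        l.getLast? = lA.getLast?) := by
  induction n with
  | zero => intro lA lB h _ hA; simp at h; exact absurd h.1 hA
  | succ n ih =>
    intro lA lB hn hAB hA hB
    obtain ⟨x, A, rfl⟩ := List.exists_cons_of_ne_nil hA
    obtain ⟨y, B, rfl⟩ := List.exists_cons_of_ne_nil hB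
    have hxy : G.Adj x y := hAB x (by simp) y (by simp)
    have hlenB := breaks_lt_length (G := G) hB
    cases A with
    | nil =>
      refine ⟨fun h1 h2 => ⟨x :: y :: B, by simp, ?_, rfl, by simp⟩, fun _ h2 => by simp at h2⟩
      have : breaks G (y :: B) = 0 := by simpa using h2
      exact List.isChain_cons_cons.2 ⟨hxy, (breaks_eq_zero_iff _).1 this⟩
    | cons x' A =>
      have hlenA := breaks_lt_length (G := G) (l := x' :: A) (by simp)
      have hAB' : ∀ a ∈ x' :: A, ∀ b ∈ y :: B, G.Adj a b :=
        fun a ha b hb => hAB a (by simp at ha ⊢; tauto) b hb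
      have hBA' : ∀ b ∈ y :: B, ∀ a ∈ x' :: A, G.Adj b a :=
        fun b hb a ha => (hAB' a ha b hb).symm
      obtain ⟨c1, c2⟩ := ih (x' :: A) (y :: B) (by simp at hn ⊢; omega) hAB' (by simp) (by simp)
      obtain ⟨j1, j2⟩ := ih (y :: B) (x' :: A) (by simp at hn ⊢; omega) hBA' (by simp) (by simp)
      have cont : ∀ (z : Option V), G.Adj x x' → (∃ l : List V, l.Perm ((x' :: A) ++ (y :: B)) ∧
          l.IsChain G.Adj ∧ l.head? = (x' :: A).head? ∧ l.getLast? = z) →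
          ∃ l : List V, l.Perm ((x :: x' :: A) ++ (y :: B)) ∧ l.IsChain G.Adj ∧
            l.head? = (x :: x' :: A).head? ∧ l.getLast? = z := by
        rintro z hadj ⟨l, h1, h2, h3, h4⟩
        cases l with
        | nil => simp at h3
        | cons w l =>
          obtain rfl : w = x' := by simpa using h3
          exact ⟨x :: w :: l, h1.cons x, List.isChain_cons_cons.2 ⟨hadj, h2⟩, rfl, by simpa using h4⟩
      have jump : ∀ (z : Option V), (∃ l : List V, l.Perm ((y :: B) ++ (x' :: A)) ∧
          l.IsChain G.Adj ∧ l.head? = (y :: B).head? ∧ l.getLast? = z) →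
          ∃ l : List V, l.Perm ((x :: x' :: A) ++ (y :: B)) ∧ l.IsChain G.Adj ∧
            l.head? = (x :: x' :: A).head? ∧ l.getLast? = z := by
        rintro z ⟨l, h1, h2, h3, h4⟩
        cases l with
        | nil => simp at h3
        | cons w l =>
          obtain rfl : w = y := by simpa using h3
          exact ⟨x :: w :: l, (h1.trans List.perm_append_comm).cons x,
            List.isChain_cons_cons.2 ⟨hxy, h2⟩, rfl, by simpa using h4⟩
      constructor
      · intro h1 h2
        have hl : ((x :: x' :: A).getLast?) = (x' :: A).getLast? := by simp
        by_cases hadj : G.Adj x x'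
        · simp only [breaks, hadj, if_true, List.length_cons] at h1 h2 hlenA hlenB c1 j2
          by_cases hc : breaks G (y :: B) + 1 ≤ A.length + 1
          · exact cont _ hadj (c1 (by omega) hc)
          · exact jump _ (j2 (by omega) (by omega))
        · simp only [breaks, hadj, if_false, List.length_cons] at h1 h2 hlenA hlenB c1 j2
          exact jump _ (j2 (by omega) (by omega))
      · intro h1 h2
        have hl : ((x :: x' :: A).getLast?) = (x' :: A).getLast? := by simp
        rw [hl]
        by_cases hadj : G.Adj x x'
        · simp only [breaks, hadj, if_true, List.length_cons] at h1 h2 hlenA hlenB c2 j1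
          by_cases hc : breaks G (y :: B) + 2 ≤ A.length + 1
          · exact cont _ hadj (c2 (by omega) hc)
          · exact jump _ (j1 (by omega) (by omega))
        · simp only [breaks, hadj, if_false, List.length_cons] at h1 h2 hlenA hlenB c2 j1
          exact jump _ (j1 (by omega) (by omega))

/-- Reordering so that a given vertex comes first costs at most one break. -/
theorem exists_perm_head (l : List V) {x : V} (hx : x ∈ l) :
    ∃ l' : List V, l'.Perm l ∧ l'.head? = some x ∧ breaks G l' ≤ breaks G l + 1 := by
  obtain ⟨l₁, l₂, rfl⟩ := List.append_of_mem hx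
  refine ⟨(l₁ ++ [x]).reverse ++ l₂, ?_, by simp, ?_⟩
  · have := (List.reverse_perm (l₁ ++ [x])).append_right l₂
    simpa using this
  · have h1 := breaks_append_le (G := G) (l₁ ++ [x]).reverse l₂
    have h2 := breaks_append_ge (G := G) (l₁ ++ [x]) l₂
    rw [breaks_reverse] at h1
    simp only [List.append_assoc, List.cons_append, List.nil_append] at h2
    omega

theorem exists_perm_last (l : List V) {x : V} (hx : x ∈ l) :
    ∃ l' : List V, l'.Perm l ∧ l'.getLast? = some x ∧ breaks G l' ≤ breaks G l + 1 := by
  obtain ⟨l', h1, h2, h3⟩ := exists_perm_head (G := G) l hx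
  exact ⟨l'.reverse, (List.reverse_perm l').trans h1, by simpa using h2, by rwa [breaks_reverse]⟩

theorem exists_perm_head_last_aux (l₁ l₂ l₃ : List V) (x y : V) :
    ∃ l' : List V, l'.Perm (l₁ ++ x :: (l₂ ++ y :: l₃)) ∧ l'.head? = some x ∧
      l'.getLast? = some y ∧
      breaks G l' ≤ breaks G (l₁ ++ [x]) + breaks G l₂ + breaks G (y :: l₃) + 2 := by
  refine ⟨(l₁ ++ [x]).reverse ++ l₂ ++ (y :: l₃).reverse, ?_, by simp, by simp [List.getLast?_append, List.getLast?_cons], ?_⟩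
  · have := ((List.reverse_perm (l₁ ++ [x])).append_right l₂).append (List.reverse_perm (y :: l₃))
    refine this.trans (by simp)
  · have h1 := breaks_append_le (G := G) ((l₁ ++ [x]).reverse ++ l₂) (y :: l₃).reverse
    have h2 := breaks_append_le (G := G) (l₁ ++ [x]).reverse l₂
    rw [breaks_reverse] at h1 h2
    omega

theorem mem_split_two {l : List V} {x y : V} (hx : x ∈ l) (hy : y ∈ l) (hxy : x ≠ y) :
    (∃ l₁ l₂ l₃, l = l₁ ++ x :: (l₂ ++ y :: l₃)) ∨ (∃ l₁ l₂ l₃, l = l₁ ++ y :: (l₂ ++ x :: l₃)) := by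
  obtain ⟨l₁, l₂, rfl⟩ := List.append_of_mem hx
  rcases List.mem_append.1 hy with h | h
  · obtain ⟨a, b, rfl⟩ := List.append_of_mem h
    exact Or.inr ⟨a, b, l₂, by simp⟩
  · have : y ∈ l₂ := by
      rcases List.mem_cons.1 h with h | h
      · exact absurd h.symm hxy
      · exact h
    obtain ⟨a, b, rfl⟩ := List.append_of_mem this
    exact Or.inl ⟨l₁, a, b, by simp⟩

/-- Reordering so that two given vertices come first and last costs at most two breaks. -/
theorem exists_perm_head_last (l : List V) {x y : V} (hx : x ∈ l) (hy : y ∈ l) (hxy : x ≠ y) :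
    ∃ l' : List V, l'.Perm l ∧ l'.head? = some x ∧ l'.getLast? = some y ∧
      breaks G l' ≤ breaks G l + 2 := by
  have key : ∀ (l₁ l₂ l₃ : List V) (x y : V), ∃ l' : List V,
      l'.Perm (l₁ ++ x :: (l₂ ++ y :: l₃)) ∧ l'.head? = some x ∧ l'.getLast? = some y ∧
      breaks G l' ≤ breaks G (l₁ ++ x :: (l₂ ++ y :: l₃)) + 2 := by
    intro l₁ l₂ l₃ x y
    obtain ⟨l', h1, h2, h3, h4⟩ := exists_perm_head_last_aux (G := G) l₁ l₂ l₃ x y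
    refine ⟨l', h1, h2, h3, h4.trans ?_⟩
    have e1 := breaks_append_ge (G := G) (l₁ ++ [x]) (l₂ ++ y :: l₃)
    have e2 := breaks_append_ge (G := G) l₂ (y :: l₃)
    simp only [List.append_assoc, List.cons_append, List.nil_append] at e1
    omega
  rcases mem_split_two hx hy hxy with ⟨a, b, c, rfl⟩ | ⟨a, b, c, rfl⟩
  · exact key a b c x y
  · obtain ⟨l', h1, h2, h3, h4⟩ := key a b c y x
    exact ⟨l'.reverse, (List.reverse_perm l').trans h1, by simpa using h3, by simpa using h2,
      by rwa [breaks_reverse]⟩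

/-- If no earlier vertex is adjacent to `y`, then a reordering with `x` first and `y` last costs at
most one break. -/
theorem exists_perm_head_last_of_break {l₁ l₂ : List V} {x y : V} (hx : x ∈ l₁ ++ y :: l₂)
    (hxy : x ≠ y) (hy : ∀ z ∈ l₁, ¬ G.Adj z y) :
    ∃ l' : List V, l'.Perm (l₁ ++ y :: l₂) ∧ l'.head? = some x ∧ l'.getLast? = some y ∧
      breaks G l' ≤ breaks G (l₁ ++ y :: l₂) + 1 := by
  have hx' : x ∈ l₁ ∨ x ∈ l₂ := by simpa [hxy] using hx
  rcases hx' with h | h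
  · obtain ⟨a, b, rfl⟩ := List.append_of_mem h
    obtain ⟨l', h1, h2, h3, h4⟩ := exists_perm_head_last_aux (G := G) a b l₂ x y
    refine ⟨l', by simpa using h1, h2, h3, ?_⟩
    have e1 := breaks_append_eq (G := G) (l₂ := l₂) (by simp) hy
    have e2 := breaks_append_ge (G := G) (a ++ [x]) b
    simp only [List.append_assoc, List.cons_append, List.nil_append] at e1 e2 ⊢
    omega
  · obtain ⟨a, b, rfl⟩ := List.append_of_mem h
    refine ⟨(x :: b) ++ (l₁ ++ (y :: a).reverse), ?_, by simp, by simp [List.getLast?_append, List.getLast?_cons], ?_⟩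
    · have e1 : ((x :: b) ++ (l₁ ++ (y :: a).reverse)).Perm ((x :: b) ++ (l₁ ++ (y :: a))) :=
        ((List.reverse_perm _).append_left _).append_left _
      refine e1.trans (List.perm_append_comm.trans ?_)
      simp
    · by_cases hl : l₁ = []
      · subst hl
        have e1 := breaks_append_le (G := G) (x :: b) (y :: a).reverse
        have e2 := breaks_append_ge (G := G) (y :: a) (x :: b)
        rw [breaks_reverse] at e1
        simp only [List.nil_append, List.cons_append] at *
        omega
      · have e1 := breaks_append_le (G := G) (x :: b) (l₁ ++ (y :: a).reverse)
        have e2 := breaks_append_le (G := G) l₁ (y :: a).reverse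
        rw [breaks_reverse] at e2
        have e3 := breaks_append_eq (G := G) (l₂ := a ++ x :: b) hl hy
        have e4 := breaks_append_ge (G := G) (y :: a) (x :: b)
        simp only [List.cons_append] at *
        omega

end Lists

/-- No induced path on four vertices inside `H`. -/
def NoP4 {V : Type*} (G : SimpleGraph V) (H : Finset V) : Prop :=
  ∀ a ∈ H, ∀ b ∈ H, ∀ c ∈ H, ∀ d ∈ H, G.Adj a b → G.Adj b c → G.Adj c d →
    ¬ G.Adj a c → ¬ G.Adj a d → ¬ G.Adj b d → False

/-- Every proper nonempty part of `H` sends an edge to the rest of `H`. -/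
def Conn {V : Type*} (G : SimpleGraph V) (H : Finset V) : Prop :=
  ∀ X ⊆ H, X.Nonempty → X ≠ H → ∃ a ∈ X, ∃ b ∈ H, b ∉ X ∧ G.Adj a b

/-- `X` is a union of components of `H`. -/
def ClosedIn {V : Type*} (G : SimpleGraph V) (H X : Finset V) : Prop :=
  X ⊆ H ∧ ∀ a ∈ X, ∀ b ∈ H, G.Adj a b → b ∈ X

section Cographs

variable {V : Type*} {G : SimpleGraph V}

theorem NoP4.mono {H K : Finset V} (h : NoP4 G H) (hK : K ⊆ H) : NoP4 G K :=
  fun a ha b hb c hc d hd => h a (hK ha) b (hK hb) c (hK hc) d (hK hd)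

theorem NoP4.compl {H : Finset V} (h : NoP4 G H) : NoP4 Gᶜ H := by
  intro a ha b hb c hc d hd hab hbc hcd hac had hbd
  have h1 : a ≠ c := by rintro rfl; exact had hcd
  have h2 : a ≠ d := by rintro rfl; exact hac hcd.symm
  have h3 : b ≠ d := by rintro rfl; exact had hab
  simp only [compl_adj, not_and, not_not] at *
  exact h b hb d hd a ha c hc (hbd h3) (had h2).symm (hac h1) (fun e => hab.2 e.symm) hbc.2
    (fun e => hcd.2 e.symm)

theorem not_conn_iff {H : Finset V} :
    ¬ Conn G H ↔ ∃ X, ClosedIn G H X ∧ X.Nonempty ∧ X ≠ H := by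
  constructor
  · intro h
    simp only [Conn, not_forall] at h
    obtain ⟨X, h1, h2, h3, h4⟩ := h
    push Not at h4
    exact ⟨X, ⟨h1, fun a ha b hb hab => by_contra fun hn => h4 a ha b hb hn hab⟩, h2, h3⟩
  · rintro ⟨X, ⟨h1, h2⟩, h3, h4⟩ h
    obtain ⟨a, ha, b, hb, hn, hab⟩ := h X h1 h3 h4
    exact hn (h2 a ha b hb hab)

theorem Conn.subset_of_closedIn {H X K : Finset V} (hX : ClosedIn G H X) (hK : Conn G K)
    (hKH : K ⊆ H) [DecidableEq V] {u : V} (h1 : u ∈ K) (h2 : u ∈ X) : K ⊆ X := by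
  by_contra hn
  obtain ⟨a, ha, b, hb, hab, e⟩ := hK (K ∩ X) Finset.inter_subset_left ⟨u, by simp [h1, h2]⟩
    (fun e => hn (by rw [← e]; exact Finset.inter_subset_right))
  simp only [Finset.mem_inter] at ha hab
  exact hab ⟨hb, hX.2 a ha.2 b (hKH hb) e⟩

theorem ClosedIn.sdiff [DecidableEq V] {H X : Finset V} (h : ClosedIn G H X) :
    ClosedIn G H (H \ X) := by
  refine ⟨Finset.sdiff_subset, fun a ha b hb hab => ?_⟩
  simp only [Finset.mem_sdiff] at *
  exact ⟨hb, fun hn => ha.2 (h.2 b hn a ha.1 hab.symm)⟩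

theorem ClosedIn.trans {H X Y : Finset V} (h : ClosedIn G H X) (h' : ClosedIn G X Y) :
    ClosedIn G H Y :=
  ⟨h'.1.trans h.1, fun a ha b hb hab => h'.2 a ha b (h.2 a (h'.1 ha) b hb hab) hab⟩

/-- The component of a vertex. -/
theorem exists_component [DecidableEq V] {H : Finset V} {u : V} (hu : u ∈ H) :
    ∃ X, ClosedIn G H X ∧ u ∈ X ∧ Conn G X := by
  obtain ⟨X, hX⟩ := exists_minimal_of_wellFoundedLT
    (fun X : Finset V => ClosedIn G H X ∧ u ∈ X) ⟨H, ⟨subset_rfl, fun _ _ b hb _ => hb⟩, hu⟩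
  refine ⟨X, hX.1.1, hX.1.2, ?_⟩
  by_contra hc
  obtain ⟨Y, hY, hne, hYX⟩ := not_conn_iff.1 hc
  by_cases huY : u ∈ Y
  · exact hYX (hY.1.antisymm (hX.2 ⟨hX.1.1.trans hY, huY⟩ hY.1))
  · obtain ⟨y, hy⟩ := hne
    have := hX.2 ⟨hX.1.1.trans hY.sdiff, by simp [hX.1.2, huY]⟩ Finset.sdiff_subset (hY.1 hy)
    simp only [Finset.mem_sdiff] at this
    exact this.2 hy

theorem seinsche_step [DecidableEq V] {H : Finset V} {v : V} (hv : v ∉ H)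
    (hP : NoP4 G (insert v H)) (hH : ¬ Conn G H) :
    ¬ Conn G (insert v H) ∨ ¬ Conn Gᶜ (insert v H) := by
  obtain ⟨X₀, hX₀, hne, hX₀H⟩ := not_conn_iff.1 hH
  by_cases hcomp : ∀ u ∈ H, G.Adj v u
  · right
    refine not_conn_iff.2 ⟨{v}, ⟨by simp, ?_⟩, by simp, ?_⟩
    · intro a ha b hb hab
      simp only [Finset.mem_singleton, Finset.mem_insert] at *
      subst ha
      rcases hb with rfl | hb
      · rfl
      · exact absurd (hcomp b hb) hab.2
    · obtain ⟨x, hx⟩ := hne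
      intro e
      have : x ∈ ({v} : Finset V) := by rw [e]; simp [hX₀.1 hx]
      simp only [Finset.mem_singleton] at this
      exact hv (this ▸ hX₀.1 hx)
  push Not at hcomp
  obtain ⟨u, hu, hvu⟩ := hcomp
  left
  obtain ⟨X, hX, huX, hXc⟩ := exists_component (G := G) hu
  have hXH : ∃ c₀ ∈ H, c₀ ∉ X := by
    by_contra hall
    push Not at hall
    exact hH ((hX.1.antisymm hall) ▸ hXc)
  by_cases h1 : ∃ a ∈ X, G.Adj v a
  swap
  · push Not at h1
    refine not_conn_iff.2 ⟨X, ⟨hX.1.trans (Finset.subset_insert _ _), ?_⟩, ⟨u, huX⟩, ?_⟩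
    · intro a ha b hb hab
      rcases Finset.mem_insert.1 hb with rfl | hb
      · exact absurd hab.symm (h1 a ha)
      · exact hX.2 a ha b hb hab
    · rintro rfl
      exact hv (hX.1 (Finset.mem_insert_self _ _))
  by_cases h2 : ∃ c ∈ H \ X, G.Adj v c
  swap
  · push Not at h2
    refine not_conn_iff.2 ⟨H \ X, ⟨Finset.sdiff_subset.trans (Finset.subset_insert _ _), ?_⟩, ?_, ?_⟩
    · intro a ha b hb hab
      rcases Finset.mem_insert.1 hb with rfl | hb
      · exact absurd hab.symm (h2 a ha)
      · exact hX.sdiff.2 a ha b hb hab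
    · obtain ⟨c, hc, hcX⟩ := hXH
      exact ⟨c, by simp [hc, hcX]⟩
    · intro e
      have : v ∈ H \ X := by rw [e]; simp
      exact hv (Finset.sdiff_subset this)
  exfalso
  obtain ⟨a₀, ha₀, hva₀⟩ := h1
  obtain ⟨c, hc, hvc⟩ := h2
  classical
  obtain ⟨b, hb, a, ha, hab, e⟩ := hXc (X.filter fun a => G.Adj v a) (Finset.filter_subset _ _)
    ⟨a₀, by simp [ha₀, hva₀]⟩ (fun e => hvu (by rw [← e] at huX; exact (Finset.mem_filter.1 huX).2))
  simp only [Finset.mem_filter, Finset.mem_sdiff] at hb hab hc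
  have hav : ¬ G.Adj a v := fun h => hab ⟨ha, h.symm⟩
  refine hP a (by simp [hX.1 ha]) b (by simp [hX.1 hb.1]) v (by simp) c (by simp [hc.1]) e.symm
    hb.2.symm hvc hav (fun h => hc.2 (hX.2 a ha c hc.1 h)) (fun h => hc.2 (hX.2 b hb.1 c hc.1 h))

/-- A `P₄`-free graph with at least two vertices is disconnected or has disconnected complement. -/
theorem seinsche [DecidableEq V] {H : Finset V} : ∀ G : SimpleGraph V, NoP4 G H → 2 ≤ H.card →
    ¬ Conn G H ∨ ¬ Conn Gᶜ H := by
  induction H using Finset.induction_on with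
  | empty => intro G _ h; simp at h
  | insert v H hv ih =>
    intro G hP hcard
    rw [Finset.card_insert_of_notMem hv] at hcard
    by_cases h2 : 2 ≤ H.card
    · rcases ih G (hP.mono (Finset.subset_insert _ _)) h2 with h | h
      · exact seinsche_step hv hP h
      · have := seinsche_step hv hP.compl h
        rw [compl_compl] at this
        exact this.symm
    · obtain ⟨u, rfl⟩ := Finset.card_eq_one.1 (show H.card = 1 by omega)
      have huv : v ≠ u := by simpa using hv
      have hne : ({v} : Finset V) ≠ {v, u} := by
        intro e
        have : u ∈ ({v} : Finset V) := by rw [e]; simp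
        exact huv (Finset.mem_singleton.1 this).symm
      by_cases h : G.Adj v u
      · right
        refine not_conn_iff.2 ⟨{v}, ⟨by simp, ?_⟩, by simp, hne⟩
        intro a ha b hb hab
        simp only [Finset.mem_singleton, Finset.mem_insert] at *
        subst ha
        rcases hb with rfl | rfl
        · rfl
        · exact absurd h hab.2
      · left
        refine not_conn_iff.2 ⟨{v}, ⟨by simp, ?_⟩, by simp, hne⟩
        intro a ha b hb hab
        simp only [Finset.mem_singleton, Finset.mem_insert] at *
        subst ha
        rcases hb with rfl | rfl
        · rfl
        · exact absurd hab h

/-- A connected `P₄`-free graph that is not complete is the join of a disconnected graph and a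
nonempty graph. -/
theorem exists_join [DecidableEq V] {H : Finset V} (hP : NoP4 G H) (hc : Conn G H) {u w : V}
    (hu : u ∈ H) (hw : w ∈ H) (huw : u ≠ w) (hn : ¬ G.Adj u w) :
    ∃ A ⊆ H, ¬ Conn G A ∧ (H \ A).Nonempty ∧ ∀ a ∈ A, ∀ b ∈ H \ A, G.Adj a b := by
  obtain ⟨A, hA, huA, hAc⟩ := exists_component (G := Gᶜ) hu
  have hwA : w ∈ A := hA.2 u huA w hw (by simp [huw, hn])
  have h2 : 2 ≤ A.card := Finset.one_lt_card.2 ⟨u, huA, w, hwA, huw⟩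
  have hd : ¬ Conn G A := by
    rcases seinsche G (hP.mono hA.1) h2 with h | h
    · exact h
    · exact absurd hAc h
  refine ⟨A, hA.1, hd, ?_, ?_⟩
  · rw [Finset.sdiff_nonempty]
    intro h
    exact hd ((hA.1.antisymm h) ▸ hc)
  · intro a ha b hb
    rw [Finset.mem_sdiff] at hb
    by_contra h
    exact hb.2 (hA.2 a ha b hb.1 (by
      refine (compl_adj _ _ _).2 ⟨?_, h⟩
      rintro rfl
      exact hb.2 ha))

end Cographs

/-- A path given by its first vertex, its interior and its last vertex. -/
structure Seg (V : Type*) where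
  /-- The first vertex. -/
  s : V
  /-- The interior. -/
  p : List V
  /-- The last vertex. -/
  t : V

/-- The vertices of a segment, in order. -/
def Seg.all {V : Type*} (f : Seg V) : List V := f.s :: (f.p ++ [f.t])

/-- The reversed segment. -/
def Seg.rev {V : Type*} (f : Seg V) : Seg V := ⟨f.t, f.p.reverse, f.s⟩

/-- A system of disjoint segments with ends in `E` whose interiors partition `H`. -/
structure SegSys {V : Type*} (G : SimpleGraph V) (E H : Finset V) (Fs : List (Seg V)) : Prop where
  chain : ∀ f ∈ Fs, f.all.IsChain G.Adj
  p_ne : ∀ f ∈ Fs, f.p ≠ []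
  s_mem : ∀ f ∈ Fs, f.s ∈ E
  t_mem : ∀ f ∈ Fs, f.t ∈ E
  p_sub : ∀ f ∈ Fs, ∀ v ∈ f.p, v ∈ H
  nodup : (Fs.flatMap Seg.all).Nodup
  cover : ∀ v ∈ H, ∃ f ∈ Fs, v ∈ f.p

section Segments

variable {V : Type*} {G : SimpleGraph V}

@[simp] theorem Seg.all_rev (f : Seg V) : f.rev.all = f.all.reverse := by
  simp [Seg.all, Seg.rev]

theorem isChain_reverse {l : List V} (h : l.IsChain G.Adj) : l.reverse.IsChain G.Adj := by
  rw [List.isChain_reverse]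
  exact h.imp fun _ _ h => h.symm

theorem SegSys.perm {E H : Finset V} {Fs Fs' : List (Seg V)} (h : SegSys G E H Fs)
    (hp : Fs.Perm Fs') : SegSys G E H Fs' where
  chain f hf := h.chain f (hp.mem_iff.2 hf)
  p_ne f hf := h.p_ne f (hp.mem_iff.2 hf)
  s_mem f hf := h.s_mem f (hp.mem_iff.2 hf)
  t_mem f hf := h.t_mem f (hp.mem_iff.2 hf)
  p_sub f hf := h.p_sub f (hp.mem_iff.2 hf)
  nodup := (hp.flatMap_right Seg.all).nodup_iff.1 h.nodup
  cover v hv := by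
    obtain ⟨f, hf, hvf⟩ := h.cover v hv
    exact ⟨f, hp.mem_iff.1 hf, hvf⟩

theorem SegSys.rev_head {E H : Finset V} {f : Seg V} {Fs : List (Seg V)}
    (h : SegSys G E H (f :: Fs)) : SegSys G E H (f.rev :: Fs) where
  chain g hg := by
    rcases List.mem_cons.1 hg with rfl | hg
    · rw [Seg.all_rev]; exact isChain_reverse (h.chain f (by simp))
    · exact h.chain g (by simp [hg])
  p_ne g hg := by
    rcases List.mem_cons.1 hg with rfl | hg
    · simpa [Seg.rev] using h.p_ne f (by simp)
    · exact h.p_ne g (by simp [hg])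
  s_mem g hg := by
    rcases List.mem_cons.1 hg with rfl | hg
    · exact h.t_mem f (by simp)
    · exact h.s_mem g (by simp [hg])
  t_mem g hg := by
    rcases List.mem_cons.1 hg with rfl | hg
    · exact h.s_mem f (by simp)
    · exact h.t_mem g (by simp [hg])
  p_sub g hg := by
    rcases List.mem_cons.1 hg with rfl | hg
    · simpa [Seg.rev] using h.p_sub f (by simp)
    · exact h.p_sub g (by simp [hg])
  nodup := by
    have : ((f :: Fs).flatMap Seg.all).Perm ((f.rev :: Fs).flatMap Seg.all) := by
      simpa using (List.reverse_perm f.all).symm.append_right _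
    exact this.nodup_iff.1 h.nodup
  cover v hv := by
    obtain ⟨g, hg, hvg⟩ := h.cover v hv
    rcases List.mem_cons.1 hg with rfl | hg
    · exact ⟨g.rev, by simp, by simpa [Seg.rev] using hvg⟩
    · exact ⟨g, by simp [hg], hvg⟩

theorem SegSys.mono {E E' H : Finset V} {Fs : List (Seg V)} (h : SegSys G E H Fs)
    (hE : ∀ f ∈ Fs, f.s ∈ E' ∧ f.t ∈ E') : SegSys G E' H Fs :=
  { h with
    s_mem := fun f hf => (hE f hf).1
    t_mem := fun f hf => (hE f hf).2 }

theorem SegSys.mem_all {E H : Finset V} {Fs : List (Seg V)} (h : SegSys G E H Fs) {f : Seg V}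
    (hf : f ∈ Fs) {v : V} (hv : v ∈ f.all) : v ∈ E ∨ v ∈ H := by
  simp only [Seg.all, List.mem_cons, List.mem_append, List.not_mem_nil, or_false] at hv
  rcases hv with rfl | hv | rfl
  · exact Or.inl (h.s_mem f hf)
  · exact Or.inr (h.p_sub f hf v hv)
  · exact Or.inl (h.t_mem f hf)

theorem SegSys.append [DecidableEq V] {E₁ E₂ H₁ H₂ : Finset V} {Fs₁ Fs₂ : List (Seg V)}
    (h₁ : SegSys G E₁ H₁ Fs₁) (h₂ : SegSys G E₂ H₂ Fs₂) (hd : Disjoint (E₁ ∪ H₁) (E₂ ∪ H₂)) :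
    SegSys G (E₁ ∪ E₂) (H₁ ∪ H₂) (Fs₁ ++ Fs₂) where
  chain f hf := (List.mem_append.1 hf).elim (h₁.chain f) (h₂.chain f)
  p_ne f hf := (List.mem_append.1 hf).elim (h₁.p_ne f) (h₂.p_ne f)
  s_mem f hf := (List.mem_append.1 hf).elim (fun h => Finset.mem_union_left _ (h₁.s_mem f h))
    (fun h => Finset.mem_union_right _ (h₂.s_mem f h))
  t_mem f hf := (List.mem_append.1 hf).elim (fun h => Finset.mem_union_left _ (h₁.t_mem f h))
    (fun h => Finset.mem_union_right _ (h₂.t_mem f h))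
  p_sub f hf v hv := (List.mem_append.1 hf).elim
    (fun h => Finset.mem_union_left _ (h₁.p_sub f h v hv))
    (fun h => Finset.mem_union_right _ (h₂.p_sub f h v hv))
  nodup := by
    rw [List.flatMap_append]
    refine List.nodup_append'.2 ⟨h₁.nodup, h₂.nodup, ?_⟩
    intro v hv₁ hv₂
    obtain ⟨f, hf, hvf⟩ := List.mem_flatMap.1 hv₁
    obtain ⟨g, hg, hvg⟩ := List.mem_flatMap.1 hv₂
    exact Finset.disjoint_left.1 hd (Finset.mem_union.2 (h₁.mem_all hf hvf))
      (Finset.mem_union.2 (h₂.mem_all hg hvg))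
  cover v hv := by
    rcases Finset.mem_union.1 hv with hv | hv
    · obtain ⟨f, hf, h⟩ := h₁.cover v hv
      exact ⟨f, by simp [hf], h⟩
    · obtain ⟨f, hf, h⟩ := h₂.cover v hv
      exact ⟨f, by simp [hf], h⟩

theorem SegSys.nil (E : Finset V) : SegSys G E ∅ [] := by
  constructor <;> simp

theorem SegSys.merge_two [DecidableEq V] {E H : Finset V} {b : V} {f g : Seg V}
    {Fs : List (Seg V)} (h : SegSys G (insert b E) H (f :: g :: Fs)) (hb : b ∉ H) (hbE : b ∉ E)
    (hfb : f.s = b) (hg : ∀ a, g.p.head? = some a → G.Adj a b) :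
    SegSys G E (insert b H) (⟨g.t, g.p.reverse ++ b :: f.p, f.t⟩ :: Fs) := by
  obtain ⟨bb, P, t⟩ := f
  obtain ⟨s', P', t'⟩ := g
  simp only at hfb hg ⊢
  subst hfb
  have hnd := h.nodup
  have hc1 := h.chain _ (List.mem_cons_self)
  have hc2 := isChain_reverse (h.chain ⟨s', P', t'⟩ (by simp))
  obtain ⟨x, P', rfl⟩ := List.exists_cons_of_ne_nil (h.p_ne ⟨s', P', t'⟩ (by simp))
  have hx := hg x rfl
  have hne : ∀ v ∈ P ++ t :: s' :: x :: (P' ++ t' :: Fs.flatMap Seg.all), v ≠ bb := by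
    intro v hv e
    subst e
    simp [Seg.all] at hnd hv
    grind
  have hE : ∀ v ∈ insert bb E, v ≠ bb → v ∈ E := fun v hv hv' =>
    (Finset.mem_insert.1 hv).resolve_left hv'
  constructor
  · intro f hf
    rcases List.mem_cons.1 hf with rfl | hf
    · simp only [Seg.all, List.reverse_cons, List.reverse_append, List.append_assoc,
        List.cons_append, List.nil_append, List.reverse_nil] at hc1 hc2 ⊢
      have e1 : t' :: (P'.reverse ++ x :: bb :: (P ++ [t])) =
          (t' :: (P'.reverse ++ [x])) ++ (bb :: (P ++ [t])) := by simp
      have e2 : t' :: (P'.reverse ++ [x, s']) = (t' :: (P'.reverse ++ [x])) ++ [s'] := by simp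
      rw [e2] at hc2
      rw [e1, List.isChain_append]
      refine ⟨(List.isChain_append.1 hc2).1, hc1, ?_⟩
      intro u hu w hw
      have e3 : t' :: (P'.reverse ++ [x]) = (t' :: P'.reverse) ++ [x] := by simp
      rw [e3, List.getLast?_concat] at hu
      simp at hu hw
      subst hu hw
      exact hx
    · exact h.chain f (by simp [hf])
  · intro f hf
    rcases List.mem_cons.1 hf with rfl | hf
    · simp
    · exact h.p_ne f (by simp [hf])
  · intro f hf
    rcases List.mem_cons.1 hf with rfl | hf
    · exact hE _ (h.t_mem ⟨s', x :: P', t'⟩ (by simp)) (hne _ (by simp))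
    · refine hE _ (h.s_mem f (by simp [hf])) (hne _ ?_)
      have : f.s ∈ Fs.flatMap Seg.all := List.mem_flatMap.2 ⟨f, hf, by simp [Seg.all]⟩
      simp only [List.mem_append, List.mem_cons]; tauto
  · intro f hf
    rcases List.mem_cons.1 hf with rfl | hf
    · exact hE _ (h.t_mem ⟨bb, P, t⟩ (by simp)) (hne _ (by simp))
    · refine hE _ (h.t_mem f (by simp [hf])) (hne _ ?_)
      have : f.t ∈ Fs.flatMap Seg.all := List.mem_flatMap.2 ⟨f, hf, by simp [Seg.all]⟩
      simp only [List.mem_append, List.mem_cons]; tauto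
  · intro f hf v hv
    rcases List.mem_cons.1 hf with rfl | hf
    · simp only [List.mem_append, List.mem_reverse, List.mem_cons] at hv
      have a1 := h.p_sub ⟨bb, P, t⟩ (by simp) v
      have a2 := h.p_sub ⟨s', x :: P', t'⟩ (by simp) v
      simp only [List.mem_cons] at a1 a2
      simp only [Finset.mem_insert]; tauto
    · exact Finset.mem_insert_of_mem (h.p_sub f (by simp [hf]) v hv)
  · have hs : ((⟨t', (x :: P').reverse ++ bb :: P, t⟩ :: Fs : List (Seg V)).flatMap Seg.all).Perm
        ((bb :: (P ++ [t])) ++ (x :: (P' ++ [t'])) ++ Fs.flatMap Seg.all) := by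
      simp only [List.flatMap_cons]
      refine List.Perm.append_right _ ?_
      have e : Seg.all ⟨t', (x :: P').reverse ++ bb :: P, t⟩ =
          (x :: (P' ++ [t'])).reverse ++ (bb :: (P ++ [t])) := by simp [Seg.all]
      rw [e]
      exact ((List.reverse_perm _).append_right _).trans List.perm_append_comm
    refine hs.nodup_iff.2 (hnd.sublist ?_)
    simp only [List.flatMap_cons, Seg.all, List.append_assoc]
    refine List.Sublist.append (List.Sublist.refl _) ?_
    exact (List.Sublist.refl _).cons s'
  · intro v hv
    rcases Finset.mem_insert.1 hv with rfl | hv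
    · exact ⟨_, List.mem_cons_self, by simp⟩
    · obtain ⟨f, hf, hvf⟩ := h.cover v hv
      simp only [List.mem_cons] at hf
      rcases hf with rfl | rfl | hf
      · exact ⟨_, List.mem_cons_self, by simp at hvf ⊢; tauto⟩
      · exact ⟨_, List.mem_cons_self, by simp at hvf ⊢; tauto⟩
      · exact ⟨f, by simp [hf], hvf⟩

/-- Vertices complete to all interiors can be absorbed, each one joining two segments. -/
theorem SegSys.absorb [DecidableEq V] {E B : Finset V} : ∀ {H : Finset V} {Fs : List (Seg V)},
    SegSys G (E ∪ B) H Fs → Disjoint B H → Disjoint E B →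
    (∀ f ∈ Fs, ∀ a, (f.p.head? = some a ∨ f.p.getLast? = some a) → ∀ b ∈ B, G.Adj a b) →
    B.card < Fs.length →
    ∃ Fs', SegSys G E (H ∪ B) Fs' ∧ Fs'.length + B.card = Fs.length := by
  induction B using Finset.induction_on with
  | empty => intro H Fs h _ _ _ _; exact ⟨Fs, by simpa using h, by simp⟩
  | insert b B hb ih =>
    intro H Fs h hBH hEB hend hlt
    rw [Finset.card_insert_of_notMem hb] at hlt
    have hbH : b ∉ H := Finset.disjoint_left.1 hBH (by simp)
    have hbE : b ∉ E := fun e => Finset.disjoint_left.1 hEB e (by simp)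
    rw [Finset.union_insert] at h
    have hbEB : b ∉ E ∪ B := by simp [hb, hbE]
    -- bring a segment starting at `b` to the front
    have key : ∃ f Fs₀, SegSys G (insert b (E ∪ B)) H (f :: Fs₀) ∧ f.s = b ∧
        (∀ g ∈ f :: Fs₀, ∀ a, (g.p.head? = some a ∨ g.p.getLast? = some a) →
          ∀ b' ∈ insert b B, G.Adj a b') ∧ Fs₀.length + 1 = Fs.length := by
      by_cases hex : ∃ f ∈ Fs, f.s = b ∨ f.t = b
      · obtain ⟨f, hf, hfb⟩ := hex
        obtain ⟨r₁, r₂, rfl⟩ := List.append_of_mem hf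
        have h' := h.perm (List.perm_middle (a := f) (l₁ := r₁) (l₂ := r₂))
        rcases hfb with hfb | hfb
        · refine ⟨f, r₁ ++ r₂, h', hfb, ?_, by simp; omega⟩
          intro g hg
          exact hend g (List.perm_middle.mem_iff.2 hg)
        · refine ⟨f.rev, r₁ ++ r₂, h'.rev_head, hfb, ?_, by simp; omega⟩
          intro g hg a ha
          rcases List.mem_cons.1 hg with rfl | hg
          · exact hend f hf a (by simpa [Seg.rev, or_comm] using ha)
          · exact hend g (List.perm_middle.mem_iff.2 (by simp at hg ⊢; tauto)) a ha
      · push Not at hex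
        obtain ⟨f, Fs, rfl⟩ := List.exists_cons_of_ne_nil (l := Fs) (by rintro rfl; simp at hlt)
        refine ⟨⟨b, f.p, f.t⟩, Fs, ?_, rfl, ?_, by simp⟩
        · have hbnot : ∀ g ∈ f :: Fs, b ∉ g.all := by
            intro g hg hmem
            simp only [Seg.all, List.mem_cons, List.mem_append, List.not_mem_nil, or_false] at hmem
            rcases hmem with e | e | e
            · exact (hex g hg).1 e.symm
            · exact hbH (h.p_sub g hg b e)
            · exact (hex g hg).2 e.symm
          obtain ⟨x, P, hxP⟩ := List.exists_cons_of_ne_nil (h.p_ne f (by simp))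
          constructor
          · intro g hg
            rcases List.mem_cons.1 hg with rfl | hg
            · have hc := h.chain f (by simp)
              simp only [Seg.all, hxP, List.cons_append, List.isChain_cons_cons] at hc ⊢
              exact ⟨(hend f (by simp) x (by simp [hxP]) b (by simp)).symm, hc.2⟩
            · exact h.chain g (by simp [hg])
          · intro g hg
            rcases List.mem_cons.1 hg with rfl | hg
            · exact h.p_ne f (by simp)
            · exact h.p_ne g (by simp [hg])
          · intro g hg
            rcases List.mem_cons.1 hg with rfl | hg
            · simp
            · exact h.s_mem g (by simp [hg])
          · intro g hg
            rcases List.mem_cons.1 hg with rfl | hg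
            · exact h.t_mem f (by simp)
            · exact h.t_mem g (by simp [hg])
          · intro g hg
            rcases List.mem_cons.1 hg with rfl | hg
            · exact h.p_sub f (by simp)
            · exact h.p_sub g (by simp [hg])
          · have hnd := h.nodup
            simp only [List.flatMap_cons, Seg.all, List.cons_append, List.nodup_cons] at hnd ⊢
            refine ⟨?_, hnd.2⟩
            intro hmem
            rcases List.mem_append.1 hmem with e | e
            · exact hbnot f (by simp) (by simp only [Seg.all, List.mem_cons]; exact Or.inr e)
            · obtain ⟨g, hg, hbg⟩ := List.mem_flatMap.1 e
              exact hbnot g (by simp [hg]) hbg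
          · intro v hv
            obtain ⟨g, hg, hvg⟩ := h.cover v hv
            rcases List.mem_cons.1 hg with rfl | hg
            · exact ⟨_, List.mem_cons_self, hvg⟩
            · exact ⟨g, by simp [hg], hvg⟩
        · intro g hg
          rcases List.mem_cons.1 hg with rfl | hg
          · exact hend f (by simp)
          · exact hend g (by simp [hg])
    obtain ⟨f, Fs₀, h', hfb, hend', hlen⟩ := key
    obtain ⟨g, Fs₁, rfl⟩ := List.exists_cons_of_ne_nil (l := Fs₀) (by rintro rfl; simp at hlen; omega)
    have hm := h'.merge_two hbH hbEB hfb
      (fun a ha => hend' g (by simp) a (Or.inl ha) b (by simp))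
    obtain ⟨Fs', h1, h2⟩ := ih hm
      (by rw [Finset.disjoint_left] at hBH ⊢
          intro x hx
          simp only [Finset.mem_insert, not_or]
          exact ⟨fun e => hb (e ▸ hx), hBH (by simp [hx])⟩)
      (hEB.mono_right (Finset.subset_insert _ _))
      (by
        intro k hk a ha b' hb'
        rcases List.mem_cons.1 hk with rfl | hk
        · simp only at ha
          have hf0 := h'.p_ne f (by simp)
          have hg0 := h'.p_ne g (by simp)
          rcases ha with ha | ha
          · refine hend' g (by simp) a (Or.inr ?_) b' (by simp [hb'])
            obtain ⟨z, l, hz⟩ := List.exists_cons_of_ne_nil (l := g.p.reverse) (by simpa using hg0)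
            rw [hz] at ha
            rw [← List.head?_reverse, hz]
            simpa using ha
          · refine hend' f (by simp) a (Or.inr ?_) b' (by simp [hb'])
            obtain ⟨z, l, hz⟩ := List.exists_cons_of_ne_nil hf0
            rw [hz] at ha ⊢
            rw [← ha]
            simp [List.getLast?_append, List.getLast?_cons]
        · exact hend' k (by simp [hk]) a ha b' (by simp [hb']))
      (by simp at hlen ⊢; omega)
    refine ⟨Fs', ?_, ?_⟩
    · rwa [Finset.union_insert, ← Finset.insert_union]
    · rw [Finset.card_insert_of_notMem hb]
      simp at hlen h2; omega

end Segments

/-- A decomposition of `H` into a separating set `W` and modules `𝒬`, with an order `l` of `H`,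
such that admissible outer neighbours of the modules extend to a system of segments. -/
structure Good {V : Type*} (G : SimpleGraph V) (H W : Finset V) (𝒬 : Finset (Finset V))
    (l : List V) : Prop where
  W_sub : W ⊆ H
  nonempty : ∀ Q ∈ 𝒬, Q.Nonempty
  sub : ∀ Q ∈ 𝒬, Q ⊆ H
  conn : ∀ Q ∈ 𝒬, Conn G Q
  disjW : ∀ Q ∈ 𝒬, ∀ x ∈ Q, x ∉ W
  anti : ∀ Q ∈ 𝒬, ∀ Q' ∈ 𝒬, Q ≠ Q' → ∀ x ∈ Q, ∀ y ∈ Q', x ≠ y ∧ ¬ G.Adj x y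
  cover : ∀ x ∈ H, x ∈ W ∨ ∃ Q ∈ 𝒬, x ∈ Q
  mod : ∀ w ∈ W, ∀ Q ∈ 𝒬, (∀ x ∈ Q, G.Adj w x) ∨ (∀ x ∈ Q, ¬ G.Adj w x)
  nodup : l.Nodup
  mem : ∀ x, x ∈ l ↔ x ∈ H
  count : W.card + breaks G l + 1 ≤ 𝒬.card
  link : ∀ E : Finset V, Disjoint E H → ∀ f : Finset V → Bool → V,
    (∀ Q ∈ 𝒬, ∀ Q' ∈ 𝒬, ∀ i j, f Q i = f Q' j → Q = Q' ∧ i = j) →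
    (∀ Q ∈ 𝒬, ∀ i, f Q i ∈ E ∨ f Q i ∈ W) →
    (∀ Q ∈ 𝒬, ∀ x ∈ Q, G.Adj (f Q true) x) →
    (∀ Q ∈ 𝒬, ∃ x ∈ Q, G.Adj (f Q false) x) →
    ∃ Fs, SegSys G E H Fs ∧ Fs.length + W.card = 𝒬.card

section GoodLemmas

variable {V : Type*} {G : SimpleGraph V} [DecidableEq V]

omit [DecidableEq V] in
theorem good_leaf {H : Finset V} (hne : H.Nonempty) (hc : Conn G H) {l : List V} (hnd : l.Nodup)
    (hmem : ∀ x, x ∈ l ↔ x ∈ H) (hl : l.IsChain G.Adj)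
    (hrot : ∀ x ∈ H, ∃ l' : List V, l'.Perm l ∧ l'.IsChain G.Adj ∧ l'.head? = some x) :
    Good G H ∅ {H} l where
  W_sub := by simp
  nonempty := by simpa using hne
  sub := by simp
  conn := by simpa using hc
  disjW := by simp
  anti := by simp
  cover := by simp
  mod := by simp
  nodup := hnd
  mem := hmem
  count := by simp [(breaks_eq_zero_iff l).2 hl]
  link := by
    intro E hE f hinj hf htrue hfalse
    simp only [Finset.mem_singleton, forall_eq, Finset.notMem_empty, or_false] at *
    obtain ⟨x, hx, hfx⟩ := hfalse
    obtain ⟨l', h1, h2, h3⟩ := hrot x hx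
    have hl' : ∀ v ∈ l', v ∈ H := fun v hv => (hmem v).1 (h1.mem_iff.1 hv)
    obtain ⟨l'', rfl⟩ : ∃ l'', l' = x :: l'' := by
      cases l' with
      | nil => simp at h3
      | cons z l' => exact ⟨l', by simp at h3; rw [h3]⟩
    have hnE : ∀ i, f H i ∉ x :: l'' := fun i hi =>
      Finset.disjoint_left.1 hE (hf i) (hl' _ hi)
    refine ⟨[⟨f H false, x :: l'', f H true⟩], ?_, by simp⟩
    constructor
    · intro g hg
      obtain rfl := List.mem_singleton.1 hg
      simp only [Seg.all, List.cons_append, List.isChain_cons_cons]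
      refine ⟨hfx, ?_⟩
      have : x :: (l'' ++ [f H true]) = (x :: l'') ++ [f H true] := rfl
      rw [this, List.isChain_append]
      refine ⟨h2, by simp, ?_⟩
      intro u hu w hw
      simp only [List.head?_cons, Option.mem_def, Option.some.injEq] at hw
      subst hw
      exact (htrue u (hl' u (List.mem_of_getLast? hu))).symm
    · simp
    · simpa using hf false
    · simpa using hf true
    · simpa using hl'
    · have h4 : (x :: l'').Nodup := h1.nodup_iff.2 hnd
      have h5 : f H false ≠ f H true := fun e => by simpa using hinj _ _ e
      have a := hnE false
      have b := hnE true
      simp only [List.flatMap_cons, List.flatMap_nil, List.append_nil, Seg.all, List.nodup_cons,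
        List.mem_append, List.mem_singleton, not_or]
      refine ⟨⟨a, h5⟩, List.nodup_append'.2 ⟨h4, by simp, ?_⟩⟩
      simpa using b
    · intro v hv
      exact ⟨_, List.mem_singleton.2 rfl, h1.mem_iff.2 ((hmem v).2 hv)⟩

theorem Good.ssys_restrict {E H W : Finset V} {𝒬 : Finset (Finset V)} {l : List V}
    (h : Good G H W 𝒬 l) (hE : Disjoint E H) {f : Finset V → Bool → V}
    (hinj : ∀ Q ∈ 𝒬, ∀ Q' ∈ 𝒬, ∀ i j, f Q i = f Q' j → Q = Q' ∧ i = j)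
    (hf : ∀ Q ∈ 𝒬, ∀ i, f Q i ∈ E ∨ f Q i ∈ W)
    (htrue : ∀ Q ∈ 𝒬, ∀ x ∈ Q, G.Adj (f Q true) x)
    (hfalse : ∀ Q ∈ 𝒬, ∃ x ∈ Q, G.Adj (f Q false) x) :
    ∃ E' ⊆ E, (∀ v ∈ E', ∃ Q ∈ 𝒬, ∃ i, v = f Q i) ∧
      ∃ Fs, SegSys G E' H Fs ∧ Fs.length + W.card = 𝒬.card := by
  classical
  refine ⟨E.filter fun v => ∃ Q ∈ 𝒬, ∃ i, v = f Q i, Finset.filter_subset _ _,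
    fun v hv => (Finset.mem_filter.1 hv).2, ?_⟩
  refine h.link _ (hE.mono_left (Finset.filter_subset _ _)) f hinj ?_ htrue hfalse
  intro Q hQ i
  refine (hf Q hQ i).imp_left fun h => Finset.mem_filter.2 ⟨h, Q, hQ, i, rfl⟩

theorem Good.union {H₁ H₂ W₁ W₂ : Finset V} {𝒬₁ 𝒬₂ : Finset (Finset V)} {l₁ l₂ : List V}
    (h₁ : Good G H₁ W₁ 𝒬₁ l₁) (h₂ : Good G H₂ W₂ 𝒬₂ l₂) (hd : Disjoint H₁ H₂)
    (ha : ∀ x ∈ H₁, ∀ y ∈ H₂, ¬ G.Adj x y) :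
    Good G (H₁ ∪ H₂) (W₁ ∪ W₂) (𝒬₁ ∪ 𝒬₂) (l₁ ++ l₂) := by
  have hW : Disjoint W₁ W₂ := hd.mono h₁.W_sub h₂.W_sub
  have hd' := Finset.disjoint_left.1 hd
  have hQ : Disjoint 𝒬₁ 𝒬₂ := by
    rw [Finset.disjoint_left]
    intro Q hQ1 hQ2
    obtain ⟨x, hx⟩ := h₁.nonempty Q hQ1
    exact hd' (h₁.sub Q hQ1 hx) (h₂.sub Q hQ2 hx)
  constructor
  · exact Finset.union_subset_union h₁.W_sub h₂.W_sub
  · intro Q hQ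
    exact (Finset.mem_union.1 hQ).elim (h₁.nonempty Q) (h₂.nonempty Q)
  · intro Q hQ
    exact (Finset.mem_union.1 hQ).elim
      (fun h => (h₁.sub Q h).trans Finset.subset_union_left)
      (fun h => (h₂.sub Q h).trans Finset.subset_union_right)
  · intro Q hQ
    exact (Finset.mem_union.1 hQ).elim (h₁.conn Q) (h₂.conn Q)
  · intro Q hQ x hx hxW
    rcases Finset.mem_union.1 hQ with h | h <;> rcases Finset.mem_union.1 hxW with h' | h'
    · exact h₁.disjW Q h x hx h'
    · exact hd' (h₁.sub Q h hx) (h₂.W_sub h')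
    · exact hd' (h₁.W_sub h') (h₂.sub Q h hx)
    · exact h₂.disjW Q h x hx h'
  · intro Q hQ Q' hQ' hne x hx y hy
    rcases Finset.mem_union.1 hQ with h | h <;> rcases Finset.mem_union.1 hQ' with h' | h'
    · exact h₁.anti Q h Q' h' hne x hx y hy
    · have a := h₁.sub Q h hx
      have b := h₂.sub Q' h' hy
      exact ⟨by rintro rfl; exact hd' a b, ha x a y b⟩
    · have a := h₂.sub Q h hx
      have b := h₁.sub Q' h' hy
      exact ⟨by rintro rfl; exact hd' b a, fun e => ha y b x a e.symm⟩
    · exact h₂.anti Q h Q' h' hne x hx y hy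
  · intro x hx
    rcases Finset.mem_union.1 hx with h | h
    · rcases h₁.cover x h with h | ⟨Q, hQ, h⟩
      · exact Or.inl (Finset.mem_union_left _ h)
      · exact Or.inr ⟨Q, Finset.mem_union_left _ hQ, h⟩
    · rcases h₂.cover x h with h | ⟨Q, hQ, h⟩
      · exact Or.inl (Finset.mem_union_right _ h)
      · exact Or.inr ⟨Q, Finset.mem_union_right _ hQ, h⟩
  · intro w hw Q hQ
    rcases Finset.mem_union.1 hw with h | h <;> rcases Finset.mem_union.1 hQ with h' | h'
    · exact h₁.mod w h Q h'
    · exact Or.inr fun x hx => ha w (h₁.W_sub h) x (h₂.sub Q h' hx)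
    · exact Or.inr fun x hx e => ha x (h₁.sub Q h' hx) w (h₂.W_sub h) e.symm
    · exact h₂.mod w h Q h'
  · refine List.nodup_append'.2 ⟨h₁.nodup, h₂.nodup, ?_⟩
    intro x hx hx'
    exact hd' ((h₁.mem x).1 hx) ((h₂.mem x).1 hx')
  · intro x
    rw [List.mem_append, h₁.mem, h₂.mem, Finset.mem_union]
  · have a := h₁.count
    have b := h₂.count
    have c := breaks_append_le (G := G) l₁ l₂
    rw [Finset.card_union_of_disjoint hW, Finset.card_union_of_disjoint hQ]
    omega
  · intro E hE f hinj hf htrue hfalse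
    rw [Finset.disjoint_union_right] at hE
    have hf1 : ∀ Q ∈ 𝒬₁, ∀ i, ∃ x ∈ Q, G.Adj (f Q i) x := by
      intro Q hQ i
      cases i
      · exact hfalse Q (Finset.mem_union_left _ hQ)
      · obtain ⟨x, hx⟩ := h₁.nonempty Q hQ
        exact ⟨x, hx, htrue Q (Finset.mem_union_left _ hQ) x hx⟩
    have hf2 : ∀ Q ∈ 𝒬₂, ∀ i, ∃ x ∈ Q, G.Adj (f Q i) x := by
      intro Q hQ i
      cases i
      · exact hfalse Q (Finset.mem_union_right _ hQ)
      · obtain ⟨x, hx⟩ := h₂.nonempty Q hQ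
        exact ⟨x, hx, htrue Q (Finset.mem_union_right _ hQ) x hx⟩
    obtain ⟨E₁, hE₁, hE₁f, Fs₁, hS₁, hc₁⟩ := h₁.ssys_restrict hE.1 (f := f)
      (fun Q hQ Q' hQ' => hinj Q (Finset.mem_union_left _ hQ) Q' (Finset.mem_union_left _ hQ'))
      (by
        intro Q hQ i
        rcases hf Q (Finset.mem_union_left _ hQ) i with h | h
        · exact Or.inl h
        · rcases Finset.mem_union.1 h with h | h
          · exact Or.inr h
          · obtain ⟨x, hx, e⟩ := hf1 Q hQ i
            exact absurd e.symm (ha x (h₁.sub Q hQ hx) _ (h₂.W_sub h)))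
      (fun Q hQ => htrue Q (Finset.mem_union_left _ hQ))
      (fun Q hQ => hfalse Q (Finset.mem_union_left _ hQ))
    obtain ⟨E₂, hE₂, hE₂f, Fs₂, hS₂, hc₂⟩ := h₂.ssys_restrict hE.2 (f := f)
      (fun Q hQ Q' hQ' => hinj Q (Finset.mem_union_right _ hQ) Q' (Finset.mem_union_right _ hQ'))
      (by
        intro Q hQ i
        rcases hf Q (Finset.mem_union_right _ hQ) i with h | h
        · exact Or.inl h
        · rcases Finset.mem_union.1 h with h | h
          · obtain ⟨x, hx, e⟩ := hf2 Q hQ i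
            exact absurd e (ha _ (h₁.W_sub h) x (h₂.sub Q hQ hx))
          · exact Or.inr h)
      (fun Q hQ => htrue Q (Finset.mem_union_right _ hQ))
      (fun Q hQ => hfalse Q (Finset.mem_union_right _ hQ))
    refine ⟨Fs₁ ++ Fs₂, (hS₁.append hS₂ ?_).mono ?_, ?_⟩
    · rw [Finset.disjoint_left]
      intro v hv hv'
      rcases Finset.mem_union.1 hv with h | h <;> rcases Finset.mem_union.1 hv' with h' | h'
      · obtain ⟨Q, hQ, i, rfl⟩ := hE₁f v h
        obtain ⟨Q', hQ', j, e⟩ := hE₂f _ h'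
        have := (hinj Q (Finset.mem_union_left _ hQ) Q' (Finset.mem_union_right _ hQ') i j e).1
        exact Finset.disjoint_left.1 ‹Disjoint 𝒬₁ 𝒬₂› hQ (this ▸ hQ')
      · exact Finset.disjoint_left.1 hE.2 (hE₁ h) h'
      · exact Finset.disjoint_left.1 hE.1 (hE₂ h') h
      · exact hd' h h'
    · intro g hg
      rcases List.mem_append.1 hg with h | h
      · exact ⟨hE₁ (hS₁.s_mem g h), hE₁ (hS₁.t_mem g h)⟩
      · exact ⟨hE₂ (hS₂.s_mem g h), hE₂ (hS₂.t_mem g h)⟩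
    · rw [Finset.card_union_of_disjoint hW, Finset.card_union_of_disjoint ‹Disjoint 𝒬₁ 𝒬₂›,
        List.length_append]
      omega

/-- Joining a set `B` of at most `breaks l` vertices to a decomposed set. -/
theorem Good.join {A B W : Finset V} {𝒬 : Finset (Finset V)} {l : List V}
    (h : Good G A W 𝒬 l) (hd : Disjoint A B) (hAB : ∀ a ∈ A, ∀ b ∈ B, G.Adj a b)
    (hle : B.card ≤ breaks G l) :
    ∃ l', Good G (A ∪ B) (W ∪ B) 𝒬 l' ∧ breaks G l' + B.card = breaks G l := by
  obtain ⟨l', hp, hb, -⟩ := exists_fill_breaks (G := G) l B.toList (by simpa using hle)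
    (fun b hb a ha => hAB a ((h.mem a).1 ha) b (by simpa using hb))
  simp only [Finset.length_toList] at hb
  have hd' := Finset.disjoint_left.1 hd
  have hWB : Disjoint W B := hd.mono_left h.W_sub
  refine ⟨l', ?_, hb⟩
  constructor
  · exact Finset.union_subset_union h.W_sub subset_rfl
  · exact h.nonempty
  · exact fun Q hQ => (h.sub Q hQ).trans Finset.subset_union_left
  · exact h.conn
  · intro Q hQ x hx hxW
    rcases Finset.mem_union.1 hxW with h' | h'
    · exact h.disjW Q hQ x hx h'
    · exact hd' (h.sub Q hQ hx) h'
  · exact h.anti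
  · intro x hx
    rcases Finset.mem_union.1 hx with h' | h'
    · exact (h.cover x h').imp_left (Finset.mem_union_left _)
    · exact Or.inl (Finset.mem_union_right _ h')
  · intro w hw Q hQ
    rcases Finset.mem_union.1 hw with h' | h'
    · exact h.mod w h' Q hQ
    · exact Or.inl fun x hx => (hAB x (h.sub Q hQ hx) w h').symm
  · refine hp.nodup_iff.2 (List.nodup_append'.2 ⟨h.nodup, B.nodup_toList, ?_⟩)
    intro x hx hx'
    exact hd' ((h.mem x).1 hx) (by simpa using hx')
  · intro x
    rw [hp.mem_iff, List.mem_append, h.mem, Finset.mem_toList, Finset.mem_union]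
  · have := h.count
    rw [Finset.card_union_of_disjoint hWB]
    omega
  · intro E hE f hinj hf htrue hfalse
    rw [Finset.disjoint_union_right] at hE
    obtain ⟨Fs, hS, hc⟩ := h.link (E ∪ B) (Finset.disjoint_union_left.2 ⟨hE.1, hd.symm⟩) f hinj
      (by
        intro Q hQ i
        have := hf Q hQ i
        simp only [Finset.mem_union] at *
        tauto) htrue hfalse
    have := h.count
    obtain ⟨Fs', hS', hc'⟩ := hS.absorb hd.symm hE.2 (by
      intro g hg a ha b hb
      refine hAB a (hS.p_sub g hg a ?_) b hb
      rcases ha with ha | ha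
      · exact List.mem_of_head? ha
      · exact List.mem_of_getLast? ha) (by omega)
    refine ⟨Fs', hS', ?_⟩
    rw [Finset.card_union_of_disjoint hWB]
    omega

end GoodLemmas

/-- `l` lists the vertices of `H`. -/
def IsOrder {V : Type*} (H : Finset V) (l : List V) : Prop := l.Nodup ∧ ∀ x, x ∈ l ↔ x ∈ H

/-- Any two vertices of `H` are joined by a path through all of `H`. -/
def HamConn {V : Type*} (G : SimpleGraph V) (H : Finset V) : Prop :=
  ∀ x ∈ H, ∀ y ∈ H, x ≠ y → ∃ l, IsOrder H l ∧ l.IsChain G.Adj ∧ l.head? = some x ∧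
    l.getLast? = some y

/-- `H` is the join of a disconnected set `A` and a set `B`, where the decomposition of `A` has an
order with exactly `|B| - 1` breaks. -/
def TightJoin {V : Type*} (G : SimpleGraph V) (H : Finset V) : Prop :=
  ∃ A B : Finset V, (∀ x, x ∈ H ↔ x ∈ A ∨ x ∈ B) ∧ ¬ Conn G A ∧ (∀ a ∈ A, ∀ b ∈ B, G.Adj a b) ∧
    (∃ W 𝒬 l, Good G A W 𝒬 l ∧ breaks G l + 1 = B.card) ∧
    ∃ l, IsOrder B l ∧ breaks G l + 1 ≤ A.card

/-- `H` is the join of a disconnected set `A`, decomposed with order `l`, and a nonempty set. -/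
def JoinPiece {V : Type*} [DecidableEq V] (G : SimpleGraph V) (H A : Finset V) (l : List V) :
    Prop :=
  A ⊆ H ∧ ¬ Conn G A ∧ (H \ A).Nonempty ∧ (∀ a ∈ A, ∀ b ∈ H \ A, G.Adj a b) ∧
    ∃ W 𝒬, Good G A W 𝒬 l

section Main

theorem exists_max_of_bounded {α : Type*} {P : α → Prop} {f : α → ℕ} {N : ℕ} (h : ∃ a, P a)
    (hN : ∀ a, P a → f a ≤ N) : ∃ a, P a ∧ ∀ b, P b → f b ≤ f a := by
  obtain ⟨a₀, ha₀⟩ := h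
  have hb : BddAbove {n | ∃ a, P a ∧ f a = n} := ⟨N, by rintro _ ⟨a, ha, rfl⟩; exact hN a ha⟩
  obtain ⟨a, ha, hfa⟩ := Nat.sSup_mem (s := {n | ∃ a, P a ∧ f a = n}) ⟨_, a₀, ha₀, rfl⟩ hb
  exact ⟨a, ha, fun b hPb => hfa ▸ le_csSup hb ⟨b, hPb, rfl⟩⟩

variable {V : Type*} {G : SimpleGraph V}

theorem IsOrder.perm {H : Finset V} {l l' : List V} (h : IsOrder H l) (hp : l'.Perm l) :
    IsOrder H l' :=
  ⟨hp.nodup_iff.2 h.1, fun x => hp.mem_iff.trans (h.2 x)⟩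

theorem IsOrder.length_eq [DecidableEq V] {H : Finset V} {l : List V} (h : IsOrder H l) :
    l.length = H.card := by
  rw [← List.toFinset_card_of_nodup h.1]
  congr 1
  ext x
  simp [h.2 x]

theorem IsOrder.append {A B H : Finset V} {l₁ l₂ : List V} (h₁ : IsOrder A l₁)
    (h₂ : IsOrder B l₂) (hd : ∀ x ∈ A, x ∉ B) (hH : ∀ x, x ∈ H ↔ x ∈ A ∨ x ∈ B) :
    IsOrder H (l₁ ++ l₂) := by
  refine ⟨List.nodup_append'.2 ⟨h₁.1, h₂.1, ?_⟩, ?_⟩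
  · intro x hx hx'
    exact hd x ((h₁.2 x).1 hx) ((h₂.2 x).1 hx')
  · intro x
    rw [List.mem_append, h₁.2, h₂.2, hH]

theorem isChain_of_clique {H : Finset V} (hcl : ∀ x ∈ H, ∀ y ∈ H, x ≠ y → G.Adj x y)
    {l : List V} (h : IsOrder H l) : l.IsChain G.Adj := by
  have : l.Pairwise G.Adj := by
    refine List.Pairwise.imp_of_mem ?_ h.1
    intro a b ha hb hab
    exact hcl a ((h.2 a).1 ha) b ((h.2 b).1 hb) hab
  exact this.isChain

theorem exists_rotation {l : List V} (hl : l.IsChain G.Adj)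
    (hc : ∀ u ∈ l.getLast?, ∀ v ∈ l.head?, G.Adj u v) {x : V} (hx : x ∈ l) :
    ∃ l' : List V, l'.Perm l ∧ l'.IsChain G.Adj ∧ l'.head? = some x := by
  obtain ⟨l₁, l₂, rfl⟩ := List.append_of_mem hx
  rw [List.isChain_append] at hl
  refine ⟨(x :: l₂) ++ l₁, List.perm_append_comm, ?_, rfl⟩
  rw [List.isChain_append]
  refine ⟨hl.2.1, hl.1, ?_⟩
  intro u hu v hv
  refine hc u ?_ v ?_
  · simp only [Option.mem_def, List.getLast?_append] at hu ⊢
    simp [hu]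
  · simp only [Option.mem_def, List.head?_append] at hv ⊢
    simp [hv]

theorem hamConn_of_breaks [DecidableEq V] {H A B : Finset V} (hH : ∀ x, x ∈ H ↔ x ∈ A ∨ x ∈ B)
    (hAB : ∀ a ∈ A, ∀ b ∈ B, G.Adj a b) {lA lB : List V} (hA : IsOrder A lA) (hB : IsOrder B lB)
    (h₁ : breaks G lA + 2 ≤ B.card) (h₂ : breaks G lB + 2 ≤ A.card) : HamConn G H := by
  have hd : ∀ x ∈ A, x ∉ B := fun x hx hx' => (hAB x hx x hx').ne rfl
  have hAne : lA ≠ [] := by rintro rfl; have := hA.length_eq; simp at this; omega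
  have hBne : lB ≠ [] := by rintro rfl; have := hB.length_eq; simp at this; omega
  have ne_of : ∀ {l l' : List V}, l'.Perm l → l ≠ [] → l' ≠ [] := by
    rintro l l' hp hl rfl
    exact hl hp.nil_eq.symm
  have mixed : ∀ x ∈ A, ∀ y ∈ B, ∃ l, IsOrder H l ∧ l.IsChain G.Adj ∧ l.head? = some x ∧
      l.getLast? = some y := by
    intro x hx y hy
    obtain ⟨l₁, p1, q1, r1⟩ := exists_perm_head (G := G) lA ((hA.2 x).2 hx)
    obtain ⟨l₂, p2, q2, r2⟩ := exists_perm_last (G := G) lB ((hB.2 y).2 hy)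
    have o1 := hA.perm p1
    have o2 := hB.perm p2
    obtain ⟨l, a1, a2, a3, a4⟩ := (exists_weave (G := G) _ l₁ l₂ le_rfl
      (fun a ha b hb => hAB a ((o1.2 a).1 ha) b ((o2.2 b).1 hb)) (ne_of p1 hAne)
      (ne_of p2 hBne)).1 (by rw [o2.length_eq]; omega) (by rw [o1.length_eq]; omega)
    exact ⟨l, (o1.append o2 hd hH).perm a1, a2, a3.trans q1, a4.trans q2⟩
  have same : ∀ {A B : Finset V} {lA lB : List V}, (∀ x, x ∈ H ↔ x ∈ A ∨ x ∈ B) →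
      (∀ a ∈ A, ∀ b ∈ B, G.Adj a b) → IsOrder A lA → IsOrder B lB → breaks G lA + 2 ≤ B.card →
      breaks G lB + 2 ≤ A.card → lA ≠ [] → lB ≠ [] → (∀ x ∈ A, x ∉ B) →
      ∀ x ∈ A, ∀ y ∈ A, x ≠ y → ∃ l, IsOrder H l ∧ l.IsChain G.Adj ∧ l.head? = some x ∧
      l.getLast? = some y := by
    intro A B lA lB hH hAB hA hB h₁ h₂ hAne hBne hd x hx y hy hxy
    obtain ⟨l₁, p1, q1, q1', r1⟩ := exists_perm_head_last (G := G) lA ((hA.2 x).2 hx)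
      ((hA.2 y).2 hy) hxy
    have o1 := hA.perm p1
    obtain ⟨l, a1, a2, a3, a4⟩ := (exists_weave (G := G) _ l₁ lB le_rfl
      (fun a ha b hb => hAB a ((o1.2 a).1 ha) b ((hB.2 b).1 hb)) (ne_of p1 hAne)
      hBne).2 (by rw [hB.length_eq]; omega) (by rw [o1.length_eq]; omega)
    exact ⟨l, (o1.append hB hd hH).perm a1, a2, a3.trans q1, a4.trans q1'⟩
  intro x hx y hy hxy
  rcases (hH x).1 hx with hx | hx <;> rcases (hH y).1 hy with hy | hy
  · exact same hH hAB hA hB h₁ h₂ hAne hBne hd x hx y hy hxy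
  · exact mixed x hx y hy
  · obtain ⟨l, a1, a2, a3, a4⟩ := mixed y hy x hx
    exact ⟨l.reverse, a1.perm (List.reverse_perm l), isChain_reverse a2, by simpa using a4,
      by simpa using a3⟩
  · exact same (fun x => (hH x).trans or_comm) (fun b hb a ha => (hAB a ha b hb).symm) hB hA h₂ h₁
      hBne hAne (fun x hx hx' => hd x hx' hx) x hx y hy hxy

theorem exists_good [DecidableEq V] (H : Finset V) : H.Nonempty → NoP4 G H →
    ∃ W 𝒬 l, Good G H W 𝒬 l ∧ (Conn G H →
      (W.Nonempty ∧ (∀ Q ∈ 𝒬, ∃ w ∈ W, ∀ x ∈ Q, G.Adj w x) ∧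
        ∃ A l', JoinPiece G H A l' ∧ (H \ A).card + breaks G l ≤ breaks G l') ∨
      (W = ∅ ∧ 𝒬 = {H} ∧ breaks G l = 0 ∧ (HamConn G H ∨ TightJoin G H))) := by
  induction H using Finset.strongInduction with
  | H H ih =>
  intro hne hP
  by_cases hc : Conn G H
  swap
  · obtain ⟨X, hX, hXne, hXH⟩ := not_conn_iff.1 hc
    have hXss : X ⊂ H := lt_of_le_of_ne hX.1 hXH
    have hYne : (H \ X).Nonempty := by
      rw [Finset.sdiff_nonempty]
      exact fun h => hXH (hX.1.antisymm h)
    have hYss : H \ X ⊂ H := Finset.sdiff_ssubset hX.1 hXne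
    obtain ⟨W₁, 𝒬₁, l₁, h₁, -⟩ := ih X hXss hXne (hP.mono hX.1)
    obtain ⟨W₂, 𝒬₂, l₂, h₂, -⟩ := ih (H \ X) hYss hYne (hP.mono Finset.sdiff_subset)
    have := h₁.union h₂ Finset.disjoint_sdiff (by
      intro x hx y hy e
      rw [Finset.mem_sdiff] at hy
      exact hy.2 (hX.2 x hx y hy.1 e))
    rw [Finset.union_sdiff_of_subset hX.1] at this
    exact ⟨_, _, _, this, fun h => absurd h hc⟩
  by_cases hcl : ∀ x ∈ H, ∀ y ∈ H, x ≠ y → G.Adj x y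
  · have ho : IsOrder H H.toList := ⟨H.nodup_toList, by simp⟩
    refine ⟨∅, {H}, H.toList, good_leaf hne hc ho.1 ho.2 (isChain_of_clique hcl ho) ?_, fun _ =>
      Or.inr ⟨rfl, rfl, (breaks_eq_zero_iff _).2 (isChain_of_clique hcl ho), Or.inl ?_⟩⟩
    · intro x hx
      obtain ⟨l, h1, h2, -⟩ := exists_perm_head (G := G) H.toList (by simpa using hx)
      exact ⟨l, h1, isChain_of_clique hcl (ho.perm h1), h2⟩
    · intro x hx y hy hxy
      obtain ⟨l, h1, h2, h3, -⟩ := exists_perm_head_last (G := G) H.toList (by simpa using hx)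
        (by simpa using hy) hxy
      exact ⟨l, ho.perm h1, isChain_of_clique hcl (ho.perm h1), h2, h3⟩
  push Not at hcl
  obtain ⟨u, hu, w, hw, huw, hnadj⟩ := hcl
  have hAne : ∀ A : Finset V, ¬ Conn G A → A.Nonempty := by
    intro A hA
    obtain ⟨X, hX, hXne, -⟩ := not_conn_iff.1 hA
    exact hXne.mono hX.1
  have hA2 : ∀ A : Finset V, ¬ Conn G A → 2 ≤ A.card := by
    intro A hA
    obtain ⟨X, hX, hXne, hXA⟩ := not_conn_iff.1 hA
    have := Finset.card_lt_card (lt_of_le_of_ne hX.1 hXA)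
    have := hXne.card_pos
    omega
  have hex : ∃ a : Finset V × List V, JoinPiece G H a.1 a.2 := by
    obtain ⟨A, hAH, hAd, hB, hAB⟩ := exists_join hP hc hu hw huw hnadj
    have hss : A ⊂ H := by
      refine lt_of_le_of_ne hAH ?_
      rintro rfl
      simp at hB
    obtain ⟨W, 𝒬, l, h, -⟩ := ih A hss (hAne A hAd) (hP.mono hAH)
    exact ⟨(A, l), hAH, hAd, hB, hAB, W, 𝒬, h⟩
  obtain ⟨⟨A, lA⟩, hAp, hmax⟩ := exists_max_of_bounded (f := fun a : Finset V × List V =>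
    breaks G a.2 + a.1.card) (N := 2 * H.card) hex (by
    rintro ⟨A, l⟩ ⟨hAH, hAd, -, -, W, 𝒬, h⟩
    have hl : IsOrder A l := ⟨h.nodup, h.mem⟩
    have h1 := hl.length_eq
    have h2 := breaks_lt_length (G := G) (l := l) (by
      rintro rfl
      have := hA2 A hAd
      simp at h1; omega)
    have h3 := Finset.card_le_card hAH
    change breaks G l + A.card ≤ 2 * H.card
    change A.card ≤ H.card at h3
    omega)
  have hAp' := hAp
  obtain ⟨hAH, hAd, hBne, hAB, W, 𝒬, hA⟩ := hAp
  simp only [Prod.forall] at hmax hAH hAd hBne hAB hA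
  have hAss : A ⊂ H := by
    refine lt_of_le_of_ne hAH ?_
    rintro rfl
    simp at hBne
  have hHB : A ∪ (H \ A) = H := Finset.union_sdiff_of_subset hAH
  have hH : ∀ x, x ∈ H ↔ x ∈ A ∨ x ∈ H \ A := fun x => by rw [← Finset.mem_union, hHB]
  by_cases hU : (H \ A).card ≤ breaks G lA
  · obtain ⟨l, hl, hb⟩ := hA.join Finset.disjoint_sdiff hAB hU
    rw [hHB] at hl
    refine ⟨_, _, l, hl, fun _ => Or.inl ⟨hBne.mono Finset.subset_union_right, ?_, A, lA, hAp',
      by omega⟩⟩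
    intro Q hQ
    obtain ⟨b, hb⟩ := hBne
    exact ⟨b, Finset.mem_union_right _ hb, fun x hx => (hAB x (hA.sub Q hQ hx) b hb).symm⟩
  have hBss : H \ A ⊂ H := Finset.sdiff_ssubset hAH (hAne A hAd)
  obtain ⟨WB, 𝒬B, lB, hB, hBc⟩ := ih (H \ A) hBss hBne (hP.mono Finset.sdiff_subset)
  have hcardA := hA2 A hAd
  have key : breaks G lB + (H \ A).card ≤ breaks G lA + A.card ∨ breaks G lB = 0 := by
    by_cases hBconn : Conn G (H \ A)
    · rcases hBc hBconn with ⟨-, -, A', l', ⟨hA'B, hA'd, hne', hA'c, hg⟩, hle⟩ | ⟨-, -, h0, -⟩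
      · left
        have hA'H := hA'B.trans (Finset.sdiff_subset (s := H) (t := A))
        have := hmax A' l' ⟨hA'H, hA'd, ?_, ?_, hg⟩
        · rw [Finset.card_sdiff_of_subset hA'B] at hle
          have := Finset.card_le_card hA'B
          omega
        · refine hne'.mono (Finset.sdiff_subset_sdiff Finset.sdiff_subset subset_rfl)
        · intro a ha b hb
          rw [Finset.mem_sdiff] at hb
          by_cases hbA : b ∈ A
          · exact (hAB b hbA a (hA'B ha)).symm
          · exact hA'c a ha b (by simp [hb, hbA])
      · exact Or.inr h0
    · left
      refine hmax (H \ A) lB ⟨Finset.sdiff_subset, hBconn, ?_, ?_, WB, 𝒬B, hB⟩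
      · rw [Finset.sdiff_sdiff_eq_self hAH]; exact hAne A hAd
      · rw [Finset.sdiff_sdiff_eq_self hAH]
        exact fun b hb a ha => (hAB a ha b hb).symm
  have oA : IsOrder A lA := ⟨hA.nodup, hA.mem⟩
  have oB : IsOrder (H \ A) lB := ⟨hB.nodup, hB.mem⟩
  have hlA : lA ≠ [] := by rintro rfl; have := oA.length_eq; simp at this; omega
  have hlB : lB ≠ [] := by
    rintro rfl
    have h1 := oB.length_eq
    have h2 := hBne.card_pos
    simp at h1 h2; omega
  have hdAB : ∀ x ∈ A, x ∉ H \ A := fun x hx => by simp [hx]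
  obtain ⟨l, p1, p2, p3, p4⟩ := (exists_weave (G := G) _ lA lB le_rfl
    (fun a ha b hb => hAB a ((hA.mem a).1 ha) b ((hB.mem b).1 hb)) hlA hlB).1
    (by rw [oB.length_eq]; omega) (by rw [oA.length_eq]; omega)
  have oH : IsOrder H l := (oA.append oB hdAB hH).perm p1
  refine ⟨∅, {H}, l, good_leaf hne hc oH.1 oH.2 p2 ?_, fun _ =>
    Or.inr ⟨rfl, rfl, (breaks_eq_zero_iff _).2 p2, ?_⟩⟩
  · intro x hx
    refine exists_rotation p2 ?_ ((oH.2 x).2 hx)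
    intro a ha b hb
    rw [p4] at ha
    rw [p3] at hb
    exact (hAB b ((hA.mem b).1 (List.mem_of_head? hb)) a
      ((hB.mem a).1 (List.mem_of_getLast? ha))).symm
  · by_cases hT : breaks G lA + 1 = (H \ A).card
    · exact Or.inr ⟨A, H \ A, hH, hAd, hAB, ⟨W, 𝒬, lA, hA, hT⟩, lB, oB, by omega⟩
    · exact Or.inl (hamConn_of_breaks hH hAB oA oB (by omega) (by omega))

end Main

/-- A minimal cutset `S` of a `4.5`-tough `(P₄ ∪ P₁)`-free graph, together with the components
`𝒟` of the rest. -/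
structure Setting {V : Type*} (G : SimpleGraph V) (S : Finset V) (𝒟 : Finset (Finset V)) :
    Prop where
  free : ∀ a b c d e, G.Adj a b → G.Adj b c → G.Adj c d → ¬ G.Adj a c → ¬ G.Adj a d →
    ¬ G.Adj b d → ¬ G.Adj e a → ¬ G.Adj e b → ¬ G.Adj e c → ¬ G.Adj e d → False
  tough : ∀ (T : Finset V) (𝒦 : Finset (Finset V)), 2 ≤ 𝒦.card → (∀ K ∈ 𝒦, K.Nonempty) →
    (∀ K ∈ 𝒦, ∀ x ∈ K, x ∉ T) → (∀ K ∈ 𝒦, ∀ K' ∈ 𝒦, K ≠ K' → ∀ x ∈ K, x ∉ K') →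
    (∀ K ∈ 𝒦, ∀ x ∈ K, ∀ y, y ∉ T → G.Adj x y → y ∈ K) → 9 * 𝒦.card ≤ 2 * T.card
  two : 2 ≤ 𝒟.card
  nonempty : ∀ D ∈ 𝒟, D.Nonempty
  conn : ∀ D ∈ 𝒟, Conn G D
  notMem : ∀ D ∈ 𝒟, ∀ x ∈ D, x ∉ S
  disj : ∀ D ∈ 𝒟, ∀ D' ∈ 𝒟, D ≠ D' → ∀ x ∈ D, x ∉ D'
  closed : ∀ D ∈ 𝒟, ∀ x ∈ D, ∀ y, y ∉ S → G.Adj x y → y ∈ D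
  cover : ∀ x, x ∉ S → ∃ D ∈ 𝒟, x ∈ D
  touch : ∀ s ∈ S, ∀ D ∈ 𝒟, ∃ x ∈ D, G.Adj s x

section Setup

variable {V : Type*} {G : SimpleGraph V}

theorem P4P1Free.false_of (h : P4P1Free G) {a b c d e : V} (hab : G.Adj a b) (hbc : G.Adj b c)
    (hcd : G.Adj c d) (hac : ¬ G.Adj a c) (had : ¬ G.Adj a d) (hbd : ¬ G.Adj b d)
    (hea : ¬ G.Adj e a) (heb : ¬ G.Adj e b) (hec : ¬ G.Adj e c) (hed : ¬ G.Adj e d) : False := by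
  have n1 : a ≠ c := by rintro rfl; exact had hcd
  have n2 : a ≠ d := by rintro rfl; exact hac hcd.symm
  have n3 : b ≠ d := by rintro rfl; exact had hab
  have n4 : e ≠ a := by rintro rfl; exact heb hab
  have n5 : e ≠ b := by rintro rfl; exact hea hab.symm
  have n6 : e ≠ c := by rintro rfl; exact hed hcd
  have n7 : e ≠ d := by rintro rfl; exact hec hcd.symm
  have m1 := hab.ne
  have m2 := hbc.ne
  have m3 := hcd.ne
  have hae : ¬ G.Adj a e := fun h => hea h.symm
  have hbe : ¬ G.Adj b e := fun h => heb h.symm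
  have hce : ¬ G.Adj c e := fun h => hec h.symm
  have hde : ¬ G.Adj d e := fun h => hed h.symm
  have hca : ¬ G.Adj c a := fun h => hac h.symm
  have hda : ¬ G.Adj d a := fun h => had h.symm
  have hdb : ¬ G.Adj d b := fun h => hbd h.symm
  let f : Fin 5 → V := ![a, b, c, d, e]
  have hinj : Function.Injective f := by
    intro i j hij
    fin_cases i <;> fin_cases j <;> simp [f] at hij ⊢ <;>
      first
        | exact absurd hij ‹_›
        | exact absurd hij.symm ‹_›
  refine h.false ⟨⟨f, hinj⟩, ?_⟩
  intro i j
  change G.Adj (f i) (f j) ↔ P4P1.Adj i j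
  fin_cases i <;> fin_cases j <;>
    simp [f, P4P1, hab, hbc, hcd, hac, had, hbd, hea, heb, hec, hed, hab.symm, hbc.symm, hcd.symm,
      hae, hbe, hce, hde, hca, hda, hdb]

theorem le_ncomps [Fintype V] (T : Finset V) (𝒦 : Finset (Finset V)) (hne : ∀ K ∈ 𝒦, K.Nonempty)
    (hT : ∀ K ∈ 𝒦, ∀ x ∈ K, x ∉ T) (hd : ∀ K ∈ 𝒦, ∀ K' ∈ 𝒦, K ≠ K' → ∀ x ∈ K, x ∉ K')
    (hcl : ∀ K ∈ 𝒦, ∀ x ∈ K, ∀ y, y ∉ T → G.Adj x y → y ∈ K) :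
    𝒦.card ≤ ncomps G (T : Set V) := by
  classical
  choose r hr using hne
  let g : 𝒦 → (G.induce (T : Set V)ᶜ).ConnectedComponent := fun K =>
    (G.induce (T : Set V)ᶜ).connectedComponentMk ⟨r K K.2, by simpa using hT K K.2 _ (hr K K.2)⟩
  have hg : Function.Injective g := by
    intro K K' h
    have hreach := ConnectedComponent.exact h
    have stay : ∀ u v : ((T : Set V)ᶜ : Set V), (G.induce (T : Set V)ᶜ).Walk u v →
        (u : V) ∈ (K : Finset V) → (v : V) ∈ (K : Finset V) := by
      intro u v p
      induction p with
      | nil => exact id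
      | @cons u w v hadj p ih =>
        exact fun hu => ih (hcl K K.2 _ hu _ (fun h => w.2 (Finset.mem_coe.2 h)) hadj)
    obtain ⟨p⟩ := hreach
    have := stay _ _ p (hr K K.2)
    by_contra hne
    exact hd K' K'.2 K K.2 (fun e => hne (Subtype.ext e.symm)) _ (hr K' K'.2) this
  have := Nat.card_le_card_of_injective g hg
  simpa [ncomps] using this

theorem exists_setting [Fintype V] (htough : Tough 4.5 G) (hfree : P4P1Free G) (S : Finset V)
    (hcut : IsCutset G (S : Set V)) (hmin : ∀ T : Set V, T ⊂ S → ¬ IsCutset G T) :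
    ∃ 𝒟, Setting G S 𝒟 := by
  classical
  have hcomp : ∀ {D : Finset V}, ClosedIn G Sᶜ D → ∀ x ∈ D, ∀ y, y ∉ S → G.Adj x y → y ∈ D :=
    fun hD x hx y hy h => hD.2 x hx y (by simpa using hy) h
  refine ⟨Finset.univ.filter fun D => ClosedIn G Sᶜ D ∧ D.Nonempty ∧ Conn G D, ?_⟩
  have hcov : ∀ x, x ∉ S → ∃ D ∈ Finset.univ.filter
      (fun D => ClosedIn G Sᶜ D ∧ D.Nonempty ∧ Conn G D), x ∈ D := by
    intro x hx
    obtain ⟨X, h1, h2, h3⟩ := exists_component (G := G) (H := Sᶜ) (by simpa using hx)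
    exact ⟨X, by simp [h1, h3, show X.Nonempty from ⟨x, h2⟩], h2⟩
  have hdis : ∀ D D' : Finset V, (ClosedIn G Sᶜ D ∧ D.Nonempty ∧ Conn G D) →
      (ClosedIn G Sᶜ D' ∧ D'.Nonempty ∧ Conn G D') → D ≠ D' → ∀ x ∈ D, x ∉ D' := by
    intro D D' hD hD' hne x hx hx'
    exact hne ((hD.2.2.subset_of_closedIn hD'.1 hD.1.1 hx hx').antisymm
      (hD'.2.2.subset_of_closedIn hD.1 hD'.1.1 hx' hx))
  have htwo : 2 ≤ (Finset.univ.filter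
      (fun D => ClosedIn G Sᶜ D ∧ D.Nonempty ∧ Conn G D)).card := by
    have : 1 < Nat.card (G.induce (S : Set V)ᶜ).ConnectedComponent := hcut
    rw [Finite.one_lt_card_iff_nontrivial] at this
    obtain ⟨c₁, c₂, hne⟩ := this
    induction c₁ using ConnectedComponent.ind with
    | h v₁ =>
    induction c₂ using ConnectedComponent.ind with
    | h v₂ =>
    obtain ⟨D₁, hD₁, hv₁⟩ := hcov v₁ (v₁.2)
    obtain ⟨D₂, hD₂, hv₂⟩ := hcov v₂ (v₂.2)
    refine Finset.one_lt_card.2 ⟨D₁, hD₁, D₂, hD₂, ?_⟩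
    rintro rfl
    simp only [Finset.mem_filter, Finset.mem_univ, true_and] at hD₁
    let X : Finset V := Finset.univ.filter fun x => ∃ h : x ∈ ((S : Set V)ᶜ : Set V),
      (G.induce (S : Set V)ᶜ).Reachable v₁ ⟨x, h⟩
    have hX : ClosedIn G Sᶜ X := by
      refine ⟨fun x hx => ?_, fun a ha b hb hab => ?_⟩
      · obtain ⟨h, -⟩ := (Finset.mem_filter.1 hx).2
        simpa using h
      · obtain ⟨h, hr⟩ := (Finset.mem_filter.1 ha).2
        refine Finset.mem_filter.2 ⟨Finset.mem_univ _, by simpa using hb, hr.trans ?_⟩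
        exact Adj.reachable (by simpa using hab)
    have := hD₁.2.2.subset_of_closedIn hX hD₁.1.1 hv₁
      (Finset.mem_filter.2 ⟨Finset.mem_univ _, v₁.2, Reachable.refl _⟩) hv₂
    obtain ⟨h, hr⟩ := (Finset.mem_filter.1 this).2
    exact hne (ConnectedComponent.sound hr)
  constructor
  · intro a b c d e h1 h2 h3 h4 h5 h6 h7 h8 h9 h10
    exact hfree.false_of h1 h2 h3 h4 h5 h6 h7 h8 h9 h10
  · intro T 𝒦 h2 hne hT hd hcl
    have h := le_ncomps T 𝒦 hne hT hd hcl
    have h' := htough T (h2.trans h)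
    rw [Set.ncard_coe_finset] at h'
    have h'' : (𝒦.card : ℝ) ≤ (ncomps G (T : Set V) : ℝ) := by exact_mod_cast h
    have : (9 : ℝ) * 𝒦.card ≤ 2 * T.card := by linarith
    exact_mod_cast this
  · exact htwo
  · intro D hD
    exact (Finset.mem_filter.1 hD).2.2.1
  · intro D hD
    exact (Finset.mem_filter.1 hD).2.2.2
  · intro D hD x hx
    simpa using (Finset.mem_filter.1 hD).2.1.1 hx
  · intro D hD D' hD' hne
    exact hdis D D' (Finset.mem_filter.1 hD).2 (Finset.mem_filter.1 hD').2 hne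
  · intro D hD
    exact hcomp (Finset.mem_filter.1 hD).2.1
  · exact hcov
  · intro s hs D hD
    by_contra hno
    push Not at hno
    have hD' := (Finset.mem_filter.1 hD).2
    have hDS : ∀ x ∈ D, x ∉ S := fun x hx => by simpa using hD'.1.1 hx
    refine hmin ((S.erase s : Finset V) : Set V) ?_ ?_
    · exact_mod_cast Finset.erase_ssubset hs
    have hsD : s ∉ D := fun h => hDS s h hs
    have hDc : ∀ x ∈ D, ∀ y, y ∉ S.erase s → G.Adj x y → y ∈ D := by
      intro x hx y hy h
      by_cases hys : y = s
      · subst hys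
        exact absurd h.symm (hno x hx)
      · exact hcomp hD'.1 x hx y (fun e => hy (Finset.mem_erase.2 ⟨hys, e⟩)) h
    have hne : D ≠ (S.erase s ∪ D)ᶜ := by
      intro e
      have : s ∈ (S.erase s ∪ D)ᶜ := by simp [hsD]
      exact hsD (e ▸ this)
    have := le_ncomps (G := G) (S.erase s) {D, (S.erase s ∪ D)ᶜ} (by
        simp only [Finset.mem_insert, Finset.mem_singleton, forall_eq_or_imp, forall_eq]
        exact ⟨hD'.2.1, s, by simp [hsD]⟩)
      (by
        simp only [Finset.mem_insert, Finset.mem_singleton, forall_eq_or_imp, forall_eq]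
        refine ⟨fun x hx h => hDS x hx (Finset.mem_of_mem_erase h), fun x hx h => ?_⟩
        simp only [Finset.mem_compl, Finset.mem_union, not_or] at hx
        exact hx.1 h)
      (by
        simp only [Finset.mem_insert, Finset.mem_singleton, forall_eq_or_imp, forall_eq]
        refine ⟨⟨fun h => absurd rfl h, fun _ x hx => by simp [hx]⟩, fun _ x hx h => ?_,
          fun h => absurd rfl h⟩
        simp [h] at hx)
      (by
        simp only [Finset.mem_insert, Finset.mem_singleton, forall_eq_or_imp, forall_eq]
        refine ⟨hDc, fun x hx y hy hxy => ?_⟩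
        simp only [Finset.mem_compl, Finset.mem_union, not_or] at hx ⊢
        exact ⟨hy, fun h => hx.2 (hDc y h x hx.1 hxy.symm)⟩)
    rw [Finset.card_pair hne] at this
    exact this

end Setup

section ListSplit

variable {V : Type*} {G : SimpleGraph V}

theorem exists_split_first {p : V → Prop} {l : List V} (h : ∃ x ∈ l, p x) :
    ∃ l₁ x l₂, l = l₁ ++ x :: l₂ ∧ p x ∧ ∀ y ∈ l₁, ¬ p y := by
  induction l with
  | nil => simp at h
  | cons a l ih =>
    by_cases ha : p a
    · exact ⟨[], a, l, rfl, ha, by simp⟩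
    · obtain ⟨x, hx, hpx⟩ := h
      have hx' : x ∈ l := by
        rcases List.mem_cons.1 hx with rfl | h
        · exact absurd hpx ha
        · exact h
      obtain ⟨l₁, y, l₂, rfl, hy, hl⟩ := ih ⟨x, hx', hpx⟩
      exact ⟨a :: l₁, y, l₂, rfl, hy, by simpa [ha] using hl⟩

theorem exists_split_last {p : V → Prop} {l : List V} (h : ∃ x ∈ l, p x) :
    ∃ l₁ x l₂, l = l₁ ++ x :: l₂ ∧ p x ∧ ∀ y ∈ l₂, ¬ p y := by
  obtain ⟨l₁, x, l₂, e, hx, hl⟩ := exists_split_first (l := l.reverse) (p := p) (by simpa using h)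
  refine ⟨l₂.reverse, x, l₁.reverse, ?_, hx, by simpa using hl⟩
  rw [← List.reverse_reverse l, e]
  simp

theorem isChain_glue {l₁ l₂ m : List V} {a b : V} (h₁ : (l₁ ++ [a]).IsChain G.Adj)
    (hm : (a :: (m ++ [b])).IsChain G.Adj) (h₂ : (b :: l₂).IsChain G.Adj) :
    (l₁ ++ a :: (m ++ b :: l₂)).IsChain G.Adj := by
  rw [List.isChain_split]
  refine ⟨h₁, ?_⟩
  have : a :: (m ++ b :: l₂) = (a :: m) ++ b :: l₂ := rfl
  rw [this, List.isChain_split]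
  exact ⟨hm, h₂⟩

/-- `v` equals `b` or is adjacent to `s` or `b`. -/
def Near (G : SimpleGraph V) (s b v : V) : Prop := v = b ∨ G.Adj v s ∨ G.Adj v b

/-- Some edge joins `{s, b}` and `{s', b'}`. -/
def Linked (G : SimpleGraph V) (s b s' b' : V) : Prop :=
  G.Adj b b' ∨ G.Adj s b' ∨ G.Adj b s' ∨ G.Adj s s'

theorem Linked.symm {s b s' b' : V} (h : Linked G s b s' b') : Linked G s' b' s b := by
  rcases h with h | h | h | h
  · exact Or.inl h.symm
  · exact Or.inr (Or.inr (Or.inl h.symm))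
  · exact Or.inr (Or.inl h.symm)
  · exact Or.inr (Or.inr (Or.inr h.symm))

theorem Near.exists_path [DecidableEq V] {s b v : V} (h : Near G s b v) (hvb : v ≠ b)
    (hsb : G.Adj s b) :
    ∃ m : List V, (v :: (m ++ [b])).IsChain G.Adj ∧ ∀ u, m.count u ≤ [s].count u := by
  rcases h with h | h | h
  · exact absurd h hvb
  · exact ⟨[s], by simp [h, hsb], fun u => le_rfl⟩
  · exact ⟨[], by simp [h], fun u => by simp⟩

theorem Linked.exists_path [DecidableEq V] {s b s' b' : V} (h : Linked G s b s' b')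
    (hsb : G.Adj s b) (hsb' : G.Adj s' b') :
    ∃ m : List V, (b :: (m ++ [b'])).IsChain G.Adj ∧ ∀ u, m.count u ≤ [s, s'].count u := by
  rcases h with h | h | h | h
  · exact ⟨[], by simp [h], fun u => by simp⟩
  · exact ⟨[s], by simp [h, hsb.symm], fun u => by simp [List.count_cons]⟩
  · exact ⟨[s'], by simp [h, hsb'], fun u => by simp [List.count_cons]⟩
  · exact ⟨[s, s'], by simp [h, hsb.symm, hsb'], fun u => le_rfl⟩

/-- Turning a path `b … x … d` all of whose relevant vertices are near `(s, b)` into a path from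
`x` to `d`. -/
theorem exists_turn [DecidableEq V] {S : Finset V} {P : List V} {s b d x : V} {l l' : List V}
    (hP : P.IsChain G.Adj) (hnd : P.Nodup) (hb : P = b :: l) (hd : P = l' ++ [d]) (hsb : G.Adj s b)
    (hnear : ∀ v ∈ P, v ∉ S → Near G s b v) (hdS : d ∉ S) (hx : x ∈ P) (hxd : x ≠ d) :
    ∃ X : List V, (x :: (X ++ [d])).IsChain G.Adj ∧
      (∀ u, (x :: (X ++ [d])).count u ≤ (s :: P).count u) ∧
      ∀ v ∈ P, v ∉ S → v ∈ x :: (X ++ [d]) := by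
  obtain ⟨L, R, rfl⟩ := List.append_of_mem hx
  have hdR : d ∈ R := by
    have : d ∈ (L ++ x :: R).getLast? := by rw [hd]; simp
    rw [List.getLast?_append, List.getLast?_cons] at this
    cases R with
    | nil => simp at this; exact absurd this hxd
    | cons r R =>
      simp [List.getLast?_cons] at this
      cases h : R.getLast? with
      | none => simp [h] at this; simp [this]
      | some q =>
        simp [h] at this
        subst this
        exact List.mem_cons_of_mem _ (List.mem_of_getLast? h)
  obtain ⟨T, y, R', rfl, hyS, hT⟩ := exists_split_first (p := fun v => v ∉ S) ⟨d, hdR, hdS⟩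
  have hyb : y ≠ b := by
    rintro rfl
    cases L with
    | nil =>
      simp at hb hnd
      exact hnd.1.2.1 hb.1
    | cons z L =>
      simp at hb hnd
      have := hb.1
      subst this
      exact hnd.1.2.2.2.1 rfl
  obtain ⟨m, hm, hmc⟩ := (hnear y (by simp) hyS).exists_path hyb hsb
  -- the part from `y` on
  obtain ⟨Y, hY⟩ : ∃ Y, y :: R' = Y ++ [d] := by
    rcases List.eq_nil_or_concat R' with h | ⟨Y, q, h⟩
    · subst h
      have : d = y := by
        have : (L ++ x :: (T ++ [y])).getLast? = (l' ++ [d]).getLast? := by rw [hd]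
        have e : L ++ x :: (T ++ [y]) = (L ++ x :: T) ++ [y] := by simp
        rw [e, List.getLast?_concat, List.getLast?_concat] at this
        exact (Option.some.inj this).symm
      exact ⟨[], by simp [this]⟩
    · subst h
      have : d = q := by
        have : (L ++ x :: (T ++ y :: (Y ++ [q]))).getLast? = (l' ++ [d]).getLast? := by
          rw [← hd]; simp
        have e : L ++ x :: (T ++ y :: (Y ++ [q])) = (L ++ x :: (T ++ y :: Y)) ++ [q] := by simp
        rw [e, List.getLast?_concat, List.getLast?_concat] at this
        exact (Option.some.inj this).symm
      exact ⟨y :: Y, by simp [this]⟩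
  -- the reversed first part
  obtain ⟨K, hK⟩ : ∃ K, x :: L.reverse = K ++ [b] := by
    cases L with
    | nil =>
      simp at hb
      exact ⟨[], by simp [hb.1]⟩
    | cons z L =>
      simp at hb
      exact ⟨x :: L.reverse, by simp [hb.1]⟩
  have hPx := hP
  rw [List.isChain_split] at hPx
  have hKc : (K ++ [b]).IsChain G.Adj := by
    rw [← hK]
    have := isChain_reverse hPx.1
    simpa using this
  have e1 : L ++ x :: (T ++ y :: R') = (L ++ x :: T) ++ y :: R' := by simp
  have hYc : (y :: R').IsChain G.Adj := by
    rw [e1, List.isChain_split] at hP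
    exact hP.2
  have hm' : (b :: (m.reverse ++ [y])).IsChain G.Adj := by
    have := isChain_reverse hm
    simpa using this
  have hall := isChain_glue hKc hm' hYc
  have e2 : K ++ b :: (m.reverse ++ y :: R') = x :: (L.reverse ++ m.reverse ++ Y ++ [d]) := by
    have : K ++ b :: (m.reverse ++ y :: R') = (K ++ [b]) ++ m.reverse ++ (y :: R') := by simp
    rw [this, ← hK, hY]
    simp
  refine ⟨L.reverse ++ m.reverse ++ Y, by rw [e2] at hall; exact hall, ?_, ?_⟩
  · intro u
    have h1 := hmc u
    have h2 := congrArg (List.count u) hY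
    simp only [List.count_cons, List.count_append, List.count_reverse, List.count_nil] at h1 h2 ⊢
    omega
  · intro v hv hvS
    rw [← e2, List.mem_append]
    rw [e1] at hv
    have h1 : v ∈ x :: L.reverse ↔ v ∈ K ++ [b] := by rw [hK]
    have h2 := hT v
    simp only [List.mem_append, List.mem_cons, List.mem_reverse, List.not_mem_nil] at hv h1 ⊢
    tauto

end ListSplit

section Dichotomy

variable {V : Type*} {G : SimpleGraph V} {S : Finset V} {𝒟 : Finset (Finset V)}

theorem Setting.not_adj (h : Setting G S 𝒟) {D D' : Finset V} (hD : D ∈ 𝒟) (hD' : D' ∈ 𝒟)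
    (hne : D ≠ D') {x y : V} (hx : x ∈ D) (hy : y ∈ D') : ¬ G.Adj x y := fun hxy =>
  h.disj D' hD' D hD hne.symm y hy (h.closed D hD x hx y (h.notMem D' hD' y hy) hxy)

theorem Setting.exists_ne (h : Setting G S 𝒟) (D : Finset V) : ∃ D' ∈ 𝒟, D' ≠ D := by
  have := h.two
  exact Finset.exists_mem_ne (by omega) D

theorem Setting.exists_edge (h : Setting G S 𝒟) {s x : V} {D : Finset V} (hs : s ∈ S)
    (hD : D ∈ 𝒟) (hx : x ∈ D) (hsx : ¬ G.Adj s x) :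
    ∃ a ∈ D, ∃ b ∈ D, G.Adj a b ∧ G.Adj s b ∧ ¬ G.Adj s a := by
  classical
  by_contra! hno
  obtain ⟨u, hu, hsu⟩ := h.touch s hs D hD
  have hcl : ClosedIn G D (D.filter (G.Adj s)) := by
    refine ⟨Finset.filter_subset _ _, fun a ha b hb hab => ?_⟩
    rw [Finset.mem_filter] at ha ⊢
    exact ⟨hb, hno b hb a ha.1 hab.symm ha.2⟩
  have := (h.conn D hD).subset_of_closedIn hcl subset_rfl hu (by simp [hu, hsu])
  exact hsx (Finset.mem_filter.1 (this hx)).2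

/-- In a connected set, two disjoint parts that are both met are joined by an edge. -/
theorem Conn.exists_crossing {D : Finset V} (h : Conn G D) {p : V → Prop} {u v : V} (hu : u ∈ D)
    (hpu : p u) (hv : v ∈ D) (hpv : ¬ p v) : ∃ x ∈ D, ∃ y ∈ D, p x ∧ ¬ p y ∧ G.Adj x y := by
  classical
  by_contra! hno
  have hcl : ClosedIn G D (D.filter p) := by
    refine ⟨Finset.filter_subset _ _, fun a ha b hb hab => ?_⟩
    rw [Finset.mem_filter] at ha ⊢
    refine ⟨hb, ?_⟩
    by_contra hpb
    exact hno a ha.1 b hb ha.2 hpb hab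
  have := h.subset_of_closedIn hcl subset_rfl hu (by simp [hu, hpu])
  exact hpv (Finset.mem_filter.1 (this hv)).2

theorem Setting.complete_of_pair (h : Setting G S 𝒟) {s b e : V} {D D' : Finset V} (hs : s ∈ S)
    (hD : D ∈ 𝒟) (hD' : D' ∈ 𝒟) (hne : D' ≠ D) (hb : b ∈ D) (he : e ∈ D) (hsb : G.Adj s b)
    (hse : ¬ G.Adj e s) (hbe : ¬ G.Adj e b) : ∀ x ∈ D', G.Adj s x := by
  intro x hx
  by_contra hsx
  obtain ⟨a, ha, c, hc, hac, hsc, hsa⟩ := h.exists_edge hs hD' hx hsx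
  exact h.free a c s b e hac hsc.symm hsb (fun h => hsa h.symm) (h.not_adj hD' hD hne ha hb)
    (h.not_adj hD' hD hne hc hb) (h.not_adj hD hD' hne.symm he ha)
    (h.not_adj hD hD' hne.symm he hc) hse hbe

theorem Setting.near_or_near (h : Setting G S 𝒟) {s b s' b' : V} (hs : s ∈ S) (hs' : s' ∈ S)
    (hb : b ∉ S) (hb' : b' ∉ S) (hsb : G.Adj s b) (hsb' : G.Adj s' b')
    (hl : ¬ Linked G s b s' b') {v : V} (hv : v ∉ S) : Near G s b v ∨ Near G s' b' v := by
  by_contra hcon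
  simp only [Linked, Near, not_or] at hl hcon
  obtain ⟨⟨v1, v2, v3⟩, v4, v5, v6⟩ := hcon
  obtain ⟨l1, l2, l3, l4⟩ := hl
  obtain ⟨D, hD, hbD⟩ := h.cover b hb
  obtain ⟨D', hD', hbD'⟩ := h.cover b' hb'
  have mixed : ∀ {s b s' b' : V} {D D' : Finset V}, s ∈ S → D ∈ 𝒟 → D' ∈ 𝒟 → D ≠ D' → b ∈ D →
      b' ∈ D' → G.Adj s b → ¬ G.Adj s b' → ¬ G.Adj v s → ¬ G.Adj v b → v ∈ D' := by
    intro s b s' b' D D' hs hD hD' hne hb hb' hsb hsb' hvs hvb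
    by_contra hvD
    obtain ⟨a, ha, c, hc, hac, hsc, hsa⟩ := h.exists_edge hs hD' hb' hsb'
    exact h.free a c s b v hac hsc.symm hsb (fun h => hsa h.symm)
      (h.not_adj hD' hD hne.symm ha hb) (h.not_adj hD' hD hne.symm hc hb)
      (fun e => hvD (h.closed D' hD' a ha v hv e.symm))
      (fun e => hvD (h.closed D' hD' c hc v hv e.symm)) hvs hvb
  by_cases hDD : D = D'
  · subst hDD
    obtain ⟨D', hD', hne⟩ := h.exists_ne D
    have c1 := h.complete_of_pair hs hD hD' hne hbD hbD' hsb (fun e => l2 e.symm)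
      (fun e => l1 e.symm)
    have c2 := h.complete_of_pair hs' hD hD' hne hbD' hbD hsb' l3 l1
    obtain ⟨c, hc⟩ := h.nonempty D' hD'
    refine h.free b s c s' v hsb.symm (c1 c hc) (c2 c hc).symm (h.not_adj hD hD' hne.symm hbD hc)
      l3 l4 v3 v2 (fun e => ?_) v5
    exact v2 (c1 v (h.closed D' hD' c hc v hv e.symm)).symm
  · have m1 := mixed (s' := s) hs hD hD' hDD hbD hbD' hsb l2 v2 v3
    have m2 := mixed (s' := s) hs' hD' hD (Ne.symm hDD) hbD' hbD hsb' (fun e => l3 e.symm) v5 v6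
    exact h.disj D hD D' hD' hDD v m2 m1

end Dichotomy

section Merging

variable {V : Type*} {G : SimpleGraph V} {S : Finset V} {𝒟 : Finset (Finset V)}

theorem List.exists_concat_of_getLast? {l : List V} {d : V} (h : l.getLast? = some d) :
    ∃ l', l = l' ++ [d] := by
  rcases List.eq_nil_or_concat l with rfl | ⟨l', q, rfl⟩
  · simp at h
  · simp at h
    exact ⟨l', by simp [h]⟩

theorem isChain_link {l₁ l₂ m : List V} {a b : V} (h₁ : l₁.IsChain G.Adj)
    (ha : l₁.getLast? = some a) (hm : (a :: (m ++ [b])).IsChain G.Adj)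
    (hb : l₂.head? = some b) (h₂ : l₂.IsChain G.Adj) : (l₁ ++ (m ++ l₂)).IsChain G.Adj := by
  obtain ⟨l', rfl⟩ := List.exists_concat_of_getLast? ha
  obtain ⟨l'', rfl⟩ := List.head?_eq_some_iff.1 hb
  have := isChain_glue h₁ hm h₂
  simpa using this

theorem isChain_reverse_path {m : List V} {a b : V} (hm : (a :: (m ++ [b])).IsChain G.Adj) :
    (b :: (m.reverse ++ [a])).IsChain G.Adj := by
  have := isChain_reverse hm
  simpa using this

theorem exists_turn' [DecidableEq V] {P : List V} {s b d x : V} (hP : P.IsChain G.Adj)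
    (hnd : P.Nodup) (hb : P.head? = some b) (hd : P.getLast? = some d) (hsb : G.Adj s b)
    (hnear : ∀ v ∈ P, v ∉ S → Near G s b v) (hdS : d ∉ S) (hx : x ∈ P) (hxd : x ≠ d) :
    ∃ X : List V, X.IsChain G.Adj ∧ X.head? = some x ∧ X.getLast? = some d ∧
      (∀ u, X.count u ≤ (s :: P).count u) ∧ ∀ v ∈ P, v ∉ S → v ∈ X := by
  obtain ⟨l, hl⟩ := List.head?_eq_some_iff.1 hb
  obtain ⟨l', hl'⟩ := List.exists_concat_of_getLast? hd
  obtain ⟨X, h1, h2, h3⟩ := exists_turn hP hnd hl hl' hsb hnear hdS hx hxd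
  exact ⟨x :: (X ++ [d]), h1, by simp, by simp [List.getLast?_cons], h2, h3⟩

/-- A segment with ends in `S` whose interior starts and ends outside `S`. -/
structure SegOK (G : SimpleGraph V) (S : Finset V) (f : Seg V) : Prop where
  chain : f.all.IsChain G.Adj
  s_mem : f.s ∈ S
  t_mem : f.t ∈ S
  head : ∃ b, f.p.head? = some b ∧ b ∉ S
  last : ∃ d, f.p.getLast? = some d ∧ d ∉ S

/-- Disjoint segments covering the complement of `S`. -/
structure SegInv (G : SimpleGraph V) (S : Finset V) (Fs : List (Seg V)) : Prop where
  ok : ∀ f ∈ Fs, SegOK G S f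
  nodup : (Fs.flatMap Seg.all).Nodup
  cover : ∀ v, v ∉ S → ∃ f ∈ Fs, v ∈ f.p

theorem SegOK.rev {f : Seg V} (h : SegOK G S f) : SegOK G S f.rev where
  chain := by rw [Seg.all_rev]; exact isChain_reverse h.chain
  s_mem := h.t_mem
  t_mem := h.s_mem
  head := by simpa [Seg.rev] using h.last
  last := by simpa [Seg.rev] using h.head

theorem SegOK.chain_p {f : Seg V} (h : SegOK G S f) : f.p.IsChain G.Adj := by
  have := h.chain
  unfold Seg.all at this
  exact (List.isChain_append.1 this.tail).1

theorem SegOK.chain_sp {f : Seg V} (h : SegOK G S f) : (f.s :: f.p).IsChain G.Adj := by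
  have := h.chain
  unfold Seg.all at this
  rw [← List.cons_append] at this
  exact (List.isChain_append.1 this).1

theorem SegOK.chain_pt {f : Seg V} (h : SegOK G S f) : (f.p ++ [f.t]).IsChain G.Adj := by
  have := h.chain
  unfold Seg.all at this
  exact this.tail

theorem SegOK.adj_head {f : Seg V} (h : SegOK G S f) {b : V} (hb : f.p.head? = some b) :
    G.Adj f.s b := by
  have := h.chain_sp
  obtain ⟨l, hl⟩ := List.head?_eq_some_iff.1 hb
  rw [hl] at this
  simp at this
  exact this.1

theorem SegOK.adj_last {f : Seg V} (h : SegOK G S f) {d : V} (hd : f.p.getLast? = some d) :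
    G.Adj f.t d := by
  have := h.rev.adj_head (b := d) (by simpa [Seg.rev] using hd)
  exact this

theorem SegInv.perm {Fs Fs' : List (Seg V)} (h : SegInv G S Fs) (hp : Fs.Perm Fs') :
    SegInv G S Fs' where
  ok f hf := h.ok f (hp.mem_iff.2 hf)
  nodup := (hp.flatMap_right Seg.all).nodup_iff.1 h.nodup
  cover v hv := by
    obtain ⟨f, hf, hvf⟩ := h.cover v hv
    exact ⟨f, hp.mem_iff.1 hf, hvf⟩

theorem SegInv.replace [DecidableEq V] {As Bs Fs : List (Seg V)} (h : SegInv G S (As ++ Fs))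
    (hok : ∀ f ∈ Bs, SegOK G S f)
    (hc : ∀ v, (Bs.flatMap Seg.all).count v ≤ (As.flatMap Seg.all).count v)
    (hcov : ∀ f ∈ As, ∀ v ∈ f.p, v ∉ S → ∃ g ∈ Bs, v ∈ g.p) : SegInv G S (Bs ++ Fs) where
  ok f hf := by
    rcases List.mem_append.1 hf with hf | hf
    · exact hok f hf
    · exact h.ok f (by simp [hf])
  nodup := by
    have := h.nodup
    rw [List.nodup_iff_count_le_one] at this ⊢
    intro v
    have h1 := this v
    have h2 := hc v
    simp only [List.flatMap_append, List.count_append] at h1 ⊢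
    omega
  cover v hv := by
    obtain ⟨f, hf, hvf⟩ := h.cover v hv
    rcases List.mem_append.1 hf with hf | hf
    · obtain ⟨g, hg, hvg⟩ := hcov f hf v hvf hv
      exact ⟨g, by simp [hg], hvg⟩
    · exact ⟨f, by simp [hf], hvf⟩

theorem SegInv.merge [DecidableEq V] {f g n : Seg V} {Fs : List (Seg V)}
    (h : SegInv G S (f :: g :: Fs)) (hn : SegOK G S n)
    (hc : ∀ v, n.all.count v ≤ f.all.count v + g.all.count v)
    (hcov : ∀ v, v ∉ S → v ∈ f.p ∨ v ∈ g.p → v ∈ n.p) : SegInv G S (n :: Fs) := by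
  refine SegInv.replace (As := [f, g]) (Bs := [n]) h (by simpa using hn) ?_ ?_
  · intro v
    have := hc v
    simpa [List.count_append] using this
  · intro k hk v hv hvS
    simp only [List.mem_cons, List.not_mem_nil, or_false] at hk
    refine ⟨n, by simp, hcov v hvS ?_⟩
    rcases hk with rfl | rfl
    · exact Or.inl hv
    · exact Or.inr hv

theorem SegInv.rev_head {f : Seg V} {Fs : List (Seg V)}
    (h : SegInv G S (f :: Fs)) : SegInv G S (f.rev :: Fs) := by
  classical
  refine SegInv.replace (As := [f]) (Bs := [f.rev]) h (by simpa using (h.ok f (by simp)).rev) ?_ ?_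
  · intro v; simp
  · intro k hk v hv hvS
    simp only [List.mem_cons, List.not_mem_nil, or_false] at hk
    subst hk
    exact ⟨k.rev, by simp, by simpa [Seg.rev] using hv⟩

theorem SegInv.merge_linked {f g : Seg V} {Fs : List (Seg V)} {b c : V}
    (h : SegInv G S (f :: g :: Fs)) (hb : f.p.head? = some b) (hc : g.p.head? = some c)
    (hl : Linked G f.s b g.s c) : ∃ n, SegInv G S (n :: Fs) := by
  classical
  have hf := h.ok f (by simp)
  have hg := h.ok g (by simp)
  obtain ⟨m, hm, hmc⟩ := hl.exists_path (hf.adj_head hb) (hg.adj_head hc)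
  obtain ⟨d, hd, hdS⟩ := hf.last
  obtain ⟨d', hd', hdS'⟩ := hg.last
  refine ⟨⟨f.t, f.p.reverse ++ (m ++ g.p), g.t⟩, h.merge ⟨?_, hf.t_mem, hg.t_mem, ?_, ?_⟩ ?_ ?_⟩
  · have := isChain_link (isChain_reverse hf.chain_pt) (by simp [List.getLast?_cons, hb]) hm (by simp [hc])
      hg.chain_pt
    simpa [Seg.all] using this
  · exact ⟨d, by simp [hd], hdS⟩
  · exact ⟨d', by simp [hd'], hdS'⟩
  · intro v
    have := hmc v
    simp only [Seg.all, List.count_cons, List.count_append, List.count_reverse,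
      List.count_nil] at this ⊢
    omega
  · intro v _ hv
    simp only [List.mem_append, List.mem_reverse]
    tauto

theorem SegInv.swap {f g : Seg V} {Fs : List (Seg V)} (h : SegInv G S (f :: g :: Fs)) :
    SegInv G S (g :: f :: Fs) := h.perm (List.Perm.swap _ _ _)

theorem SegInv.ne_of_mem {f g : Seg V} {Fs : List (Seg V)} (h : SegInv G S (f :: g :: Fs))
    {x y : V} (hx : x ∈ f.all) (hy : y ∈ g.all) : x ≠ y := by
  rintro rfl
  have := h.nodup
  simp only [List.flatMap_cons] at this
  exact (List.disjoint_of_nodup_append this) hx (by simp [hy])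

theorem Seg.mem_all_of_mem_p {f : Seg V} {x : V} (h : x ∈ f.p) : x ∈ f.all := by
  simp [Seg.all, h]

/-- Three segments can be replaced by two. -/
theorem SegInv.merge_three (hS : Setting G S 𝒟) {f g k : Seg V} {Fs : List (Seg V)}
    (h : SegInv G S (f :: g :: k :: Fs)) :
    ∃ n Fs', SegInv G S (n :: Fs') ∧ Fs'.length = Fs.length + 1 := by
  obtain ⟨b₁, hb₁, hb₁S⟩ := (h.ok f (by simp)).head
  obtain ⟨b₂, hb₂, hb₂S⟩ := (h.ok g (by simp)).head
  obtain ⟨b₃, hb₃, hb₃S⟩ := (h.ok k (by simp)).head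
  have hf := h.ok f (by simp)
  have hg := h.ok g (by simp)
  by_cases hl : Linked G f.s b₁ g.s b₂
  · obtain ⟨n, hn⟩ := h.merge_linked hb₁ hb₂ hl
    exact ⟨n, k :: Fs, hn, by simp⟩
  have hfk : SegInv G S (f :: k :: g :: Fs) := h.perm ((List.Perm.swap _ _ _).cons _)
  have hgk : SegInv G S (g :: k :: f :: Fs) := (h.swap).perm ((List.Perm.swap _ _ _).cons _)
  have m1 := Seg.mem_all_of_mem_p (List.mem_of_head? hb₁)
  have m2 := Seg.mem_all_of_mem_p (List.mem_of_head? hb₂)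
  have m3 := Seg.mem_all_of_mem_p (List.mem_of_head? hb₃)
  rcases hS.near_or_near hf.s_mem hg.s_mem hb₁S hb₂S (hf.adj_head hb₁) (hg.adj_head hb₂) hl hb₃S
    with hn | hn
  · have : Linked G f.s b₁ k.s b₃ := by
      rcases hn with e | e | e
      · exact absurd e.symm (hfk.ne_of_mem m1 m3)
      · exact Or.inr (Or.inl e.symm)
      · exact Or.inl e.symm
    obtain ⟨n, hn⟩ := hfk.merge_linked hb₁ hb₃ this
    exact ⟨n, g :: Fs, hn, by simp⟩
  · have : Linked G g.s b₂ k.s b₃ := by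
      rcases hn with e | e | e
      · exact absurd e.symm (hgk.ne_of_mem m2 m3)
      · exact Or.inr (Or.inl e.symm)
      · exact Or.inl e.symm
    obtain ⟨n, hn⟩ := hgk.merge_linked hb₂ hb₃ this
    exact ⟨n, f :: Fs, hn, by simp⟩

end Merging

section TwoSegments

variable {V : Type*} {G : SimpleGraph V} {S : Finset V} {𝒟 : Finset (Finset V)}

theorem SegInv.nodup_all {f : Seg V} {Fs : List (Seg V)} (h : SegInv G S (f :: Fs)) :
    f.all.Nodup := by
  have := h.nodup
  rw [List.flatMap_cons] at this
  exact (List.nodup_append.1 this).1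

theorem SegInv.nodup_p {f : Seg V} {Fs : List (Seg V)} (h : SegInv G S (f :: Fs)) :
    f.p.Nodup := by
  have := h.nodup_all
  unfold Seg.all at this
  exact (List.nodup_append.1 (List.nodup_cons.1 this).2).1

theorem SegInv.merge_of_near {f g : Seg V} {Fs : List (Seg V)} {b b' d : V}
    (h : SegInv G S (f :: g :: Fs)) (hb : f.p.head? = some b) (hbS : b ∉ S)
    (hd : f.p.getLast? = some d)
    (hb' : g.p.head? = some b') (hnb : ¬ Near G g.s b' b)
    (htype : ∀ v, v ∉ S → Near G g.s b' v ∨ Near G f.t d v)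
    (hz : ∃ z ∈ f.p, z ∉ S ∧ Near G g.s b' z) : ∃ n, SegInv G S (n :: Fs) := by
  classical
  have hf := h.ok f (by simp)
  have hg := h.ok g (by simp)
  obtain ⟨L, z, R, hp, ⟨hzS, hzn⟩, hL⟩ := exists_split_first hz
  have hbL : b ∈ L := by
    cases L with
    | nil =>
      rw [hp] at hb
      simp at hb
      subst hb
      exact absurd hzn hnb
    | cons q L => rw [hp] at hb; simp at hb; simp [hb]
  obtain ⟨L', z', T, rfl, hz'S, hT⟩ := exists_split_last (p := fun v => v ∉ S) ⟨b, hbL, hbS⟩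
  have hz'n : Near G f.t d z' := (htype z' hz'S).resolve_left fun e => hL z' (by simp) ⟨hz'S, e⟩
  have hnd := h.nodup_p
  have hdR : (z :: R).getLast? = some d := by
    rw [hp, List.getLast?_append] at hd
    simpa [List.getLast?_cons] using hd
  have hz'd : z' ≠ d := by
    rintro rfl
    rw [hp] at hnd
    have := (List.nodup_append.1 hnd).2.2 z' (by simp) z' (List.mem_of_getLast? hdR)
    exact this rfl
  have hzb' : z ≠ b' := h.ne_of_mem (Seg.mem_all_of_mem_p (by simp [hp]))
    (Seg.mem_all_of_mem_p (List.mem_of_head? hb'))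
  obtain ⟨m₁, hm₁, hc₁⟩ := hz'n.exists_path hz'd (hf.adj_last hd)
  obtain ⟨m₂, hm₂, hc₂⟩ := hzn.exists_path hzb' (hg.adj_head hb')
  have hchain := hf.chain
  unfold Seg.all at hchain
  rw [hp] at hchain
  have c₂ : (z :: R).IsChain G.Adj := by
    have := hf.chain_p
    rw [hp] at this
    exact (List.isChain_append.1 this).2.1
  have c₃ : (z' :: (L'.reverse ++ [f.s])).IsChain G.Adj := by
    have e : f.s :: ((L' ++ z' :: T) ++ z :: R ++ [f.t]) =
        (f.s :: (L' ++ [z'])) ++ (T ++ z :: R ++ [f.t]) := by simp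
    rw [e] at hchain
    have := isChain_reverse (List.isChain_append.1 hchain).1
    simpa using this
  have c₁ : (g.t :: g.p.reverse).IsChain G.Adj := by
    have := isChain_reverse hg.chain_pt
    simpa using this
  have l₁ := isChain_link c₂ hdR (isChain_reverse_path hm₁) (by simp) c₃
  have l₂ := isChain_link c₁ (b := z) (by simp [List.getLast?_cons, hb'])
    (isChain_reverse_path hm₂) (by simp) l₁
  obtain ⟨d', hd', hdS'⟩ := hg.last
  refine ⟨⟨g.t, g.p.reverse ++ (m₂.reverse ++ ((z :: R) ++ (m₁.reverse ++ z' :: L'.reverse))), f.s⟩,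
    h.merge ⟨?_, hg.t_mem, hf.s_mem, ⟨d', by simp [hd'], hdS'⟩, ⟨b, ?_, hbS⟩⟩ ?_ ?_⟩
  · simpa [Seg.all] using l₂
  · have : L'.head?.getD z' = b := by
      rw [hp] at hb
      cases L' with
      | nil => simpa using hb
      | cons q L' => simpa using hb
    simp [List.getLast?_append, List.getLast?_cons, this]
  · intro v
    have h1 := hc₁ v
    have h2 := hc₂ v
    simp only [Seg.all, hp, List.count_cons, List.count_append, List.count_reverse,
      List.count_nil] at h1 h2 ⊢
    omega
  · intro v hvS hv
    rw [hp] at hv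
    have := hT v
    simp only [List.mem_append, List.mem_reverse, List.mem_cons] at hv ⊢
    tauto

theorem SegOK.exists_end {f : Seg V} (h : SegOK G S f) (hnd : f.p.Nodup) {b d x : V}
    (hb : f.p.head? = some b) (hd : f.p.getLast? = some d) [DecidableEq V]
    (hn : ∀ v ∈ f.p, v ∉ S → Near G f.t d v) (hx : x ∈ f.p) :
    ∃ k ∈ S, ∃ Y : List V, (k :: Y).IsChain G.Adj ∧ Y.getLast? = some x ∧
      (∃ c, Y.head? = some c ∧ c ∉ S) ∧ (∀ u, (k :: Y).count u ≤ f.all.count u) ∧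
      ∀ v ∈ f.p, v ∉ S → v ∈ Y := by
  obtain ⟨b', hb', hbS⟩ := h.head
  obtain ⟨d', hd', hdS⟩ := h.last
  obtain rfl : b = b' := Option.some.inj (hb.symm.trans hb')
  obtain rfl : d = d' := Option.some.inj (hd.symm.trans hd')
  by_cases hxb : x = b
  · subst hxb
    refine ⟨f.t, h.t_mem, f.p.reverse, ?_, by simp [hb], ⟨d, by simp [hd], hdS⟩, ?_, fun v hv _ => by simpa using hv⟩
    · have := isChain_reverse h.chain_pt
      simpa using this
    · intro u
      simp only [Seg.all, List.count_cons, List.count_append, List.count_reverse, List.count_nil]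
      omega
  · obtain ⟨X, h1, h2, h3, h4, h5⟩ := exists_turn' (S := S) (P := f.p.reverse) (s := f.t) (b := d)
      (d := b) (x := x) (isChain_reverse h.chain_p) (by simpa using hnd) (by simp [hd])
      (by simp [hb]) (h.adj_last hd) (by simpa using hn) hbS (by simpa using hx) hxb
    refine ⟨f.s, h.s_mem, X.reverse, ?_, by simp [h2], ⟨b, by simp [h3], hbS⟩, ?_, by simpa using h5⟩
    · obtain ⟨X', rfl⟩ := List.exists_concat_of_getLast? h3
      have := isChain_reverse h1
      simp only [List.reverse_append, List.reverse_cons, List.reverse_nil, List.nil_append,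
        List.singleton_append] at this ⊢
      exact List.IsChain.cons_cons (h.adj_head hb) this
    · intro u
      have := h4 u
      simp only [Seg.all, List.count_cons, List.count_append, List.count_reverse,
        List.count_nil] at this ⊢
      omega

/-- Two segments can be merged. -/
theorem SegInv.merge_pair (hS : Setting G S 𝒟) {f g : Seg V} (h : SegInv G S [f, g]) :
    ∃ n, SegInv G S [n] := by
  classical
  have hf := h.ok f (by simp)
  have hg := h.ok g (by simp)
  obtain ⟨b₁, hb₁, hb₁S⟩ := hf.head
  obtain ⟨d₁, hd₁, hd₁S⟩ := hf.last
  obtain ⟨b₂, hb₂, hb₂S⟩ := hg.head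
  obtain ⟨d₂, hd₂, hd₂S⟩ := hg.last
  by_cases hl₁ : Linked G f.s b₁ g.s b₂
  · exact h.merge_linked hb₁ hb₂ hl₁
  by_cases hl₂ : Linked G f.s b₁ g.t d₂
  · exact h.swap.rev_head.swap.merge_linked hb₁ (c := d₂) (by simp [Seg.rev, hd₂]) hl₂
  by_cases hl₃ : Linked G f.t d₁ g.s b₂
  · exact h.rev_head.merge_linked (b := d₁) (by simp [Seg.rev, hd₁]) hb₂ hl₃
  have n₂ := fun v (hv : v ∉ S) => hS.near_or_near hf.s_mem hg.t_mem hb₁S hd₂S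
    (hf.adj_head hb₁) (hg.adj_last hd₂) hl₂ hv
  have n₃ := fun v (hv : v ∉ S) => hS.near_or_near hf.t_mem hg.s_mem hd₁S hb₂S
    (hf.adj_last hd₁) (hg.adj_head hb₂) hl₃ hv
  have mb₁ := Seg.mem_all_of_mem_p (List.mem_of_head? hb₁)
  have mb₂ := Seg.mem_all_of_mem_p (List.mem_of_head? hb₂)
  by_cases hz₁ : ∃ z ∈ f.p, z ∉ S ∧ Near G g.s b₂ z
  · refine h.merge_of_near hb₁ hb₁S hd₁ hb₂ ?_ (fun v hv => (n₃ v hv).symm) hz₁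
    rintro (e | e | e)
    · exact h.ne_of_mem mb₁ mb₂ e
    · exact hl₁ (Or.inr (Or.inr (Or.inl e)))
    · exact hl₁ (Or.inl e)
  by_cases hz₂ : ∃ z ∈ g.p, z ∉ S ∧ Near G f.s b₁ z
  · refine h.swap.merge_of_near hb₂ hb₂S hd₂ hb₁ ?_ (fun v hv => n₂ v hv) hz₂
    rintro (e | e | e)
    · exact h.ne_of_mem mb₁ mb₂ e.symm
    · exact hl₁ (Or.inr (Or.inl e.symm))
    · exact hl₁ (Or.inl e.symm)
  push Not at hz₁ hz₂
  obtain ⟨D, hD⟩ := Finset.card_pos.1 (by have := hS.two; omega : 0 < 𝒟.card)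
  obtain ⟨u, hu, hsu⟩ := hS.touch _ hf.s_mem D hD
  obtain ⟨v, hv, hsv⟩ := hS.touch _ hg.s_mem D hD
  have huS := hS.notMem D hD u hu
  have hvS := hS.notMem D hD v hv
  have cov : ∀ w, w ∉ S → w ∈ f.p ∨ w ∈ g.p := by
    intro w hw
    obtain ⟨k, hk, hwk⟩ := h.cover w hw
    simp only [List.mem_cons, List.not_mem_nil, or_false] at hk
    rcases hk with rfl | rfl
    · exact Or.inl hwk
    · exact Or.inr hwk
  have hup : u ∈ f.p := (cov u huS).resolve_right fun e => hz₂ u e huS (Or.inr (Or.inl hsu.symm))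
  have hvp : v ∉ f.p := fun e => hz₁ v e hvS (Or.inr (Or.inl hsv.symm))
  obtain ⟨x, hx, y, hy, hxp, hyp, hxy⟩ := (hS.conn D hD).exists_crossing (p := (· ∈ f.p))
    hu hup hv hvp
  have hyg := (cov y (hS.notMem D hD y hy)).resolve_left hyp
  obtain ⟨k₁, hk₁, Y₁, c₁, l₁, ⟨a₁, ha₁, ha₁S⟩, ct₁, cv₁⟩ := hf.exists_end h.nodup_p hb₁ hd₁
    (fun w hw hwS => (n₃ w hwS).resolve_right (hz₁ w hw hwS)) hxp
  obtain ⟨k₂, hk₂, Y₂, c₂, l₂, ⟨a₂, ha₂, ha₂S⟩, ct₂, cv₂⟩ := hg.exists_end h.swap.nodup_p hb₂ hd₂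
    (fun w hw hwS => (n₂ w hwS).resolve_left (hz₂ w hw hwS)) hyg
  refine ⟨⟨k₁, Y₁ ++ Y₂.reverse, k₂⟩, h.merge ⟨?_, hk₁, hk₂, ⟨a₁, by simp [ha₁], ha₁S⟩,
    ⟨a₂, by simp [ha₂], ha₂S⟩⟩ ?_ ?_⟩
  · have := isChain_link (m := []) (a := x) (b := y) c₁ (by simp [List.getLast?_cons, l₁])
      (by simpa using hxy) (by simp [l₂]) (isChain_reverse c₂)
    simpa [Seg.all] using this
  · intro w
    have h1 := ct₁ w
    have h2 := ct₂ w
    simp only [Seg.all, List.count_cons, List.count_append, List.count_reverse,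
      List.count_nil] at h1 h2 ⊢
    omega
  · intro w hwS hw
    simp only [List.mem_append, List.mem_reverse]
    rcases hw with hw | hw
    · exact Or.inl (cv₁ w hw hwS)
    · exact Or.inr (cv₂ w hw hwS)

theorem SegInv.exists_single (hS : Setting G S 𝒟) {Fs : List (Seg V)} (h : SegInv G S Fs) :
    ∃ n, SegInv G S [n] := by
  induction hn : Fs.length using Nat.strong_induction_on generalizing Fs with
  | _ k ih =>
    match Fs with
    | [] =>
      obtain ⟨D, hD⟩ := Finset.card_pos.1 (by have := hS.two; omega : 0 < 𝒟.card)
      obtain ⟨x, hx⟩ := hS.nonempty D hD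
      obtain ⟨f, hf, -⟩ := h.cover x (hS.notMem D hD x hx)
      simp at hf
    | [f] => exact ⟨f, h⟩
    | [f, g] => exact h.merge_pair hS
    | f :: g :: k :: Fs =>
      obtain ⟨n, Fs', hF, hl⟩ := h.merge_three hS
      simp at hn
      exact ih _ (by simp; omega) hF rfl

end TwoSegments

section OneSegment

variable {V : Type*} {G : SimpleGraph V} {S : Finset V} {𝒟 : Finset (Finset V)}

/-- A closed walk without repetitions through all vertices outside `S`, as a list. -/
def HasTour (G : SimpleGraph V) (S : Finset V) : Prop :=
  ∃ (a : V) (l : List V), (a :: (l ++ [a])).IsChain G.Adj ∧ (a :: l).Nodup ∧ ∀ v, v ∉ S → v ∈ a :: l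

theorem hasTour_of_closing [DecidableEq V] {A C : List V} {a b : V} (hA : A.Nodup)
    (hc : C.IsChain G.Adj) (ha : C.head? = some a) (hb : C.getLast? = some b) (hba : G.Adj b a)
    (hct : ∀ u, C.count u ≤ A.count u) (hcov : ∀ v, v ∉ S → v ∈ C) : HasTour G S := by
  obtain ⟨l, rfl⟩ := List.head?_eq_some_iff.1 ha
  refine ⟨a, l, ?_, ?_, hcov⟩
  · rw [← List.cons_append]
    refine List.isChain_append.2 ⟨hc, by simp, ?_⟩
    intro x hx y hy
    rw [hb] at hx
    simp at hx hy
    subst hx hy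
    exact hba
  · rw [List.nodup_iff_count_le_one] at hA ⊢
    exact fun u => (hct u).trans (hA u)

theorem SegInv.mem_p {f : Seg V} (h : SegInv G S [f]) {v : V} (hv : v ∉ S) : v ∈ f.p := by
  obtain ⟨g, hg, hvg⟩ := h.cover v hv
  simp at hg
  exact hg ▸ hvg

theorem SegInv.hasTour_of_linked {f : Seg V} {b d : V} (h : SegInv G S [f])
    (hb : f.p.head? = some b) (hd : f.p.getLast? = some d) (hl : Linked G f.s b f.t d) :
    HasTour G S := by
  classical
  have hf := h.ok f (by simp)
  obtain ⟨m, hm, hmc⟩ := hl.symm.exists_path (hf.adj_last hd) (hf.adj_head hb)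
  obtain ⟨l, hl⟩ := List.head?_eq_some_iff.1 hb
  refine ⟨b, l ++ m, ?_, ?_, ?_⟩
  · have := isChain_link hf.chain_p hd hm (l₂ := [b]) (by simp) (by simp)
    rw [hl] at this
    simpa using this
  · have := h.nodup_all
    rw [List.nodup_iff_count_le_one] at this ⊢
    intro u
    have h1 := this u
    have h2 := hmc u
    simp only [Seg.all, hl, List.count_cons, List.count_append, List.count_nil] at h1 h2 ⊢
    omega
  · intro v hv
    have := h.mem_p hv
    rw [hl] at this
    simp only [List.mem_cons, List.mem_append] at this ⊢
    tauto

theorem SegInv.hasTour_of_switch {f : Seg V} {b d z z' : V} {L T R : List V}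
    (h : SegInv G S [f]) (hb : f.p.head? = some b) (hd : f.p.getLast? = some d)
    (hp : f.p = L ++ z :: (T ++ z' :: R)) (hT : ∀ v ∈ T, v ∈ S)
    (hz : Near G f.t d z) (hz' : Near G f.s b z') : HasTour G S := by
  classical
  have hf := h.ok f (by simp)
  have hnd := h.nodup_p
  rw [hp] at hnd
  have hd' : (z' :: R).getLast? = some d := by
    have e : f.p = (L ++ z :: T) ++ z' :: R := by simp [hp]
    rw [e, List.getLast?_append] at hd
    simpa [List.getLast?_cons] using hd
  have hb' : (L ++ [z]).head? = some b := by
    rw [hp] at hb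
    cases L with
    | nil => simpa using hb
    | cons q L => simpa using hb
  have hzd : z ≠ d := by
    rintro rfl
    have h1 := List.mem_of_getLast? hd'
    have h2 := (List.nodup_append.1 hnd).2.1
    rw [List.nodup_cons] at h2
    exact h2.1 (List.mem_append_right _ h1)
  have hzb : z' ≠ b := by
    rintro rfl
    have h1 := List.mem_of_head? hb'
    have e : L ++ z :: (T ++ z' :: R) = (L ++ [z]) ++ (T ++ z' :: R) := by simp
    rw [e] at hnd
    exact (List.nodup_append.1 hnd).2.2 z' h1 z' (by simp) rfl
  obtain ⟨m₁, hm₁, hc₁⟩ := hz'.exists_path hzb (hf.adj_head hb)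
  obtain ⟨m₂, hm₂, hc₂⟩ := hz.exists_path hzd (hf.adj_last hd)
  have hch := hf.chain_p
  rw [hp, List.isChain_split] at hch
  have hR : (z' :: R).IsChain G.Adj := by
    have := hch.2
    rw [← List.cons_append] at this
    exact (List.isChain_append.1 this).2.1
  have l₁ := isChain_link hR hd' (isChain_reverse_path hm₂) (l₂ := [z]) (by simp) (by simp)
  have l₂ := isChain_link (isChain_reverse hch.1) (a := b) (b := z')
    (by rw [List.getLast?_reverse]; exact hb') (isChain_reverse_path hm₁) (by simp) l₁
  refine ⟨z, L.reverse ++ (m₁.reverse ++ (z' :: R ++ m₂.reverse)), by simpa using l₂, ?_, ?_⟩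
  · have := h.nodup_all
    rw [List.nodup_iff_count_le_one] at this ⊢
    intro u
    have h1 := this u
    have h2 := hc₁ u
    have h3 := hc₂ u
    simp only [Seg.all, hp, List.count_cons, List.count_append, List.count_nil,
      List.count_reverse] at h1 h2 h3 ⊢
    omega
  · intro v hv
    have := h.mem_p hv
    have hT := hT v
    rw [hp] at this
    simp only [List.mem_cons, List.mem_append, List.mem_reverse] at this ⊢
    tauto

/-- A single segment closes up to a tour. -/
theorem SegInv.hasTour (hS : Setting G S 𝒟) {f : Seg V} (h : SegInv G S [f]) :
    HasTour G S := by
  classical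
  have hf := h.ok f (by simp)
  have hnd := h.nodup_p
  have hnda := h.nodup_all
  obtain ⟨b, hb, hbS⟩ := hf.head
  obtain ⟨d, hd, hdS⟩ := hf.last
  have hsb := hf.adj_head hb
  have htd := hf.adj_last hd
  by_cases hl : Linked G f.s b f.t d
  · exact h.hasTour_of_linked hb hd hl
  by_contra hno
  have hnear := fun v (hv : v ∉ S) => hS.near_or_near hf.s_mem hf.t_mem hbS hdS hsb htd hl hv
  have hbd : ¬ Near G f.t d b := by
    rintro (e | e | e)
    · exact hl (Or.inr (Or.inl (e ▸ hsb)))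
    · exact hl (Or.inr (Or.inr (Or.inl e)))
    · exact hl (Or.inl e)
  obtain ⟨L, z, R, hp, ⟨hzS, hzn⟩, hL⟩ := exists_split_first (l := f.p)
    (p := fun v => v ∉ S ∧ Near G f.t d v) ⟨d, List.mem_of_getLast? hd, hdS, Or.inl rfl⟩
  have hLn : ∀ v ∈ L, v ∉ S → Near G f.s b v := fun v hv hvS =>
    (hnear v hvS).resolve_right fun e => hL v hv ⟨hvS, e⟩
  have hRn : ∀ v ∈ R, v ∉ S → ¬ Near G f.s b v := by
    intro v hv hvS hvn
    obtain ⟨R₁, z', R₂, rfl, ⟨hz'S, hz'n⟩, hR₁⟩ := exists_split_first (l := R)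
      (p := fun v => v ∉ S ∧ Near G f.s b v) ⟨v, hv, hvS, hvn⟩
    obtain ⟨A, y, T, hA, hyS, hT⟩ := exists_split_last (l := z :: R₁) (p := fun v => v ∉ S)
      ⟨z, by simp, hzS⟩
    have hyn : Near G f.t d y := by
      have hy : y ∈ z :: R₁ := by simp [hA]
      rcases List.mem_cons.1 hy with rfl | hy
      · exact hzn
      · exact (hnear y hyS).resolve_left fun e => hR₁ y hy ⟨hyS, e⟩
    refine hno (h.hasTour_of_switch (L := L ++ A) (T := T) (R := R₂) hb hd ?_ (by simpa using hT) hyn hz'n)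
    have : L ++ z :: (R₁ ++ z' :: R₂) = L ++ ((z :: R₁) ++ z' :: R₂) := by simp
    rw [hp, this, hA]
    simp
  have hRt : ∀ v ∈ z :: R, v ∉ S → Near G f.t d v := by
    intro v hv hvS
    rcases List.mem_cons.1 hv with rfl | hv
    · exact hzn
    · exact (hnear v hvS).resolve_left (hRn v hv hvS)
  have hmem : ∀ v, v ∉ S → v ∈ L ∨ v ∈ z :: R := by
    intro v hv
    have := h.mem_p hv
    rw [hp] at this
    exact List.mem_append.1 this
  have hbL : b ∈ L := by
    rcases hmem b hbS with h | h
    · exact h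
    · exact absurd (hRt b h hbS) hbd
  have hbh : L.head? = some b := by
    rw [hp] at hb
    cases L with
    | nil => simp at hbL
    | cons q L => simpa using hb
  have hdl : (z :: R).getLast? = some d := by
    rw [hp, List.getLast?_append] at hd
    simpa [List.getLast?_cons] using hd
  have hch := hf.chain_p
  rw [hp] at hch hnd
  have hchR : (z :: R).IsChain G.Adj := (List.isChain_append.1 hch).2.1
  have hndR : (z :: R).Nodup := (List.nodup_append.1 hnd).2.1
  have turnR : ∀ y ∈ z :: R, y ∉ S → y ≠ z → ∃ X : List V, X.IsChain G.Adj ∧ X.head? = some y ∧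
      X.getLast? = some z ∧ (∀ u, X.count u ≤ (f.t :: z :: R).count u) ∧
      ∀ v ∈ z :: R, v ∉ S → v ∈ X := by
    intro y hy hyS hyz
    obtain ⟨X, h1, h2, h3, h4, h5⟩ := exists_turn' (S := S) (P := (z :: R).reverse) (s := f.t)
      (b := d) (d := z) (x := y) (isChain_reverse hchR) (by rwa [List.nodup_reverse])
      (by rwa [List.head?_reverse]) (by rw [List.getLast?_reverse]; rfl) htd
      (fun v hv => hRt v (List.mem_reverse.1 hv)) hzS (List.mem_reverse.2 hy) hyz
    refine ⟨X, h1, h2, h3, fun u => ?_, fun v hv => h5 v (List.mem_reverse.2 hv)⟩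
    have := h4 u
    rwa [List.count_cons, List.count_reverse, ← List.count_cons] at this
  by_cases hzs : Near G f.s b z
  · obtain ⟨D, hD, hzD⟩ : ∃ D ∈ 𝒟, z ∉ D := by
      obtain ⟨D, hD, hzD⟩ := hS.cover z hzS
      obtain ⟨D', hD', hne⟩ := hS.exists_ne D
      exact ⟨D', hD', hS.disj D hD D' hD' hne.symm z hzD⟩
    obtain ⟨u, hu, hsu⟩ := hS.touch _ hf.s_mem D hD
    obtain ⟨v, hv, htv⟩ := hS.touch _ hf.t_mem D hD
    have huL : u ∈ L := by
      rcases hmem u (hS.notMem D hD u hu) with e | e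
      · exact e
      · rcases List.mem_cons.1 e with rfl | e
        · exact absurd hu hzD
        · exact absurd (Or.inr (Or.inl hsu.symm)) (hRn u e (hS.notMem D hD u hu))
    have hvL : v ∉ L := fun e => hL v e ⟨hS.notMem D hD v hv, Or.inr (Or.inl htv.symm)⟩
    obtain ⟨x, hx, y, hy, hxL, hyL, hxy⟩ := (hS.conn D hD).exists_crossing (p := (· ∈ L))
      hu huL hv hvL
    have hxS := hS.notMem D hD x hx
    have hyS := hS.notMem D hD y hy
    have hyz : y ≠ z := by rintro rfl; exact hzD hy
    have hxz : x ≠ z := by rintro rfl; exact hzD hx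
    obtain ⟨X₂, c₂, a₂, l₂, ct₂, cv₂⟩ := turnR y ((hmem y hyS).resolve_left hyL) hyS hyz
    obtain ⟨X₂', rfl⟩ := List.exists_concat_of_getLast? l₂
    have e : L ++ z :: R = (L ++ [z]) ++ R := by simp
    rw [e] at hch hnd
    obtain ⟨X₁, c₁, a₁, l₁, ct₁, cv₁⟩ := exists_turn' (S := S) (P := L ++ [z]) (s := f.s)
      (b := b) (d := z) (x := x) (List.isChain_append.1 hch).1 (List.nodup_append.1 hnd).1
      (by simp [hbh]) (by simp) hsb (by
        intro v hv hvS
        rcases List.mem_append.1 hv with hv | hv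
        · exact hLn v hv hvS
        · simp at hv; exact hv ▸ hzs) hzS (by simp [hxL]) hxz
    have c₂' := isChain_reverse c₂
    rw [List.reverse_append] at c₂'
    obtain ⟨q, hq⟩ : ∃ q, X₂' = y :: q := by
      cases X₂' with
      | nil => simp at a₂; exact absurd a₂.symm hyz
      | cons r X => simp at a₂; exact ⟨X, by rw [a₂]⟩
    refine hno (hasTour_of_closing (C := X₁ ++ X₂'.reverse) hnda (a := x) (b := y) ?_ ?_ ?_
      hxy.symm ?_ ?_)
    · obtain ⟨X₁', rfl⟩ := List.exists_concat_of_getLast? l₁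
      rw [List.append_assoc, List.singleton_append, List.isChain_split]
      exact ⟨c₁, by simpa using c₂'⟩
    · simp [List.head?_append, a₁]
    · simp [hq, List.getLast?_append]
    · intro u
      have h1 := ct₁ u
      have h2 := ct₂ u
      simp only [Seg.all, hp, List.count_cons, List.count_append, List.count_nil,
        List.count_reverse] at h1 h2 ⊢
      omega
    · intro v hv
      rw [List.mem_append, List.mem_reverse]
      rcases hmem v hv with e | e
      · exact Or.inl (cv₁ v (by simp [e]) hv)
      · rcases List.mem_cons.1 e with rfl | e
        · exact Or.inl (cv₁ v (by simp) hv)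
        · have := cv₂ v (by simp [e]) hv
          rcases List.mem_append.1 this with h | h
          · exact Or.inr h
          · simp at h
            subst h
            rw [List.nodup_cons] at hndR
            exact absurd (by assumption) hndR.1
  have cross : ∀ D ∈ 𝒟, ∃ x ∈ D, ∃ y ∈ D, x ∈ L ∧ y ∈ z :: R ∧ G.Adj x y := by
    intro D hD
    obtain ⟨u, hu, hsu⟩ := hS.touch _ hf.s_mem D hD
    obtain ⟨v, hv, htv⟩ := hS.touch _ hf.t_mem D hD
    have huL : u ∈ L := by
      rcases hmem u (hS.notMem D hD u hu) with e | e
      · exact e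
      · rcases List.mem_cons.1 e with rfl | e
        · exact absurd (Or.inr (Or.inl hsu.symm)) hzs
        · exact absurd (Or.inr (Or.inl hsu.symm)) (hRn u e (hS.notMem D hD u hu))
    have hvL : v ∉ L := fun e => hL v e ⟨hS.notMem D hD v hv, Or.inr (Or.inl htv.symm)⟩
    obtain ⟨x, hx, y, hy, hxL, hyL, hxy⟩ := (hS.conn D hD).exists_crossing (p := (· ∈ L))
      hu huL hv hvL
    exact ⟨x, hx, y, hy, hxL, (hmem y (hS.notMem D hD y hy)).resolve_left hyL, hxy⟩
  obtain ⟨L', q, T, rfl, hqS, hT⟩ := exists_split_last (p := fun v => v ∉ S) ⟨b, hbL, hbS⟩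
  have e : (L' ++ q :: T) ++ z :: R = (L' ++ [q]) ++ (T ++ z :: R) := by simp
  have hchL : (L' ++ [q]).IsChain G.Adj := by
    rw [e] at hch
    exact (List.isChain_append.1 hch).1
  have hndL : (L' ++ [q]).Nodup := by
    rw [e] at hnd
    exact (List.nodup_append.1 hnd).1
  have hqT : (q :: (T ++ [z])).IsChain G.Adj := by
    have e : (L' ++ q :: T) ++ z :: R = L' ++ q :: ((T ++ [z]) ++ R) := by simp
    rw [e, List.isChain_split, ← List.cons_append] at hch
    exact (List.isChain_append.1 hch.2).1
  have turnL : ∀ x ∈ L' ++ q :: T, x ∉ S → x ≠ q → ∃ X : List V, X.IsChain G.Adj ∧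
      X.head? = some x ∧ X.getLast? = some q ∧ (∀ u, X.count u ≤ (f.s :: (L' ++ [q])).count u) ∧
      ∀ v ∈ L' ++ q :: T, v ∉ S → v ∈ X := by
    have hq : ∀ x ∈ L' ++ q :: T, x ∉ S → x ∈ L' ++ [q] := by
      intro x hx hxS
      have := hT x
      simp only [List.mem_append, List.mem_cons, List.not_mem_nil, or_false] at hx ⊢
      tauto
    intro x hx hxS hxq
    obtain ⟨X, h1, h2, h3, h4, h5⟩ := exists_turn' (S := S) (P := L' ++ [q]) (s := f.s)
      (b := b) (d := q) (x := x) hchL hndL (by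
        cases L' with
        | nil => simpa using hbh
        | cons r L' => simpa using hbh) (by simp) hsb (fun v hv => hLn v (by
          simp only [List.mem_append, List.mem_cons, List.not_mem_nil, or_false] at hv ⊢
          tauto)) hqS (hq x hx hxS) hxq
    exact ⟨X, h1, h2, h3, h4, fun v hv hvS => h5 v (hq v hv hvS) hvS⟩
  have straight : ∀ x ∈ L' ++ q :: T, ∀ y ∈ z :: R, x ∉ S → y ∉ S → G.Adj x y → x ≠ q → y ≠ z →
      False := by
    intro x hx y hy hxS hyS hxy hxq hyz
    obtain ⟨X₁, c₁, a₁, l₁, ct₁, cv₁⟩ := turnL x hx hxS hxq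
    obtain ⟨X₂, c₂, a₂, l₂, ct₂, cv₂⟩ := turnR y hy hyS hyz
    refine hno (hasTour_of_closing (C := X₁ ++ (T ++ X₂.reverse)) hnda (a := x) (b := y)
      (isChain_link c₁ l₁ hqT (by simp [l₂]) (isChain_reverse c₂)) (by simp [List.head?_append, a₁])
      (by simp [List.getLast?_append, a₂]) hxy.symm ?_ ?_)
    · intro u
      have h1 := ct₁ u
      have h2 := ct₂ u
      simp only [Seg.all, hp, List.count_cons, List.count_append, List.count_nil,
        List.count_reverse] at h1 h2 ⊢
      omega
    · intro v hv
      simp only [List.mem_append, List.mem_reverse]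
      rcases hmem v hv with e | e
      · exact Or.inl (cv₁ v e hv)
      · exact Or.inr (Or.inr (cv₂ v e hv))
  have twisted : ∀ x ∈ L' ++ q :: T, ∀ y ∈ z :: R, x ∉ S → y ∉ S → G.Adj x z → G.Adj q y →
      x ≠ q → y ≠ z → False := by
    intro x hx y hy hxS hyS hxz hqy hxq hyz
    obtain ⟨X₁, c₁, a₁, l₁, ct₁, cv₁⟩ := turnL x hx hxS hxq
    obtain ⟨X₂, c₂, a₂, l₂, ct₂, cv₂⟩ := turnR y hy hyS hyz
    refine hno (hasTour_of_closing (C := X₁ ++ ([] ++ X₂)) hnda (a := x) (b := z)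
      (isChain_link c₁ l₁ (by simpa using hqy) a₂ c₂) (by simp [List.head?_append, a₁])
      (by simp [List.getLast?_append, l₂]) hxz.symm ?_ ?_)
    · intro u
      have h1 := ct₁ u
      have h2 := ct₂ u
      simp only [Seg.all, hp, List.count_cons, List.count_append, List.count_nil] at h1 h2 ⊢
      omega
    · intro v hv
      simp only [List.mem_append, List.nil_append]
      rcases hmem v hv with e | e
      · exact Or.inl (cv₁ v e hv)
      · exact Or.inr (cv₂ v e hv)
  obtain ⟨D, hD⟩ := Finset.card_pos.1 (by have := hS.two; omega : 0 < 𝒟.card)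
  obtain ⟨D', hD', hne⟩ := hS.exists_ne D
  obtain ⟨x, hx, y, hy, hxL, hyR, hxy⟩ := cross D hD
  obtain ⟨x', hx', y', hy', hxL', hyR', hxy'⟩ := cross D' hD'
  have sx := hS.notMem D hD x hx
  have sy := hS.notMem D hD y hy
  have sx' := hS.notMem D' hD' x' hx'
  have sy' := hS.notMem D' hD' y' hy'
  have nx : x ≠ x' := by rintro rfl; exact hS.disj D hD D' hD' hne.symm x hx hx'
  have ny : y ≠ y' := by rintro rfl; exact hS.disj D hD D' hD' hne.symm y hy hy'
  by_cases e1 : x = q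
  · subst e1
    by_cases e3 : y' = z
    · subst e3
      exact twisted x' hxL' y hyR sx' sy hxy' hxy nx.symm ny
    · exact straight x' hxL' y' hyR' sx' sy' hxy' nx.symm e3
  · by_cases e2 : y = z
    · subst e2
      by_cases e3 : x' = q
      · subst e3
        exact twisted x hxL y' hyR' sx sy' hxy hxy' e1 ny.symm
      · exact straight x' hxL' y' hyR' sx' sy' hxy' e3 ny.symm
    · exact straight x hxL y hyR sx sy hxy e1 e2

theorem exists_walk_of_isChain {l : List V} {x y : V} (hl : l.IsChain G.Adj)
    (hx : l.head? = some x) (hy : l.getLast? = some y) : ∃ p : G.Walk x y, p.support = l := by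
  have hne : l ≠ [] := by rintro rfl; simp at hx
  have e₁ : l.head hne = x := by
    rw [List.head?_eq_some_head hne] at hx; exact Option.some.inj hx
  have e₂ : l.getLast hne = y := by
    rw [List.getLast?_eq_some_getLast hne] at hy; exact Option.some.inj hy
  subst e₁ e₂
  exact ⟨Walk.ofSupport l hne hl, Walk.support_ofSupport hne hl⟩

theorem HasTour.exists_isCycle (h : HasTour G S) (hS : Setting G S 𝒟) :
    ∃ (w : V) (C : G.Walk w w), C.IsCycle ∧ ∀ x ∉ S, x ∈ C.support := by
  classical
  obtain ⟨a, l, hc, hnd, hcov⟩ := h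
  obtain ⟨D, hD⟩ := Finset.card_pos.1 (by have := hS.two; omega : 0 < 𝒟.card)
  obtain ⟨D', hD', hne⟩ := hS.exists_ne D
  obtain ⟨u, hu⟩ := hS.nonempty D hD
  obtain ⟨v, hv⟩ := hS.nonempty D' hD'
  have huv := hS.not_adj hD hD' hne.symm hu hv
  have huv' : u ≠ v := by rintro rfl; exact hS.disj D hD D' hD' hne.symm u hu hv
  have mu := hcov u (hS.notMem D hD u hu)
  have mv := hcov v (hS.notMem D' hD' v hv)
  match l with
  | [] => simp at mu mv; exact absurd (mu.trans mv.symm) huv'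
  | [b] =>
    simp at hc mu mv
    rcases mu with rfl | rfl <;> rcases mv with rfl | rfl
    · exact absurd rfl huv'
    · exact absurd hc.1 huv
    · exact absurd hc.1.symm huv
    · exact absurd rfl huv'
  | b :: c :: l =>
    have hab : G.Adj a b := by
      simp at hc; exact hc.1
    obtain ⟨p, hp⟩ : ∃ p : G.Walk c a, p.support = (c :: l) ++ [a] := by
      exact exists_walk_of_isChain (l := (c :: l) ++ [a]) hc.tail.tail (by simp)
        (by rw [List.getLast?_concat])
    have hbc : G.Adj b c := by
      simp at hc; exact hc.2.1
    simp only [List.nodup_cons, List.mem_cons, not_or] at hnd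
    refine ⟨a, Walk.cons hab (Walk.cons hbc p), ?_, ?_⟩
    · rw [Walk.cons_isCycle_iff, Walk.isPath_def, Walk.support_cons, hp, Walk.edges_cons]
      refine ⟨?_, ?_⟩
      · simp only [List.cons_append, List.nodup_cons, List.mem_cons, List.mem_append, not_or,
          List.nodup_append, List.not_mem_nil, or_false, not_false_eq_true, List.nodup_nil,
          and_true, true_and]
        refine ⟨⟨hnd.2.1.1, hnd.2.1.2, fun e => hnd.1.1 e.symm⟩,
          ⟨hnd.2.2.1, fun e => hnd.1.2.1 e.symm⟩, hnd.2.2.2, ?_⟩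
        rintro x hx y rfl rfl
        exact hnd.1.2.2 hx
      · rw [List.mem_cons, not_or]
        refine ⟨fun e => ?_, fun e => ?_⟩
        · rw [Sym2.eq_iff] at e
          rcases e with e | e
          · exact hnd.1.1 e.1
          · exact hnd.1.2.1 e.1
        · have := Walk.snd_mem_support_of_mem_edges p e
          rw [hp] at this
          simp only [List.mem_append, List.mem_cons, List.not_mem_nil, or_false] at this
          rcases this with (e | e) | e
          · exact hnd.2.1.1 e
          · exact hnd.2.1.2 e
          · exact hnd.1.1 e.symm
    · intro v hv
      have := hcov v hv
      rw [Walk.support_cons, Walk.support_cons, hp]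
      simp only [List.mem_append, List.mem_cons, List.not_mem_nil, or_false] at this ⊢
      tauto

end OneSegment

section Service

variable {V : Type*} {G : SimpleGraph V} {S : Finset V} {𝒟 : Finset (Finset V)} [DecidableEq V]

/-- Toughness with the remaining vertices counted as one further part. -/
theorem Setting.tough_rest [Fintype V] (h : Setting G S 𝒟) {T : Finset V}
    {𝒦 : Finset (Finset V)} (h𝒦 : 𝒦.Nonempty) (hne : ∀ K ∈ 𝒦, K.Nonempty)
    (hT : ∀ K ∈ 𝒦, ∀ x ∈ K, x ∉ T)
    (hd : ∀ K ∈ 𝒦, ∀ K' ∈ 𝒦, K ≠ K' → ∀ x ∈ K, x ∉ K')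
    (hc : ∀ K ∈ 𝒦, ∀ x ∈ K, ∀ y, y ∉ T → G.Adj x y → y ∈ K)
    {z : V} (hz : z ∉ T) (hz𝒦 : ∀ K ∈ 𝒦, z ∉ K) : 9 * (𝒦.card + 1) ≤ 2 * T.card := by
  classical
  set X := (Finset.univ \ T) \ 𝒦.biUnion id with hX
  have memX : ∀ x, x ∈ X ↔ x ∉ T ∧ ∀ K ∈ 𝒦, x ∉ K := by
    intro x; simp [hX]
  have hX𝒦 : X ∉ 𝒦 := fun e => ((memX z).1 ((memX z).2 ⟨hz, hz𝒦⟩)).2 X e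
    ((memX z).2 ⟨hz, hz𝒦⟩)
  have hpos := h𝒦.card_pos
  have := h.tough T (insert X 𝒦) ?_ ?_ ?_ ?_ ?_
  · rwa [Finset.card_insert_of_notMem hX𝒦] at this
  · rw [Finset.card_insert_of_notMem hX𝒦]; omega
  · intro K hK
    rcases Finset.mem_insert.1 hK with rfl | hK
    · exact ⟨z, (memX z).2 ⟨hz, hz𝒦⟩⟩
    · exact hne K hK
  · intro K hK x hx
    rcases Finset.mem_insert.1 hK with rfl | hK
    · exact ((memX x).1 hx).1
    · exact hT K hK x hx
  · intro K hK K' hK' hKK x hx hx'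
    rcases Finset.mem_insert.1 hK with rfl | hK <;> rcases Finset.mem_insert.1 hK' with rfl | hK'
    · exact hKK rfl
    · exact ((memX x).1 hx).2 K' hK' hx'
    · exact ((memX x).1 hx').2 K hK hx
    · exact hd K hK K' hK' hKK x hx hx'
  · intro K hK x hx y hy hxy
    rcases Finset.mem_insert.1 hK with rfl | hK
    · refine (memX y).2 ⟨hy, fun K hK hyK => ?_⟩
      exact ((memX x).1 hx).2 K hK (hc K hK y hyK x ((memX x).1 hx).1 hxy.symm)
    · exact hc K hK x hx y hy hxy

open Classical in
/-- The vertices of `S` with a neighbour in `H`. -/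
noncomputable def nbrs (G : SimpleGraph V) (S H : Finset V) : Finset V :=
  S.filter fun s => ∃ x ∈ H, G.Adj s x

open Classical in
/-- The vertices of `S` adjacent to all of `H`. -/
noncomputable def fullNbrs (G : SimpleGraph V) (S H : Finset V) : Finset V :=
  S.filter fun s => ∀ x ∈ H, G.Adj s x

omit [DecidableEq V] in
theorem mem_nbrs {H : Finset V} {s : V} : s ∈ nbrs G S H ↔ s ∈ S ∧ ∃ x ∈ H, G.Adj s x := by
  classical
  simp [nbrs]

omit [DecidableEq V] in
theorem mem_fullNbrs {H : Finset V} {s : V} : s ∈ fullNbrs G S H ↔ s ∈ S ∧ ∀ x ∈ H, G.Adj s x := by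
  classical
  simp [fullNbrs]

omit [DecidableEq V] in
theorem nbrs_subset {H : Finset V} : nbrs G S H ⊆ S := fun _ h => (mem_nbrs.1 h).1

/-- Toughness for parts of a single component. -/
theorem Setting.tough_part [Fintype V] (h : Setting G S 𝒟) {D R N : Finset V} (hD : D ∈ 𝒟)
    (hR : R ⊆ D) {𝒦 : Finset (Finset V)} (h𝒦 : 𝒦.Nonempty) (hne : ∀ K ∈ 𝒦, K.Nonempty)
    (hsub : ∀ K ∈ 𝒦, K ⊆ D) (hRK : ∀ K ∈ 𝒦, ∀ x ∈ K, x ∉ R)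
    (hd : ∀ K ∈ 𝒦, ∀ K' ∈ 𝒦, K ≠ K' → ∀ x ∈ K, x ∉ K')
    (hc : ∀ K ∈ 𝒦, ∀ x ∈ K, ∀ y ∈ D, y ∉ R → G.Adj x y → y ∈ K) (hNS : N ⊆ S)
    (hN : ∀ K ∈ 𝒦, ∀ x ∈ K, ∀ s ∈ S, G.Adj s x → s ∈ N) :
    9 * (𝒦.card + 1) ≤ 2 * (N.card + R.card) := by
  obtain ⟨D', hD', hne'⟩ := h.exists_ne D
  obtain ⟨z, hz⟩ := h.nonempty D' hD'
  have hdis : Disjoint N R := Finset.disjoint_left.2 fun x hx hxR =>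
    h.notMem D hD x (hR hxR) (hNS hx)
  rw [← Finset.card_union_of_disjoint hdis]
  refine h.tough_rest h𝒦 hne ?_ hd ?_ (z := z) ?_ ?_
  · intro K hK x hx hxT
    rcases Finset.mem_union.1 hxT with e | e
    · exact h.notMem D hD x (hsub K hK hx) (hNS e)
    · exact hRK K hK x hx e
  · intro K hK x hx y hy hxy
    rw [Finset.mem_union, not_or] at hy
    by_cases hyS : y ∈ S
    · exact absurd (hN K hK x hx y hyS hxy.symm) hy.1
    · exact hc K hK x hx y (h.closed D hD x (hsub K hK hx) y hyS hxy) hy.2 hxy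
  · rw [Finset.mem_union, not_or]
    exact ⟨fun e => h.notMem D' hD' z hz (hNS e), fun e => h.disj D' hD' D hD hne' z hz (hR e)⟩
  · exact fun K hK hzK => h.disj D' hD' D hD hne' z hz (hsub K hK hzK)

omit [DecidableEq V] in
theorem Setting.nine_le [Fintype V] (h : Setting G S 𝒟) : 9 ≤ S.card := by
  have := h.tough S 𝒟 h.two h.nonempty h.notMem h.disj h.closed
  have := h.two
  omega

theorem Setting.eight_le_nbrs_erase [Fintype V] (h : Setting G S 𝒟) {D : Finset V} (hD : D ∈ 𝒟)
    {y : V} (hy : y ∈ D) (hne : (D.erase y).Nonempty) : 8 ≤ (nbrs G S (D.erase y)).card := by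
  have := h.tough_part (R := {y}) (N := nbrs G S (D.erase y)) (𝒦 := {D.erase y}) hD
    (by simpa using hy) (by simp) (by simpa using hne) (by simp [Finset.erase_subset]) (by simp)
    (by
      intro K hK K' hK' hne
      simp only [Finset.mem_singleton] at hK hK'
      exact absurd (hK.trans hK'.symm) hne) (by simp +contextual)
    nbrs_subset (by
      intro K hK x hx s hs hsx
      simp only [Finset.mem_singleton] at hK
      subst hK
      exact mem_nbrs.2 ⟨hs, x, hx, hsx⟩)
  simp at this
  omega

theorem Setting.exists_complete_component (h : Setting G S 𝒟) {D A : Finset V} (hD : D ∈ 𝒟)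
    (hAD : A ⊆ D) (hA : ¬ Conn G A) {s : V} (hs : s ∈ nbrs G S A) :
    ∃ X, ClosedIn G A X ∧ X.Nonempty ∧ ∀ x ∈ X, G.Adj s x := by
  obtain ⟨hsS, x, hx, hsx⟩ := mem_nbrs.1 hs
  obtain ⟨X, hX, hxX, hXc⟩ := exists_component (G := G) hx
  by_cases hall : ∀ y ∈ X, G.Adj s y
  · exact ⟨X, hX, ⟨x, hxX⟩, hall⟩
  push Not at hall
  obtain ⟨y, hy, hsy⟩ := hall
  obtain ⟨a, ha, b, hb, hsa, hsb, hab⟩ := hXc.exists_crossing (p := fun v => G.Adj s v)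
    hxX hsx hy hsy
  obtain ⟨D', hD', hne⟩ := h.exists_ne D
  obtain ⟨c, hc, hsc⟩ := h.touch s hsS D' hD'
  have hXA : X ≠ A := by rintro rfl; exact hA hXc
  have hXne : (A \ X).Nonempty := by
    rw [Finset.sdiff_nonempty]; exact fun e => hXA (hX.1.antisymm e)
  have haD := hAD (hX.1 ha)
  have hbD := hAD (hX.1 hb)
  refine ⟨A \ X, ⟨Finset.sdiff_subset, ?_⟩, hXne, ?_⟩
  · intro u hu v hv huv
    rw [Finset.mem_sdiff] at hu ⊢
    exact ⟨hv, fun e => hu.2 (hX.2 v e u hu.1 huv.symm)⟩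
  · intro v hv
    rw [Finset.mem_sdiff] at hv
    by_contra hsv
    exact h.free b a s c v hab.symm hsa.symm hsc (fun e => hsb e.symm)
      (h.not_adj hD hD' hne.symm hbD hc) (h.not_adj hD hD' hne.symm haD hc)
      (fun e => hv.2 (hX.2 b hb v hv.1 e.symm)) (fun e => hv.2 (hX.2 a ha v hv.1 e.symm))
      (fun e => hsv e.symm) (h.not_adj hD hD' hne.symm (hAD hv.1) hc)

/-- `D` can be traversed by a path that is attached to two vertices of `E`. -/
def Serves (G : SimpleGraph V) (E D : Finset V) : Prop :=
  ∃ s ∈ E, ∃ t ∈ E, s ≠ t ∧ ∃ x y l, IsOrder D l ∧ l.IsChain G.Adj ∧ l.head? = some x ∧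
    l.getLast? = some y ∧ G.Adj s x ∧ G.Adj t y

theorem Setting.serves_of_hamConn [Fintype V] (h : Setting G S 𝒟) {D F : Finset V} (hD : D ∈ 𝒟)
    (hF : F.card ≤ 2) (hham : HamConn G D) (hcard : 2 ≤ D.card) : Serves G (S \ F) D := by
  have h9 := h.nine_le
  obtain ⟨t, ht, htF⟩ := Finset.exists_mem_notMem_of_card_lt_card (s := F) (t := S) (by omega)
  obtain ⟨y, hy, hty⟩ := h.touch t ht D hD
  have h8 := h.eight_le_nbrs_erase hD hy (by
    rw [← Finset.card_pos, Finset.card_erase_of_mem hy]; omega)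
  have h3 := Finset.card_insert_le t F
  obtain ⟨s, hs, hsF⟩ := Finset.exists_mem_notMem_of_card_lt_card (s := insert t F)
    (t := nbrs G S (D.erase y)) (by omega)
  rw [Finset.mem_insert, not_or] at hsF
  obtain ⟨hsS, x, hx, hsx⟩ := mem_nbrs.1 hs
  rw [Finset.mem_erase] at hx
  obtain ⟨l, h1, h2, h3, h4⟩ := hham x hx.2 y hy hx.1
  exact ⟨s, by simp [hsS, hsF.2], t, by simp [ht, htF], hsF.1, x, y, l, h1, h2, h3, h4, hsx, hty⟩

omit [DecidableEq V] in
theorem IsOrder.of_perm_append {A B H : Finset V} {lA lB l : List V} (hA : IsOrder A lA)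
    (hB : IsOrder B lB) (hAB : ∀ a ∈ A, ∀ b ∈ B, G.Adj a b) (hH : ∀ x, x ∈ H ↔ x ∈ A ∨ x ∈ B)
    (hl : l.Perm (lA ++ lB)) : IsOrder H l := by
  refine ⟨hl.nodup_iff.2 (List.nodup_append.2 ⟨hA.1, hB.1, ?_⟩), fun x => ?_⟩
  · intro a ha b hb
    exact (hAB a ((hA.2 a).1 ha) b ((hB.2 b).1 hb)).ne
  · rw [hl.mem_iff, List.mem_append, hA.2, hB.2, hH]

theorem exists_order_head {A : Finset V} {x : V} (hx : x ∈ A) :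
    ∃ l, IsOrder A l ∧ l.head? = some x := by
  refine ⟨x :: (A.erase x).toList, ⟨?_, fun v => ?_⟩, rfl⟩
  · simp [Finset.nodup_toList]
  · by_cases hv : v = x
    · simp [hv, hx]
    · simp [hv]

omit [DecidableEq V] in
theorem exists_adj_of_isChain {l : List V} (hl : l.IsChain G.Adj) {p : V → Prop} {x y : V}
    (hx : x ∈ l) (hpx : p x) (hy : y ∈ l) (hpy : ¬ p y) :
    ∃ a ∈ l, ∃ b ∈ l, p a ∧ ¬ p b ∧ G.Adj a b := by
  induction l generalizing x y with
  | nil => simp at hx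
  | cons u l ih =>
    cases l with
    | nil =>
      simp only [List.mem_singleton] at hx hy
      exact absurd (hy ▸ hx ▸ hpx) hpy
    | cons v l =>
      rw [List.isChain_cons_cons] at hl
      by_cases hall : (∃ a ∈ v :: l, p a) ∧ ∃ b ∈ v :: l, ¬ p b
      · obtain ⟨⟨a, ha, hpa⟩, b, hb, hpb⟩ := hall
        obtain ⟨a, ha, b, hb, h⟩ := ih hl.2 ha hpa hb hpb
        exact ⟨a, List.mem_cons_of_mem _ ha, b, List.mem_cons_of_mem _ hb, h⟩
      · by_cases hu : p u <;> by_cases hv : p v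
        · grind
        · exact ⟨u, by simp, v, by simp, hu, hv, hl.1⟩
        · exact ⟨v, by simp, u, by simp, hv, hu, hl.1.symm⟩
        · grind

omit [DecidableEq V] in
theorem conn_of_isChain {A : Finset V} {l : List V} (hl : l.IsChain G.Adj)
    (hA : ∀ x, x ∈ l ↔ x ∈ A) : Conn G A := by
  intro X hXA ⟨x, hx⟩ hne
  obtain ⟨y, hy, hyX⟩ : ∃ y ∈ A, y ∉ X := by
    by_contra! hcon
    exact hne (hXA.antisymm hcon)
  obtain ⟨a, -, b, hb, haX, hbX, hab⟩ := exists_adj_of_isChain hl (p := (· ∈ X))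
    ((hA x).2 (hXA hx)) hx ((hA y).2 hy) hyX
  exact ⟨a, haX, b, (hA b).1 hb, hbX, hab⟩

theorem Setting.serves_of_tightJoin [Fintype V] (h : Setting G S 𝒟) {D F : Finset V}
    (hD : D ∈ 𝒟) (hF : F.card ≤ 2) (ht : TightJoin G D) : Serves G (S \ F) D := by
  obtain ⟨A, B, hDAB, hA, hAB, ⟨W, 𝒬, l, hgood, hlB⟩, lB, hB, hlA⟩ := ht
  have hAD : A ⊆ D := fun x hx => (hDAB x).2 (Or.inl hx)
  have hBD : B ⊆ D := fun x hx => (hDAB x).2 (Or.inr hx)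
  have hlo : IsOrder A l := ⟨hgood.nodup, hgood.mem⟩
  have hB2 : 2 ≤ B.card := by
    by_contra hlt
    have h0 : breaks G l = 0 := by omega
    rw [breaks_eq_zero_iff] at h0
    exact hA (conn_of_isChain h0 hlo.2)
  have hWB : Disjoint W B := Finset.disjoint_left.2 fun x hx hxB =>
    (hAB x (hgood.W_sub hx) x hxB).ne rfl
  have hcount := hgood.count
  have hRD : B ∪ W ⊆ D := Finset.union_subset hBD (hgood.W_sub.trans hAD)
  have hcardBW := Finset.card_union_of_disjoint hWB.symm
  -- parts of the decomposition of `A`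
  have hclosed : ∀ Q ∈ 𝒬, ∀ x ∈ Q, ∀ y ∈ D, y ∉ B ∪ W → G.Adj x y → y ∈ Q := by
    intro Q hQ x hx y hy hyR hxy
    rw [Finset.mem_union, not_or] at hyR
    have hyA : y ∈ A := ((hDAB y).1 hy).resolve_right hyR.1
    obtain ⟨Q', hQ', hyQ'⟩ := (hgood.cover y hyA).resolve_left hyR.2
    by_contra hyQ
    have : Q ≠ Q' := by rintro rfl; exact hyQ hyQ'
    exact (hgood.anti Q hQ Q' hQ' this x hx y hyQ').2 hxy
  have hnotR : ∀ Q ∈ 𝒬, ∀ x ∈ Q, x ∉ B ∪ W := by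
    intro Q hQ x hx hxR
    rcases Finset.mem_union.1 hxR with e | e
    · exact (hAB x (hgood.sub Q hQ hx) x e).ne rfl
    · exact hgood.disjW Q hQ x hx e
  have hN : 8 ≤ (nbrs G S A).card := by
    have := h.tough_part (R := B ∪ W) (N := nbrs G S A) (𝒦 := 𝒬) hD hRD
      (Finset.card_pos.1 (by omega)) hgood.nonempty (fun Q hQ => (hgood.sub Q hQ).trans hAD) hnotR
      (fun Q hQ Q' hQ' hne x hx hx' => (hgood.anti Q hQ Q' hQ' hne x hx x hx').1 rfl) hclosed
      nbrs_subset
      (fun Q hQ x hx s hs hsx => mem_nbrs.2 ⟨hs, x, hgood.sub Q hQ hx, hsx⟩)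
    omega
  obtain ⟨t, htN, htF⟩ := Finset.exists_mem_notMem_of_card_lt_card (s := F) (t := nbrs G S A)
    (by omega)
  have htS := (mem_nbrs.1 htN).1
  have h3 := Finset.card_insert_le t F
  by_cases hbr : ∃ lB, IsOrder B lB ∧ breaks G lB + 2 ≤ A.card
  · obtain ⟨lB, hB, hlA⟩ := hbr
    obtain ⟨X, hX, ⟨u, hu⟩, htX⟩ := h.exists_complete_component hD hAD hA htN
    obtain ⟨l₁, y, l₂, rfl, hyX, hl₁⟩ := exists_split_first (l := l) (p := (· ∈ X))
      ⟨u, (hgood.mem u).2 (hX.1 hu), hu⟩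
    have hyA := hX.1 hyX
    have hN' : 4 ≤ (nbrs G S (A.erase y)).card := by
      have hle : 𝒬.card ≤ (𝒬.filter (y ∉ ·)).card + 1 := by
        have h1 : (𝒬.filter (y ∈ ·)).card ≤ 1 := by
          rw [Finset.card_le_one]
          intro Q hQ Q' hQ'
          rw [Finset.mem_filter] at hQ hQ'
          by_contra hne
          exact (hgood.anti Q hQ.1 Q' hQ'.1 hne y hQ.2 y hQ'.2).1 rfl
        have h2 := Finset.card_filter_add_card_filter_not (s := 𝒬) (y ∈ ·)
        omega
      have hRc := Finset.card_insert_le y (B ∪ W)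
      have := h.tough_part (R := insert y (B ∪ W)) (N := nbrs G S (A.erase y))
        (𝒦 := 𝒬.filter (y ∉ ·)) hD (Finset.insert_subset (hAD hyA) hRD)
        (Finset.card_pos.1 (by omega)) (fun Q hQ => hgood.nonempty Q (Finset.mem_filter.1 hQ).1)
        (fun Q hQ => (hgood.sub Q (Finset.mem_filter.1 hQ).1).trans hAD)
        (by
          intro Q hQ x hx hxR
          rw [Finset.mem_filter] at hQ
          rcases Finset.mem_insert.1 hxR with rfl | e
          · exact hQ.2 hx
          · exact hnotR Q hQ.1 x hx e)
        (fun Q hQ Q' hQ' hne x hx hx' => (hgood.anti Q (Finset.mem_filter.1 hQ).1 Q'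
          (Finset.mem_filter.1 hQ').1 hne x hx x hx').1 rfl)
        (fun Q hQ x hx z hz hzR => hclosed Q (Finset.mem_filter.1 hQ).1 x hx z hz
          fun e => hzR (Finset.mem_insert_of_mem e)) nbrs_subset
        (by
          intro Q hQ x hx s hs hsx
          rw [Finset.mem_filter] at hQ
          exact mem_nbrs.2 ⟨hs, x, Finset.mem_erase.2 ⟨fun e => hQ.2 (e ▸ hx),
            hgood.sub Q hQ.1 hx⟩, hsx⟩)
      omega
    obtain ⟨s, hs, hsF⟩ := Finset.exists_mem_notMem_of_card_lt_card (s := insert t F)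
      (t := nbrs G S (A.erase y)) (by omega)
    rw [Finset.mem_insert, not_or] at hsF
    obtain ⟨hsS, x, hx, hsx⟩ := mem_nbrs.1 hs
    rw [Finset.mem_erase] at hx
    obtain ⟨lA, hp, hh, hla, hbrk⟩ := exists_perm_head_last_of_break (G := G) (x := x)
      ((hgood.mem x).2 hx.2) hx.1 (fun z hz hzy => hl₁ z hz (hX.2 y hyX z
        ((hgood.mem z).1 (by simp [hz])) hzy.symm))
    have hlA' := hlo.perm hp
    have e1 := hlA'.length_eq
    have e2 := hB.length_eq
    obtain ⟨L, q1, q2, q3, q4⟩ := (exists_weave (G := G) _ lA lB le_rfl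
      (fun a ha b hb => hAB a ((hlA'.2 a).1 ha) b ((hB.2 b).1 hb))
      (by rintro rfl; simp at hh) (by rintro rfl; simp at e2; omega)).2 (by omega) (by omega)
    exact ⟨s, by simp [hsS, hsF.2], t, by simp [htS, htF], hsF.1, x, y, L,
      hlA'.of_perm_append hB hAB hDAB q1, q2, by rw [q3, hh], by rw [q4, hla], hsx, htX y hyX⟩
  · push Not at hbr
    have hbB := hbr lB hB
    have e1 := hlo.length_eq
    have e2 := hB.length_eq
    have b1 := breaks_lt_length (G := G) (l := lB) (by rintro rfl; simp at e2; omega)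
    have b2 := breaks_lt_length (G := G) (l := l) (by
      rintro rfl; simp at e1; omega)
    have hindep : ∀ u ∈ B, ∀ v ∈ B, ¬ G.Adj u v := by
      intro u hu v hv huv
      set m := ((B.erase u).erase v).toList
      have hm : IsOrder B (u :: v :: m) := by
        refine ⟨?_, fun w => ?_⟩
        · simp [m, Finset.nodup_toList, huv.ne]
        · by_cases h1 : w = u
          · simp [h1, hu]
          · by_cases h2 : w = v
            · simp [h2, hv]
            · simp [m, h1, h2]
      have := hbr _ hm
      have h1 := hm.length_eq
      have h2 := breaks_lt_length (G := G) (l := v :: m) (by simp)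
      simp [breaks, huv] at this h1 h2
      omega
    have hNB : 4 ≤ (nbrs G S B).card := by
      have hinj : Function.Injective (fun b : V => ({b} : Finset V)) := Finset.singleton_injective
      have := h.tough_part (R := A) (N := nbrs G S B) (𝒦 := B.image fun b => {b}) hD hAD
        (by
          rw [Finset.image_nonempty]; exact Finset.card_pos.1 (by omega))
        (by simp) (by simpa using fun a ha => hBD ha)
        (by
          simp only [Finset.mem_image]
          rintro _ ⟨b, hb, rfl⟩ x hx hxA
          rw [Finset.mem_singleton] at hx
          subst hx
          exact (hAB x hxA x hb).ne rfl)
        (by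
          simp only [Finset.mem_image]
          rintro _ ⟨b, hb, rfl⟩ _ ⟨b', hb', rfl⟩ hne x hx hx'
          rw [Finset.mem_singleton] at hx hx'
          exact hne (by rw [← hx, ← hx']))
        (by
          simp only [Finset.mem_image]
          rintro _ ⟨b, hb, rfl⟩ x hx y hy hyA hxy
          rw [Finset.mem_singleton] at hx
          subst hx
          exact absurd hxy (hindep x hb y (((hDAB y).1 hy).resolve_left hyA)))
        nbrs_subset
        (by
          simp only [Finset.mem_image]
          rintro _ ⟨b, hb, rfl⟩ x hx s hs hsx
          rw [Finset.mem_singleton] at hx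
          subst hx
          exact mem_nbrs.2 ⟨hs, x, hb, hsx⟩)
      rw [Finset.card_image_of_injective _ hinj] at this
      omega
    obtain ⟨s, hs, hsF⟩ := Finset.exists_mem_notMem_of_card_lt_card (s := insert t F)
      (t := nbrs G S B) (by omega)
    rw [Finset.mem_insert, not_or] at hsF
    obtain ⟨hsS, x, hx, hsx⟩ := mem_nbrs.1 hs
    obtain ⟨-, y, hy, hty⟩ := mem_nbrs.1 htN
    obtain ⟨lA, hlA', hy'⟩ := exists_order_head hy
    obtain ⟨lB', hlB', hx'⟩ := exists_order_head hx
    have f1 := hlA'.length_eq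
    have f2 := hlB'.length_eq
    have g1 := breaks_lt_length (G := G) (l := lA) (by rintro rfl; simp at hy')
    have g2 := breaks_lt_length (G := G) (l := lB') (by rintro rfl; simp at hx')
    obtain ⟨L, q1, q2, q3, q4⟩ := (exists_weave (G := G) _ lA lB'.reverse le_rfl
      (fun a ha b hb => hAB a ((hlA'.2 a).1 ha) b ((hlB'.2 b).1 (List.mem_reverse.1 hb)))
      (by rintro rfl; simp at hy') (by
        intro e; rw [List.reverse_eq_nil_iff] at e; simp [e] at hx')).1
      (by rw [List.length_reverse]; omega) (by rw [breaks_reverse]; omega)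
    have hr := hlB'.perm (List.reverse_perm lB')
    exact ⟨t, by simp [htS, htF], s, by simp [hsS, hsF.2], fun e => hsF.1 e.symm, y, x, L,
      hlA'.of_perm_append hr hAB hDAB q1, q2, by rw [q3, hy'], by rw [q4]; simp [hx'], hty, hsx⟩

end Service

section TokenHall

variable {α β γ : Type*} [DecidableEq β] [DecidableEq γ] [Nonempty γ] {𝒢 : Finset α} {𝒬 : α → Finset β}
  {C N : β → Finset γ} {W : α → Finset γ} {leaf : α → Prop}

/-- The counting condition for a system of distinct representatives in which every part needs
a representative from `C` and one from `N`. -/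
theorem card_add_card_le_of_parts
    (hdisj : ∀ D ∈ 𝒢, ∀ D' ∈ 𝒢, D ≠ D' → Disjoint (𝒬 D) (𝒬 D'))
    (hCN : ∀ Q, C Q ⊆ N Q)
    (hmix : ∀ D ∈ 𝒢, ∀ Q ∈ 𝒬 D, ∀ Q' ∈ 𝒬 D, Q ≠ Q' → N Q ⊆ C Q ∪ C Q')
    (hN : ∀ K ⊆ 𝒢.biUnion 𝒬, 9 * K.card ≤ 2 * (K.biUnion N).card)
    (hW : ∀ D ∈ 𝒢, ¬ leaf D → ∀ Q ∈ 𝒬 D, ∃ w ∈ W D, w ∈ C Q)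
    (hWN : ∀ D ∈ 𝒢, ∀ D' ∈ 𝒢, D ≠ D' → ∀ w ∈ W D, ∀ Q ∈ 𝒬 D', w ∉ N Q)
    (hWW : ∀ D ∈ 𝒢, ∀ D' ∈ 𝒢, D ≠ D' → ∀ w ∈ W D, w ∉ W D')
    (hleaf : ∀ D ∈ 𝒢, leaf D → ∀ Q ∈ 𝒬 D, (C Q).Nonempty)
    (hleaf₂ : ∀ D ∈ 𝒢, ∀ D' ∈ 𝒢, D ≠ D' → leaf D → leaf D' → ∀ Q ∈ 𝒬 D, ∀ Q' ∈ 𝒬 D',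
      2 * (𝒢.biUnion 𝒬).card ≤ (C Q ∪ C Q').card ∨ (𝒢.card = 2 ∧ 2 ≤ (C Q).card))
    {I J : Finset β} (hI : I ⊆ 𝒢.biUnion 𝒬) (hJ : J ⊆ 𝒢.biUnion 𝒬) {U : Finset γ}
    (hIU : ∀ Q ∈ I, C Q ⊆ U) (hJU : ∀ Q ∈ J, N Q ⊆ U) : I.card + J.card ≤ U.card := by
  classical
  have hsum : ∀ X ⊆ 𝒢.biUnion 𝒬, X.card = ∑ D ∈ 𝒢, (X ∩ 𝒬 D).card := by
    intro X hX
    rw [← Finset.card_biUnion]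
    · congr 1
      ext Q
      simp only [Finset.mem_biUnion, Finset.mem_inter]
      refine ⟨fun h => ?_, fun ⟨D, _, h, _⟩ => h⟩
      obtain ⟨D, hD, hQ⟩ := Finset.mem_biUnion.1 (hX h)
      exact ⟨D, hD, h, hQ⟩
    · intro D hD D' hD' hne
      exact (hdisj D hD D' hD' hne).mono Finset.inter_subset_right Finset.inter_subset_right
  set κ : α → Finset β := fun D =>
    if 2 ≤ (I ∩ 𝒬 D).card ∧ (J ∩ 𝒬 D).card ≤ (I ∩ 𝒬 D).card then I ∩ 𝒬 D else J ∩ 𝒬 D with hκ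
  have hκsub : ∀ D, κ D ⊆ 𝒬 D := by
    intro D
    simp only [hκ]
    split_ifs <;> exact Finset.inter_subset_right
  have hκN : ∀ D ∈ 𝒢, ∀ Q ∈ κ D, N Q ⊆ U := by
    intro D hD Q hQ
    simp only [hκ] at hQ
    split_ifs at hQ with hc
    · obtain ⟨Q', hQ', hne⟩ := Finset.exists_mem_ne (s := I ∩ 𝒬 D) (by omega) Q
      rw [Finset.mem_inter] at hQ hQ'
      exact (hmix D hD Q hQ.2 Q' hQ'.2 hne.symm).trans
        (Finset.union_subset (hIU Q hQ.1) (hIU Q' hQ'.1))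
    · exact hJU Q (Finset.mem_inter.1 hQ).1
  set K := 𝒢.biUnion κ with hK
  have hKsub : K ⊆ 𝒢.biUnion 𝒬 := Finset.biUnion_mono fun D _ => hκsub D
  have hKcard : K.card = ∑ D ∈ 𝒢, (κ D).card := Finset.card_biUnion fun D hD D' hD' hne =>
    (hdisj D hD D' hD' hne).mono (hκsub D) (hκsub D')
  set L := 𝒢.filter fun D => (I ∩ 𝒬 D).card = 1 ∧ (J ∩ 𝒬 D).card = 0 with hL
  have hcount : I.card + J.card ≤ 2 * K.card + L.card := by
    rw [hsum I hI, hsum J hJ, hKcard, hL, Finset.card_filter, Finset.mul_sum,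
      ← Finset.sum_add_distrib, ← Finset.sum_add_distrib]
    refine Finset.sum_le_sum fun D _ => ?_
    simp only [hκ]
    split_ifs <;> omega
  have hLκ : ∀ D ∈ L, κ D = ∅ := by
    intro D hD
    have h := (Finset.mem_filter.1 hD).2
    simp only [hκ]
    rw [if_neg (by omega)]
    exact Finset.card_eq_zero.1 h.2
  have hLQ : ∀ D ∈ L, ∃ Q ∈ 𝒬 D, Q ∈ I := by
    intro D hD
    have h := (Finset.mem_filter.1 hD).2
    obtain ⟨Q, hQ⟩ := Finset.card_pos.1 (by omega : 0 < (I ∩ 𝒬 D).card)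
    rw [Finset.mem_inter] at hQ
    exact ⟨Q, hQ.2, hQ.1⟩
  have hLG : ∀ D ∈ L, D ∈ 𝒢 := fun D hD => (Finset.mem_filter.1 hD).1
  have hpriv : ∀ D ∈ L.filter (¬ leaf ·), ∃ w ∈ W D, w ∈ U := by
    intro D hD
    rw [Finset.mem_filter] at hD
    obtain ⟨Q, hQ, hQI⟩ := hLQ D hD.1
    obtain ⟨w, hw, hwC⟩ := hW D (hLG D hD.1) hD.2 Q hQ
    exact ⟨w, hw, hIU Q hQI hwC⟩
  choose! b hbW hbU using hpriv
  set B := (L.filter (¬ leaf ·)).image b with hB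
  have hBcard : B.card = (L.filter (¬ leaf ·)).card := by
    refine Finset.card_image_of_injOn fun D hD D' hD' he => ?_
    by_contra hne
    exact hWW D (hLG D (Finset.mem_filter.1 hD).1) D' (hLG D' (Finset.mem_filter.1 hD').1) hne _
      (hbW D hD) (by rw [show b D = b D' from he]; exact hbW D' hD')
  have hBU : B ⊆ U := by
    intro v hv
    obtain ⟨D, hD, rfl⟩ := Finset.mem_image.1 hv
    exact hbU D hD
  have hMU : K.biUnion N ⊆ U := by
    intro v hv
    obtain ⟨Q, hQ, hv⟩ := Finset.mem_biUnion.1 hv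
    obtain ⟨D, hD, hQ⟩ := Finset.mem_biUnion.1 hQ
    exact hκN D hD Q hQ hv
  have hBM : Disjoint (K.biUnion N) B := by
    rw [Finset.disjoint_left]
    intro v hv hvB
    obtain ⟨Q, hQ, hv⟩ := Finset.mem_biUnion.1 hv
    obtain ⟨D', hD', hQ⟩ := Finset.mem_biUnion.1 hQ
    obtain ⟨D, hD, rfl⟩ := Finset.mem_image.1 hvB
    have hDL := (Finset.mem_filter.1 hD).1
    by_cases hne : D = D'
    · subst hne
      rw [hLκ D hDL] at hQ
      simp at hQ
    · exact hWN D (hLG D hDL) D' hD' hne _ (hbW D hD) Q (hκsub D' hQ) hv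
  have hle := Finset.card_le_card (Finset.union_subset hMU hBU)
  rw [Finset.card_union_of_disjoint hBM, hBcard] at hle
  have hLL := Finset.card_filter_add_card_filter_not (s := L) (leaf ·)
  have hKN := hN K hKsub
  by_cases h0 : (L.filter (leaf ·)).card = 0
  · omega
  obtain ⟨D, hD⟩ := Finset.card_pos.1 (Nat.pos_of_ne_zero h0)
  rw [Finset.mem_filter] at hD
  obtain ⟨Q, hQ, hQI⟩ := hLQ D hD.1
  by_cases h1 : (L.filter (leaf ·)).card = 1
  · by_cases hK0 : K.card = 0
    · obtain ⟨c, hc⟩ := hleaf D (hLG D hD.1) hD.2 Q hQ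
      have hcB : c ∉ B := by
        intro hcB
        obtain ⟨D', hD', rfl⟩ := Finset.mem_image.1 hcB
        have h2 := Finset.mem_filter.1 hD'
        exact hWN D' (hLG D' h2.1) D (hLG D hD.1) (fun e => h2.2 (e ▸ hD.2)) _ (hbW D' hD') Q hQ
          (hCN Q hc)
      have := Finset.card_le_card (Finset.insert_subset (hIU Q hQI hc) hBU)
      rw [Finset.card_insert_of_notMem hcB, hBcard] at this
      omega
    · omega
  · obtain ⟨D', hD', hne⟩ := Finset.exists_mem_ne (s := L.filter (leaf ·)) (by omega) D
    rw [Finset.mem_filter] at hD'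
    obtain ⟨Q', hQ', hQI'⟩ := hLQ D' hD'.1
    rcases hleaf₂ D (hLG D hD.1) D' (hLG D' hD'.1) hne.symm hD.2 hD'.2 Q hQ Q' hQ' with h | ⟨h2, h⟩
    · have h3 := Finset.card_le_card (Finset.union_subset (hIU Q hQI) (hIU Q' hQI'))
      have h4 := Finset.card_le_card hI
      have h5 := Finset.card_le_card hJ
      omega
    · have h3 := Finset.card_le_card (hIU Q hQI)
      have h4 : L.card ≤ 2 := h2 ▸ Finset.card_le_card (Finset.filter_subset _ _)
      have h5 : L = 𝒢 := Finset.eq_of_subset_of_card_le (Finset.filter_subset _ _) (by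
        have := Finset.card_filter_le L (leaf ·)
        omega)
      have h6 : K = ∅ := by
        rw [Finset.eq_empty_iff_forall_notMem]
        intro Q hQ
        obtain ⟨D, hD, hQ⟩ := Finset.mem_biUnion.1 hQ
        rw [hLκ D (h5 ▸ hD)] at hQ
        simp at hQ
      rw [h6, Finset.card_empty] at hcount
      omega

omit [Nonempty γ] in
/-- Hall's theorem for two representatives per part. -/
theorem exists_two_representatives {P : Finset β}
    (h : ∀ I ⊆ P, ∀ J ⊆ P, ∀ U : Finset γ, (∀ Q ∈ I, C Q ⊆ U) → (∀ Q ∈ J, N Q ⊆ U) →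
      I.card + J.card ≤ U.card) (hP : P.Nonempty) :
    ∃ f : β → Bool → γ, (∀ Q ∈ P, ∀ Q' ∈ P, ∀ i j, f Q i = f Q' j → Q = Q' ∧ i = j) ∧
      ∀ Q ∈ P, f Q true ∈ C Q ∧ f Q false ∈ N Q := by
  classical
  obtain ⟨g, hg, hgt⟩ := (Finset.all_card_le_biUnion_card_iff_exists_injective
    (fun p : {Q // Q ∈ P} × Bool => if p.2 then C p.1 else N p.1)).1 (by
      intro T
      have hpart : ∀ i : Bool, ((T.filter (·.2 = i)).image fun p => (p.1 : β)).card =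
          (T.filter (·.2 = i)).card := by
        intro i
        refine Finset.card_image_of_injOn fun p hp q hq hpq => ?_
        rw [Finset.mem_coe, Finset.mem_filter] at hp hq
        exact Prod.ext (Subtype.ext hpq) (hp.2.trans hq.2.symm)
      have hT := Finset.card_filter_add_card_filter_not (s := T) (·.2 = true)
      simp only [Bool.not_eq_true] at hT
      rw [← hT, ← hpart, ← hpart]
      refine h _ ?_ _ ?_ _ ?_ ?_
      · intro Q hQ
        obtain ⟨p, -, rfl⟩ := Finset.mem_image.1 hQ
        exact p.1.2
      · intro Q hQ
        obtain ⟨p, -, rfl⟩ := Finset.mem_image.1 hQ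
        exact p.1.2
      · intro Q hQ v hv
        obtain ⟨p, hp, rfl⟩ := Finset.mem_image.1 hQ
        rw [Finset.mem_filter] at hp
        exact Finset.mem_biUnion.2 ⟨p, hp.1, by simpa [hp.2] using hv⟩
      · intro Q hQ v hv
        obtain ⟨p, hp, rfl⟩ := Finset.mem_image.1 hQ
        rw [Finset.mem_filter] at hp
        exact Finset.mem_biUnion.2 ⟨p, hp.1, by simpa [hp.2] using hv⟩)
  obtain ⟨Q₀, hQ₀⟩ := hP
  refine ⟨fun Q i => if hQ : Q ∈ P then g (⟨Q, hQ⟩, i) else g (⟨Q₀, hQ₀⟩, i), ?_, ?_⟩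
  · intro Q hQ Q' hQ' i j he
    simp only [hQ, hQ', dif_pos] at he
    have := hg he
    simpa using this
  · intro Q hQ
    simp only [hQ, dif_pos]
    exact ⟨by simpa using hgt (⟨Q, hQ⟩, true), by simpa using hgt (⟨Q, hQ⟩, false)⟩

end TokenHall

/-- Decompositions of the components in `𝒢`, at most one component being left out; the vertices of
`F ⊆ S` are reserved for that component. -/
structure Parts {V : Type*} [DecidableEq V] (G : SimpleGraph V) (S : Finset V)
    (𝒟 𝒢 : Finset (Finset V)) (F : Finset V) (W : Finset V → Finset V)
    (𝒬 : Finset V → Finset (Finset V)) (l : Finset V → List V) : Prop where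
  set : Setting G S 𝒟
  sub : 𝒢 ⊆ 𝒟
  nonempty : 𝒢.Nonempty
  good : ∀ D ∈ 𝒢, Good G D (W D) (𝒬 D) (l D)
  typ : ∀ D ∈ 𝒢, 𝒬 D ≠ {D} → ∀ Q ∈ 𝒬 D, ∃ w ∈ W D, ∀ x ∈ Q, G.Adj w x
  leaf : ∀ D ∈ 𝒢, 𝒬 D = {D} → 3 ≤ (fullNbrs G S D).card
  F_sub : F ⊆ S
  F_card : F.card ≤ 2 * (𝒟 \ 𝒢).card
  rest : (𝒟 \ 𝒢).card ≤ 1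

/-- The vertices available as ends of segments. -/
def pool {V : Type*} [DecidableEq V] (S F : Finset V) (𝒢 : Finset (Finset V))
    (W : Finset V → Finset V) : Finset V := (S \ F) ∪ 𝒢.biUnion W

open Classical in
/-- The vertices of `U` with a neighbour in `Q`. -/
noncomputable def someAdj {V : Type*} (G : SimpleGraph V) (U Q : Finset V) : Finset V :=
  U.filter fun v => ∃ x ∈ Q, G.Adj v x

open Classical in
/-- The vertices of `U` with a neighbour in `Q` that are adjacent to all of `Q`. -/
noncomputable def allAdj {V : Type*} (G : SimpleGraph V) (U Q : Finset V) : Finset V :=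
  (someAdj G U Q).filter fun v => ∀ x ∈ Q, G.Adj v x

section Assembly

variable {V : Type*} {G : SimpleGraph V} {S F : Finset V} {𝒟 𝒢 : Finset (Finset V)}
  {W : Finset V → Finset V} {𝒬 : Finset V → Finset (Finset V)} {l : Finset V → List V}

theorem mem_someAdj {U Q : Finset V} {v : V} :
    v ∈ someAdj G U Q ↔ v ∈ U ∧ ∃ x ∈ Q, G.Adj v x := by
  classical
  simp [someAdj]

theorem allAdj_subset {U Q : Finset V} : allAdj G U Q ⊆ someAdj G U Q := by
  classical
  exact Finset.filter_subset _ _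

theorem mem_allAdj {U Q : Finset V} {v : V} (hQ : Q.Nonempty) :
    v ∈ allAdj G U Q ↔ v ∈ U ∧ ∀ x ∈ Q, G.Adj v x := by
  classical
  obtain ⟨z, hz⟩ := hQ
  rw [allAdj, Finset.mem_filter, mem_someAdj]
  exact ⟨fun h => ⟨h.1.1, h.2⟩, fun h => ⟨⟨h.1, z, hz, h.2 z hz⟩, h.2⟩⟩

/-- If there are three components, a vertex of `S` is complete to all but one of them. -/
theorem Setting.complete_or_complete (h : Setting G S 𝒟) (h3 : 3 ≤ 𝒟.card) {D D' : Finset V}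
    (hD : D ∈ 𝒟) (hD' : D' ∈ 𝒟) (hne : D ≠ D') {s : V} (hs : s ∈ S) :
    (∀ x ∈ D, G.Adj s x) ∨ ∀ x ∈ D', G.Adj s x := by
  classical
  by_contra! hcon
  obtain ⟨⟨x, hx, hsx⟩, y, hy, hsy⟩ := hcon
  obtain ⟨D₃, hD₃, hne₃⟩ := Finset.exists_mem_notMem_of_card_lt_card (s := {D, D'}) (t := 𝒟)
    (by have := Finset.card_le_two (a := D) (b := D'); omega)
  simp only [Finset.mem_insert, Finset.mem_singleton, not_or] at hne₃
  obtain ⟨a, ha, b, hb, hab, hsb, hsa⟩ := h.exists_edge hs hD hx hsx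
  obtain ⟨c, hc, hsc⟩ := h.touch s hs D₃ hD₃
  exact h.free a b s c y hab hsb.symm hsc (fun e => hsa e.symm)
    (h.not_adj hD hD₃ (Ne.symm hne₃.1) ha hc) (h.not_adj hD hD₃ (Ne.symm hne₃.1) hb hc)
    (h.not_adj hD' hD hne.symm hy ha) (h.not_adj hD' hD hne.symm hy hb) (fun e => hsy e.symm)
    (h.not_adj hD' hD₃ (Ne.symm hne₃.2) hy hc)

variable [DecidableEq V]

theorem mem_pool {v : V} : v ∈ pool S F 𝒢 W ↔ (v ∈ S ∧ v ∉ F) ∨ ∃ D ∈ 𝒢, v ∈ W D := by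
  simp [pool]

theorem pool_subset : pool S F 𝒢 W ⊆ S ∪ 𝒢.biUnion W :=
  Finset.union_subset_union_left Finset.sdiff_subset

namespace Parts

theorem mem_D (h : Parts G S 𝒟 𝒢 F W 𝒬 l) {D Q : Finset V} (hD : D ∈ 𝒢) (hQ : Q ∈ 𝒬 D) {x : V}
    (hx : x ∈ Q) : x ∈ D := (h.good D hD).sub Q hQ hx

theorem eq_of_mem (h : Parts G S 𝒟 𝒢 F W 𝒬 l) {D D' : Finset V} (hD : D ∈ 𝒢) (hD' : D' ∈ 𝒢)
    {x : V} (hx : x ∈ D) (hx' : x ∈ D') : D = D' := by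
  by_contra hne
  exact h.set.disj D (h.sub hD) D' (h.sub hD') hne x hx hx'

theorem part_unique (h : Parts G S 𝒟 𝒢 F W 𝒬 l) {D D' Q : Finset V} (hD : D ∈ 𝒢) (hD' : D' ∈ 𝒢)
    (hQ : Q ∈ 𝒬 D) (hQ' : Q ∈ 𝒬 D') : D = D' := by
  obtain ⟨x, hx⟩ := (h.good D hD).nonempty Q hQ
  exact h.eq_of_mem hD hD' (h.mem_D hD hQ hx) (h.mem_D hD' hQ' hx)

theorem parts_disj (h : Parts G S 𝒟 𝒢 F W 𝒬 l) {Q Q' : Finset V} (hQ : Q ∈ 𝒢.biUnion 𝒬)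
    (hQ' : Q' ∈ 𝒢.biUnion 𝒬) (hne : Q ≠ Q') {x : V} (hx : x ∈ Q) : x ∉ Q' := by
  intro hx'
  obtain ⟨D, hD, hQ⟩ := Finset.mem_biUnion.1 hQ
  obtain ⟨D', hD', hQ'⟩ := Finset.mem_biUnion.1 hQ'
  obtain rfl := h.eq_of_mem hD hD' (h.mem_D hD hQ hx) (h.mem_D hD' hQ' hx')
  exact ((h.good D hD).anti Q hQ Q' hQ' hne x hx x hx').1 rfl

/-- A neighbour of a part outside that part is in `S` or in the separating set. -/
theorem closed_part (h : Parts G S 𝒟 𝒢 F W 𝒬 l) {D Q : Finset V} (hD : D ∈ 𝒢) (hQ : Q ∈ 𝒬 D)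
    {x y : V} (hx : x ∈ Q) (hxy : G.Adj x y) (hyS : y ∉ S) (hyW : y ∉ W D) : y ∈ Q := by
  have hyD := h.set.closed D (h.sub hD) x (h.mem_D hD hQ hx) y hyS hxy
  obtain ⟨Q', hQ', hy⟩ := ((h.good D hD).cover y hyD).resolve_left hyW
  by_contra hyQ
  have : Q ≠ Q' := by rintro rfl; exact hyQ hy
  exact ((h.good D hD).anti Q hQ Q' hQ' this x hx y hy).2 hxy

theorem notMem_S (h : Parts G S 𝒟 𝒢 F W 𝒬 l) {D : Finset V} (hD : D ∈ 𝒢) {x : V} (hx : x ∈ D) :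
    x ∉ S := h.set.notMem D (h.sub hD) x hx

theorem part_not_pool (h : Parts G S 𝒟 𝒢 F W 𝒬 l) {Q : Finset V} (hQ : Q ∈ 𝒢.biUnion 𝒬) {x : V}
    (hx : x ∈ Q) : x ∉ S ∪ 𝒢.biUnion W := by
  obtain ⟨D, hD, hQ⟩ := Finset.mem_biUnion.1 hQ
  have hxD := h.mem_D hD hQ hx
  rw [Finset.mem_union, not_or]
  refine ⟨h.notMem_S hD hxD, fun hxW => ?_⟩
  obtain ⟨D', hD', hxW⟩ := Finset.mem_biUnion.1 hxW
  obtain rfl := h.eq_of_mem hD hD' hxD ((h.good D' hD').W_sub hxW)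
  exact (h.good D hD).disjW Q hQ x hx hxW

theorem someAdj_subset_union (h : Parts G S 𝒟 𝒢 F W 𝒬 l) {D Q Q' : Finset V} (hD : D ∈ 𝒢)
    (hQ : Q ∈ 𝒬 D) (hQ' : Q' ∈ 𝒬 D) (hne : Q ≠ Q') :
    someAdj G (pool S F 𝒢 W) Q ⊆
      allAdj G (pool S F 𝒢 W) Q ∪ allAdj G (pool S F 𝒢 W) Q' := by
  intro v hv
  have hg := h.good D hD
  have hDD := h.sub hD
  rw [mem_someAdj] at hv
  obtain ⟨hvp, x, hx, hvx⟩ := hv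
  rw [Finset.mem_union, mem_allAdj (hg.nonempty Q hQ), mem_allAdj (hg.nonempty Q' hQ')]
  by_contra! hcon
  obtain ⟨y, hy, hvy⟩ := hcon.1 hvp
  obtain ⟨u, hu, hvu⟩ := hcon.2 hvp
  rcases mem_pool.1 hvp with ⟨hvS, -⟩ | ⟨D', hD', hvW⟩
  · obtain ⟨a, ha, b, hb, hva, hvb, hab⟩ := (hg.conn Q hQ).exists_crossing
      (p := fun z => G.Adj v z) hx hvx hy hvy
    obtain ⟨D', hD', hne'⟩ := h.set.exists_ne D
    obtain ⟨c, hc, hvc⟩ := h.set.touch v hvS D' hD'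
    exact h.set.free b a v c u hab.symm hva.symm hvc (fun e => hvb e.symm)
      (h.set.not_adj hDD hD' hne'.symm (h.mem_D hD hQ hb) hc)
      (h.set.not_adj hDD hD' hne'.symm (h.mem_D hD hQ ha) hc)
      (hg.anti Q' hQ' Q hQ hne.symm u hu b hb).2 (hg.anti Q' hQ' Q hQ hne.symm u hu a ha).2
      (fun e => hvu e.symm) (h.set.not_adj hDD hD' hne'.symm (h.mem_D hD hQ' hu) hc)
  · have hvD' := (h.good D' hD').W_sub hvW
    obtain rfl : D' = D := by
      by_contra hne'
      exact h.set.not_adj (h.sub hD') hDD hne' hvD' (h.mem_D hD hQ hx) hvx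
    rcases hg.mod v hvW Q hQ with e | e
    · exact hvy (e y hy)
    · exact e x hx hvx

theorem exists_leftover (h : Parts G S 𝒟 𝒢 F W 𝒬 l) {K : Finset (Finset V)}
    (hK : K ⊆ 𝒢.biUnion 𝒬) (h1 : K.card = 1 ∨ (𝒟 \ 𝒢).Nonempty) :
    ∃ z, z ∉ S ∪ 𝒢.biUnion W ∧ ∀ Q ∈ K, z ∉ Q := by
  by_cases hr : (𝒟 \ 𝒢).Nonempty
  · obtain ⟨D, hD⟩ := hr
    rw [Finset.mem_sdiff] at hD
    obtain ⟨z, hz⟩ := h.set.nonempty D hD.1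
    have hout : ∀ D' ∈ 𝒢, z ∉ D' := fun D' hD' =>
      h.set.disj D hD.1 D' (h.sub hD') (by rintro rfl; exact hD.2 hD') z hz
    refine ⟨z, ?_, ?_⟩
    · rw [Finset.mem_union, not_or]
      refine ⟨h.set.notMem D hD.1 z hz, fun hzW => ?_⟩
      obtain ⟨D', hD', hzW⟩ := Finset.mem_biUnion.1 hzW
      exact hout D' hD' ((h.good D' hD').W_sub hzW)
    · intro Q hQ hzQ
      obtain ⟨D', hD', hQ⟩ := Finset.mem_biUnion.1 (hK hQ)
      exact hout D' hD' (h.mem_D hD' hQ hzQ)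
  · have h1 := h1.resolve_right hr
    obtain ⟨Q, rfl⟩ := Finset.card_eq_one.1 h1
    have hQ := hK (Finset.mem_singleton_self Q)
    obtain ⟨D, hD, hQD⟩ := Finset.mem_biUnion.1 hQ
    obtain ⟨D', hD', hne⟩ := h.set.exists_ne D
    have hD'G : D' ∈ 𝒢 := by
      by_contra hD'G
      exact hr ⟨D', Finset.mem_sdiff.2 ⟨hD', hD'G⟩⟩
    have hc := (h.good D' hD'G).count
    obtain ⟨Q', hQ'⟩ := Finset.card_pos.1 (by omega : 0 < (𝒬 D').card)
    obtain ⟨z, hz⟩ := (h.good D' hD'G).nonempty Q' hQ'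
    refine ⟨z, h.part_not_pool (Finset.mem_biUnion.2 ⟨D', hD'G, hQ'⟩) hz, fun R hR hzR => ?_⟩
    obtain rfl := Finset.mem_singleton.1 hR
    exact hne (h.eq_of_mem hD'G hD (h.mem_D hD'G hQ' hz) (h.mem_D hD hQD hzR))

theorem card_le_biUnion (h : Parts G S 𝒟 𝒢 F W 𝒬 l) [Fintype V] {K : Finset (Finset V)}
    (hK : K ⊆ 𝒢.biUnion 𝒬) : 9 * K.card ≤ 2 * (K.biUnion (someAdj G (pool S F 𝒢 W))).card := by
  rcases K.eq_empty_or_nonempty with rfl | hKne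
  · simp
  set M := K.biUnion (someAdj G (pool S F 𝒢 W)) with hM
  have hMs : M ∪ F ⊆ S ∪ 𝒢.biUnion W := by
    refine Finset.union_subset ?_ (h.F_sub.trans Finset.subset_union_left)
    intro v hv
    obtain ⟨Q, -, hv⟩ := Finset.mem_biUnion.1 hv
    exact pool_subset (mem_someAdj.1 hv).1
  have hne : ∀ Q ∈ K, Q.Nonempty := by
    intro Q hQ
    obtain ⟨D, hD, hQ⟩ := Finset.mem_biUnion.1 (hK hQ)
    exact (h.good D hD).nonempty Q hQ
  have hT : ∀ Q ∈ K, ∀ x ∈ Q, x ∉ M ∪ F := fun Q hQ x hx hxM =>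
    h.part_not_pool (hK hQ) hx (hMs hxM)
  have hd : ∀ Q ∈ K, ∀ Q' ∈ K, Q ≠ Q' → ∀ x ∈ Q, x ∉ Q' := fun Q hQ Q' hQ' hne x hx =>
    h.parts_disj (hK hQ) (hK hQ') hne hx
  have hc : ∀ Q ∈ K, ∀ x ∈ Q, ∀ y, y ∉ M ∪ F → G.Adj x y → y ∈ Q := by
    intro Q hQ x hx y hy hxy
    rw [Finset.mem_union, not_or] at hy
    have hyp : y ∉ pool S F 𝒢 W := fun hyp =>
      hy.1 (Finset.mem_biUnion.2 ⟨Q, hQ, mem_someAdj.2 ⟨hyp, x, hx, hxy.symm⟩⟩)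
    rw [mem_pool] at hyp
    push Not at hyp
    obtain ⟨D, hD, hQD⟩ := Finset.mem_biUnion.1 (hK hQ)
    exact h.closed_part hD hQD hx hxy (fun e => hy.2 (hyp.1 e)) (hyp.2 D hD)
  have hMF := Finset.card_union_le M F
  have hF := h.F_card
  have hr := h.rest
  by_cases h1 : K.card = 1 ∨ (𝒟 \ 𝒢).Nonempty
  · obtain ⟨z, hz, hzK⟩ := h.exists_leftover hK h1
    have := h.set.tough_rest hKne hne hT hd hc (fun e => hz (hMs e)) hzK
    omega
  · rw [not_or, Finset.not_nonempty_iff_eq_empty] at h1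
    rw [h1.2, Finset.card_empty] at hF
    have := hKne.card_pos
    have := h.set.tough _ K (by omega) hne hT hd hc
    omega

/-- There are at least twice as many free vertices in `S` as parts. -/
theorem two_mul_card_le (h : Parts G S 𝒟 𝒢 F W 𝒬 l) :
    2 * (𝒢.biUnion 𝒬).card ≤ (S \ F).card := by
  have hdis : Disjoint (𝒢.biUnion 𝒬) (𝒟 \ 𝒢) := by
    rw [Finset.disjoint_left]
    intro Q hQ hQD
    obtain ⟨D, hD, hQ⟩ := Finset.mem_biUnion.1 hQ
    rw [Finset.mem_sdiff] at hQD
    obtain ⟨x, hx⟩ := (h.good D hD).nonempty Q hQ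
    exact h.set.disj D (h.sub hD) Q hQD.1 (by rintro rfl; exact hQD.2 hD) x (h.mem_D hD hQ hx) hx
  have hWc : (𝒢.biUnion W).card ≤ ∑ D ∈ 𝒢, (W D).card := Finset.card_biUnion_le
  have hQc : (𝒢.biUnion 𝒬).card = ∑ D ∈ 𝒢, (𝒬 D).card := Finset.card_biUnion (by
    intro D hD D' hD' hne
    exact Finset.disjoint_left.2 fun Q hQ hQ' => hne (h.part_unique hD hD' hQ hQ'))
  have hsum : ∑ D ∈ 𝒢, ((W D).card + 1) ≤ ∑ D ∈ 𝒢, (𝒬 D).card :=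
    Finset.sum_le_sum fun D hD => by have := (h.good D hD).count; omega
  rw [Finset.sum_add_distrib, Finset.sum_const, smul_eq_mul, mul_one] at hsum
  have htwo := h.set.two
  have hsd := Finset.card_sdiff_add_card_eq_card h.sub
  have hcu := Finset.card_union_of_disjoint hdis
  have hmem : ∀ Q ∈ 𝒢.biUnion 𝒬 ∪ 𝒟 \ 𝒢, Q ∈ 𝒢.biUnion 𝒬 ∨ (Q ∈ 𝒟 ∧ Q ∉ 𝒢) := by
    intro Q hQ
    rwa [Finset.mem_union, Finset.mem_sdiff] at hQ
  have hout : ∀ D ∈ 𝒟, D ∉ 𝒢 → ∀ D' ∈ 𝒢, ∀ x ∈ D, x ∉ D' := fun D hD hDG D' hD' =>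
    h.set.disj D hD D' (h.sub hD') (by rintro rfl; exact hDG hD')
  have := h.set.tough (S ∪ 𝒢.biUnion W) (𝒢.biUnion 𝒬 ∪ 𝒟 \ 𝒢) (by omega) ?_ ?_ ?_ ?_
  · have h1 := Finset.card_union_le S (𝒢.biUnion W)
    have h2 := Finset.card_sdiff_add_card_eq_card h.F_sub
    have h3 := h.F_card
    omega
  · intro Q hQ
    rcases hmem Q hQ with hQ | hQ
    · obtain ⟨D, hD, hQ⟩ := Finset.mem_biUnion.1 hQ
      exact (h.good D hD).nonempty Q hQ
    · exact h.set.nonempty Q hQ.1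
  · intro Q hQ x hx
    rcases hmem Q hQ with hQ | hQ
    · exact h.part_not_pool hQ hx
    · rw [Finset.mem_union, not_or]
      refine ⟨h.set.notMem Q hQ.1 x hx, fun hxW => ?_⟩
      obtain ⟨D', hD', hxW⟩ := Finset.mem_biUnion.1 hxW
      exact hout Q hQ.1 hQ.2 D' hD' x hx ((h.good D' hD').W_sub hxW)
  · intro Q hQ Q' hQ' hne x hx hx'
    rcases hmem Q hQ with hQ | hQ <;> rcases hmem Q' hQ' with hQ' | hQ'
    · exact h.parts_disj hQ hQ' hne hx hx'
    · obtain ⟨D, hD, hQ⟩ := Finset.mem_biUnion.1 hQ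
      exact hout Q' hQ'.1 hQ'.2 D hD x hx' (h.mem_D hD hQ hx)
    · obtain ⟨D, hD, hQ'⟩ := Finset.mem_biUnion.1 hQ'
      exact hout Q hQ.1 hQ.2 D hD x hx (h.mem_D hD hQ' hx')
    · exact h.set.disj Q hQ.1 Q' hQ'.1 hne x hx hx'
  · intro Q hQ x hx y hy hxy
    rw [Finset.mem_union, not_or] at hy
    rcases hmem Q hQ with hQ | hQ
    · obtain ⟨D, hD, hQ⟩ := Finset.mem_biUnion.1 hQ
      exact h.closed_part hD hQ hx hxy hy.1 fun e => hy.2 (Finset.mem_biUnion.2 ⟨D, hD, e⟩)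
    · exact h.set.closed Q hQ.1 x hx y hy.1 hxy

theorem exists_representatives (h : Parts G S 𝒟 𝒢 F W 𝒬 l) [Fintype V] :
    ∃ f : Finset V → Bool → V, (∀ Q ∈ 𝒢.biUnion 𝒬, ∀ Q' ∈ 𝒢.biUnion 𝒬, ∀ i j,
      f Q i = f Q' j → Q = Q' ∧ i = j) ∧ ∀ Q ∈ 𝒢.biUnion 𝒬,
      f Q true ∈ allAdj G (pool S F 𝒢 W) Q ∧ f Q false ∈ someAdj G (pool S F 𝒢 W) Q := by
  have hleaf : ∀ D ∈ 𝒢, 𝒬 D = {D} →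
      (fullNbrs G S D).card ≤ (allAdj G (pool S F 𝒢 W) D).card + F.card := by
    intro D hD hl
    refine (Finset.card_le_card (t := allAdj G (pool S F 𝒢 W) D ∪ F) fun s hs => ?_).trans
      (Finset.card_union_le _ _)
    rw [mem_fullNbrs] at hs
    by_cases hsF : s ∈ F
    · exact Finset.mem_union_right _ hsF
    · exact Finset.mem_union_left _ ((mem_allAdj (h.set.nonempty D (h.sub hD))).2
        ⟨mem_pool.2 (Or.inl ⟨hs.1, hsF⟩), hs.2⟩)
  have hF := h.F_card
  have hr := h.rest
  have hsd := Finset.card_sdiff_add_card_eq_card h.sub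
  obtain ⟨D₀, hD₀⟩ := h.nonempty
  obtain ⟨x₀, -⟩ := h.set.nonempty D₀ (h.sub hD₀)
  have : Nonempty V := ⟨x₀⟩
  refine exists_two_representatives (fun I hI J hJ U hIU hJU => card_add_card_le_of_parts
    (W := W) (leaf := fun D => 𝒬 D = {D}) ?_ (fun Q => allAdj_subset)
    (fun D hD Q hQ Q' hQ' hne => h.someAdj_subset_union hD hQ hQ' hne)
    (fun K hK => h.card_le_biUnion hK) ?_ ?_ ?_ ?_ ?_ hI hJ hIU hJU) ?_
  · intro D hD D' hD' hne
    rw [Finset.disjoint_left]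
    exact fun Q hQ hQ' => hne (h.part_unique hD hD' hQ hQ')
  · intro D hD hl Q hQ
    obtain ⟨w, hw, hwQ⟩ := h.typ D hD hl Q hQ
    exact ⟨w, hw, (mem_allAdj ((h.good D hD).nonempty Q hQ)).2
      ⟨mem_pool.2 (Or.inr ⟨D, hD, hw⟩), hwQ⟩⟩
  · intro D hD D' hD' hne w hw Q hQ hwN
    obtain ⟨-, x, hx, hwx⟩ := mem_someAdj.1 hwN
    exact h.set.not_adj (h.sub hD) (h.sub hD') hne ((h.good D hD).W_sub hw) (h.mem_D hD' hQ hx) hwx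
  · intro D hD D' hD' hne w hw hw'
    exact hne (h.eq_of_mem hD hD' ((h.good D hD).W_sub hw) ((h.good D' hD').W_sub hw'))
  · intro D hD hl Q hQ
    rw [hl, Finset.mem_singleton] at hQ
    subst hQ
    have h1 := hleaf Q hD hl
    have h2 := h.leaf Q hD hl
    exact Finset.card_pos.1 (by omega)
  · intro D hD D' hD' hne hl hl' Q hQ Q' hQ'
    rw [hl, Finset.mem_singleton] at hQ
    rw [hl', Finset.mem_singleton] at hQ'
    subst hQ hQ'
    by_cases h3 : 3 ≤ 𝒟.card
    · left
      refine h.two_mul_card_le.trans (Finset.card_le_card fun s hs => ?_)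
      rw [Finset.mem_sdiff] at hs
      rw [Finset.mem_union, mem_allAdj (h.set.nonempty _ (h.sub hD)),
        mem_allAdj (h.set.nonempty _ (h.sub hD'))]
      have hsp : s ∈ pool S F 𝒢 W := mem_pool.2 (Or.inl hs)
      exact (h.set.complete_or_complete h3 (h.sub hD) (h.sub hD') hne hs.1).imp
        (fun e => ⟨hsp, e⟩) (fun e => ⟨hsp, e⟩)
    · right
      have h1 := hleaf Q hD hl
      have h2 := h.leaf Q hD hl
      have h4 : 2 ≤ 𝒢.card := Finset.one_lt_card.2 ⟨Q, hD, Q', hD', hne⟩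
      exact ⟨by omega, by omega⟩
  · have := (h.good D₀ hD₀).count
    obtain ⟨Q, hQ⟩ := Finset.card_pos.1 (by omega : 0 < (𝒬 D₀).card)
    exact ⟨Q, Finset.mem_biUnion.2 ⟨D₀, hD₀, hQ⟩⟩

end Parts

end Assembly

section Final

variable {V : Type*} {G : SimpleGraph V} [DecidableEq V] {S F : Finset V}
  {𝒟 𝒢 : Finset (Finset V)} {W : Finset V → Finset V} {𝒬 : Finset V → Finset (Finset V)}
  {l : Finset V → List V}

theorem SegSys.exists_biUnion {ι : Type*} {I : Finset ι} {E H : ι → Finset V}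
    (h : ∀ i ∈ I, ∃ Fs, SegSys G (E i) (H i) Fs)
    (hd : ∀ i ∈ I, ∀ j ∈ I, i ≠ j → Disjoint (E i ∪ H i) (E j ∪ H j)) :
    ∃ Fs, SegSys G (I.biUnion E) (I.biUnion H) Fs := by
  classical
  induction I using Finset.induction_on with
  | empty => exact ⟨[], by simpa using SegSys.nil ∅⟩
  | insert i I hi ih =>
    obtain ⟨Fs₁, h₁⟩ := h i (Finset.mem_insert_self i I)
    obtain ⟨Fs₂, h₂⟩ := ih (fun j hj => h j (Finset.mem_insert_of_mem hj))
      (fun j hj k hk => hd j (Finset.mem_insert_of_mem hj) k (Finset.mem_insert_of_mem hk))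
    rw [Finset.biUnion_insert, Finset.biUnion_insert]
    refine ⟨_, h₁.append h₂ ?_⟩
    have key : ∀ j ∈ I, Disjoint (E i ∪ H i) (E j ∪ H j) := fun j hj =>
      hd i (Finset.mem_insert_self i I) j (Finset.mem_insert_of_mem hj)
        (by rintro rfl; exact hi hj)
    rw [Finset.disjoint_union_right, Finset.disjoint_biUnion_right, Finset.disjoint_biUnion_right]
    exact ⟨fun j hj => (key j hj).mono_right Finset.subset_union_left,
      fun j hj => (key j hj).mono_right Finset.subset_union_right⟩

theorem Setting.exists_segInv_of_segSys (h : Setting G S 𝒟) {E : Finset V → Finset V}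
    (hE : ∀ D ∈ 𝒟, E D ⊆ S) (hd : ∀ D ∈ 𝒟, ∀ D' ∈ 𝒟, D ≠ D' → Disjoint (E D) (E D'))
    (hs : ∀ D ∈ 𝒟, ∃ Fs, SegSys G (E D) D Fs) : ∃ Fs, SegInv G S Fs := by
  have hES : ∀ D ∈ 𝒟, ∀ D' ∈ 𝒟, Disjoint (E D) D' := fun D hD D' hD' =>
    Finset.disjoint_left.2 fun x hx hx' => h.notMem D' hD' x hx' (hE D hD hx)
  obtain ⟨Fs, hFs⟩ := SegSys.exists_biUnion (H := id) hs (by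
    intro D hD D' hD' hne
    rw [Finset.disjoint_union_left, Finset.disjoint_union_right, Finset.disjoint_union_right]
    exact ⟨⟨hd D hD D' hD' hne, hES D hD D' hD'⟩, (hES D' hD' D hD).symm,
      Finset.disjoint_left.2 fun x hx hx' => h.disj D hD D' hD' hne x hx hx'⟩)
  have hsub : ∀ v ∈ 𝒟.biUnion E, v ∈ S := by
    intro v hv
    obtain ⟨D, hD, hv⟩ := Finset.mem_biUnion.1 hv
    exact hE D hD hv
  have hout : ∀ f ∈ Fs, ∀ v ∈ f.p, v ∉ S := by
    intro f hf v hv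
    obtain ⟨D, hD, hv⟩ := Finset.mem_biUnion.1 (hFs.p_sub f hf v hv)
    exact h.notMem D hD v hv
  refine ⟨Fs, fun f hf => ?_, hFs.nodup, fun v hv => ?_⟩
  · have hne := hFs.p_ne f hf
    exact ⟨hFs.chain f hf, hsub _ (hFs.s_mem f hf), hsub _ (hFs.t_mem f hf),
      ⟨f.p.head hne, List.head?_eq_some_head hne, hout f hf _ (List.head_mem hne)⟩,
      ⟨f.p.getLast hne, List.getLast?_eq_some_getLast hne, hout f hf _ (List.getLast_mem hne)⟩⟩
  · obtain ⟨D, hD, hvD⟩ := h.cover v hv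
    exact hFs.cover v (Finset.mem_biUnion.2 ⟨D, hD, hvD⟩)

/-- A component with few complete neighbours is covered by a single segment. -/
theorem Setting.exists_segment [Fintype V] (h : Setting G S 𝒟) {D : Finset V} (hD : D ∈ 𝒟)
    (hF : F.card ≤ 2) (hleaf : HamConn G D ∨ TightJoin G D) (hfew : (fullNbrs G S D).card ≤ 2) :
    ∃ E ⊆ S \ F, E.card ≤ 2 ∧ ∃ Fs, SegSys G E D Fs := by
  have hserve : Serves G (S \ F) D := by
    rcases hleaf with hl | hl
    · refine h.serves_of_hamConn hD hF hl ?_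
      by_contra hlt
      have hpos := (h.nonempty D hD).card_pos
      obtain ⟨x, hx⟩ := Finset.card_eq_one.1 (by omega : D.card = 1)
      have : S ⊆ fullNbrs G S D := by
        intro s hs
        obtain ⟨y, hy, hsy⟩ := h.touch s hs D hD
        rw [hx, Finset.mem_singleton] at hy
        refine mem_fullNbrs.2 ⟨hs, fun z hz => ?_⟩
        rw [hx, Finset.mem_singleton] at hz
        rwa [hz, ← hy]
      have := Finset.card_le_card this
      have := h.nine_le
      omega
    · exact h.serves_of_tightJoin hD hF hl
  obtain ⟨s, hs, t, ht, hst, x, y, p, hp, hch, hx, hy, hsx, hty⟩ := hserve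
  have hsD : s ∉ p := fun e => h.notMem D hD s ((hp.2 s).1 e) (Finset.mem_sdiff.1 hs).1
  have htD : t ∉ p := fun e => h.notMem D hD t ((hp.2 t).1 e) (Finset.mem_sdiff.1 ht).1
  refine ⟨{s, t}, by simp [Finset.insert_subset_iff, hs, ht], Finset.card_le_two,
    [⟨s, p, t⟩], ?_⟩
  constructor
  · intro f hf
    obtain rfl := List.mem_singleton.1 hf
    have h1 : (p ++ [t]).IsChain G.Adj := by
      rw [List.isChain_append]
      exact ⟨hch, by simp, by simp [hy, hty.symm]⟩
    simp only [Seg.all]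
    rw [List.isChain_cons]
    refine ⟨?_, h1⟩
    rw [List.head?_append, hx]
    simpa using hsx
  · intro f hf e
    obtain rfl := List.mem_singleton.1 hf
    simp only at e
    simp [e] at hx
  · simp
  · simp
  · intro f hf v hv
    obtain rfl := List.mem_singleton.1 hf
    exact (hp.2 v).1 hv
  · simp only [List.flatMap_cons, List.flatMap_nil, List.append_nil, Seg.all]
    rw [List.nodup_cons, List.nodup_append']
    refine ⟨?_, hp.1, by simp, by simpa using htD⟩
    simp [hsD, hst]
  · intro v hv
    exact ⟨_, List.mem_singleton_self _, (hp.2 v).2 hv⟩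

theorem Parts.exists_segInv [Fintype V] (h : Parts G S 𝒟 𝒢 F W 𝒬 l)
    (hrest : ∀ D ∈ 𝒟 \ 𝒢, ∃ Fs, SegSys G F D Fs) : ∃ Fs, SegInv G S Fs := by
  obtain ⟨f, hinj, hf⟩ := h.exists_representatives
  have hP : ∀ D ∈ 𝒢, ∀ Q ∈ 𝒬 D, Q ∈ 𝒢.biUnion 𝒬 := fun D hD Q hQ =>
    Finset.mem_biUnion.2 ⟨D, hD, hQ⟩
  have hex : ∀ D ∈ 𝒢, ∃ E ⊆ S \ F, (∀ v ∈ E, ∃ Q ∈ 𝒬 D, ∃ i, v = f Q i) ∧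
      ∃ Fs, SegSys G E D Fs := by
    intro D hD
    have hg := h.good D hD
    have htrue : ∀ Q ∈ 𝒬 D, ∀ x ∈ Q, G.Adj (f Q true) x := fun Q hQ =>
      ((mem_allAdj (hg.nonempty Q hQ)).1 (hf Q (hP D hD Q hQ)).1).2
    have hfalse : ∀ Q ∈ 𝒬 D, ∃ x ∈ Q, G.Adj (f Q false) x := fun Q hQ =>
      (mem_someAdj.1 (hf Q (hP D hD Q hQ)).2).2
    obtain ⟨E, hE, hEf, Fs, hFs, -⟩ := hg.ssys_restrict (E := S \ F) (f := f)
      (Finset.disjoint_left.2 fun x hx hxD => h.notMem_S hD hxD (Finset.mem_sdiff.1 hx).1)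
      (fun Q hQ Q' hQ' => hinj Q (hP D hD Q hQ) Q' (hP D hD Q' hQ')) (by
        intro Q hQ i
        have hadj : ∃ x ∈ Q, G.Adj (f Q i) x := by
          cases i with
          | false => exact hfalse Q hQ
          | true =>
            obtain ⟨x, hx⟩ := hg.nonempty Q hQ
            exact ⟨x, hx, htrue Q hQ x hx⟩
        have hpool : f Q i ∈ pool S F 𝒢 W := by
          cases i with
          | false => exact (mem_someAdj.1 (hf Q (hP D hD Q hQ)).2).1
          | true => exact ((mem_allAdj (hg.nonempty Q hQ)).1 (hf Q (hP D hD Q hQ)).1).1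
        obtain ⟨x, hx, hfx⟩ := hadj
        rcases mem_pool.1 hpool with e | ⟨D', hD', e⟩
        · exact Or.inl (Finset.mem_sdiff.2 e)
        · right
          by_cases hne : D' = D
          · exact hne ▸ e
          · exact absurd hfx (h.set.not_adj (h.sub hD') (h.sub hD) hne
              ((h.good D' hD').W_sub e) (h.mem_D hD hQ hx))) htrue hfalse
    exact ⟨E, hE, hEf, Fs, hFs⟩
  choose! E hE hEf hEs using hex
  refine h.set.exists_segInv_of_segSys (E := fun D => if D ∈ 𝒢 then E D else F) ?_ ?_ ?_
  · intro D hD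
    split_ifs with hG
    · exact (hE D hG).trans Finset.sdiff_subset
    · exact h.F_sub
  · intro D hD D' hD' hne
    split_ifs with hG hG' hG'
    · rw [Finset.disjoint_left]
      intro v hv hv'
      obtain ⟨Q, hQ, i, rfl⟩ := hEf D hG v hv
      obtain ⟨Q', hQ', j, he⟩ := hEf D' hG' _ hv'
      obtain ⟨rfl, -⟩ := hinj Q (hP D hG Q hQ) Q' (hP D' hG' Q' hQ') i j he
      exact hne (h.part_unique hG hG' hQ hQ')
    · exact Finset.disjoint_of_subset_left (hE D hG) Finset.sdiff_disjoint
    · exact Finset.disjoint_of_subset_right (hE D' hG') Finset.disjoint_sdiff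
    · exact absurd (Finset.card_le_one.1 h.rest D (Finset.mem_sdiff.2 ⟨hD, hG⟩) D'
        (Finset.mem_sdiff.2 ⟨hD', hG'⟩)) hne
  · intro D hD
    split_ifs with hG
    · exact hEs D hG
    · exact hrest D (Finset.mem_sdiff.2 ⟨hD, hG⟩)

omit [DecidableEq V] in
theorem Setting.noP4 (h : Setting G S 𝒟) {D : Finset V} (hD : D ∈ 𝒟) : NoP4 G D := by
  intro a ha b hb c hc d hd hab hbc hcd hac had hbd
  obtain ⟨D', hD', hne⟩ := h.exists_ne D
  obtain ⟨e, he⟩ := h.nonempty D' hD'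
  exact h.free a b c d e hab hbc hcd hac had hbd (h.not_adj hD' hD hne he ha)
    (h.not_adj hD' hD hne he hb) (h.not_adj hD' hD hne he hc) (h.not_adj hD' hD hne he hd)

theorem Setting.exists_segInv [Fintype V] (h : Setting G S 𝒟) : ∃ Fs, SegInv G S Fs := by
  have hdec : ∀ D ∈ 𝒟, ∃ W 𝒬 l, Good G D W 𝒬 l ∧
      (𝒬 ≠ {D} → ∀ Q ∈ 𝒬, ∃ w ∈ W, ∀ x ∈ Q, G.Adj w x) ∧
      (𝒬 = {D} → HamConn G D ∨ TightJoin G D) := by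
    intro D hD
    obtain ⟨W, 𝒬, l, hg, hty⟩ := exists_good D (h.nonempty D hD) (h.noP4 hD)
    refine ⟨W, 𝒬, l, hg, ?_⟩
    rcases hty (h.conn D hD) with ⟨hW, hQ, -⟩ | ⟨-, hQ, -, hl⟩
    · refine ⟨fun _ => hQ, fun e => ?_⟩
      have h1 := hg.count
      have h2 := hW.card_pos
      rw [e, Finset.card_singleton] at h1
      omega
    · exact ⟨fun e => absurd hQ e, fun _ => hl⟩
  choose! W 𝒬 l hg htyp hleaf using hdec
  set 𝓑 := 𝒟.filter fun D => 𝒬 D = {D} ∧ (fullNbrs G S D).card ≤ 2 with h𝓑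
  have mem𝓑 : ∀ {D}, D ∈ 𝓑 ↔ D ∈ 𝒟 ∧ 𝒬 D = {D} ∧ (fullNbrs G S D).card ≤ 2 :=
    Finset.mem_filter
  have hparts : ∀ F ⊆ S, F.card ≤ 2 * 𝓑.card → 𝓑.card ≤ 1 → Parts G S 𝒟 (𝒟 \ 𝓑) F W 𝒬 l := by
    intro F hFS hFc h1
    have hdd : 𝒟 \ (𝒟 \ 𝓑) = 𝓑 :=
      Finset.sdiff_sdiff_eq_self (Finset.filter_subset _ _)
    have hsub : 𝒟 \ 𝓑 ⊆ 𝒟 := Finset.sdiff_subset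
    refine ⟨h, hsub, ?_, fun D hD => hg D (hsub hD), fun D hD => htyp D (hsub hD), ?_, hFS,
      by rwa [hdd], by rwa [hdd]⟩
    · rw [← Finset.card_pos]
      have := h.two
      have := Finset.le_card_sdiff 𝓑 𝒟
      omega
    · intro D hD hl
      rw [Finset.mem_sdiff, mem𝓑] at hD
      by_contra hlt
      exact hD.2 ⟨hD.1, hl, by omega⟩
  rcases Nat.lt_or_ge 1 𝓑.card with h2 | h1
  · obtain ⟨D, hD, D', hD', hne⟩ := Finset.one_lt_card.1 h2
    rw [mem𝓑] at hD hD'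
    have hk : 𝒟.card = 2 := by
      by_contra hk
      have h3 : 3 ≤ 𝒟.card := by have := h.two; omega
      have hS : S ⊆ fullNbrs G S D ∪ fullNbrs G S D' := fun s hs =>
        Finset.mem_union.2 ((h.complete_or_complete h3 hD.1 hD'.1 hne hs).imp
          (fun e => mem_fullNbrs.2 ⟨hs, e⟩) (fun e => mem_fullNbrs.2 ⟨hs, e⟩))
      have c1 := Finset.card_le_card hS
      have c2 := Finset.card_union_le (fullNbrs G S D) (fullNbrs G S D')
      have c3 := h.nine_le
      omega
    have h𝒟 : ∀ X ∈ 𝒟, X ≠ D → X = D' := by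
      have : ({D, D'} : Finset (Finset V)) = 𝒟 := Finset.eq_of_subset_of_card_le
        (by simp [Finset.insert_subset_iff, hD.1, hD'.1]) (by rw [Finset.card_pair hne, hk])
      intro X hX hXD
      rw [← this] at hX
      simpa [hXD] using hX
    obtain ⟨E, hE, hEc, hEs⟩ := h.exists_segment (F := ∅) hD.1 (by simp) (hleaf D hD.1 hD.2.1)
      hD.2.2
    obtain ⟨E', hE', -, hEs'⟩ := h.exists_segment (F := E) hD'.1 hEc (hleaf D' hD'.1 hD'.2.1)
      hD'.2.2
    refine h.exists_segInv_of_segSys (E := fun X => if X = D then E else E') ?_ ?_ ?_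
    · intro X _
      split_ifs
      · exact hE.trans Finset.sdiff_subset
      · exact hE'.trans Finset.sdiff_subset
    · intro X hX Y hY hXY
      split_ifs with e e' e'
      · exact absurd (e.trans e'.symm) hXY
      · exact Finset.disjoint_of_subset_right hE' Finset.disjoint_sdiff
      · exact Finset.disjoint_of_subset_left hE' Finset.sdiff_disjoint
      · exact absurd ((h𝒟 X hX e).trans (h𝒟 Y hY e').symm) hXY
    · intro X hX
      split_ifs with e
      · exact e ▸ hEs
      · exact (h𝒟 X hX e) ▸ hEs'
  · have hdd : 𝒟 \ (𝒟 \ 𝓑) = 𝓑 := Finset.sdiff_sdiff_eq_self (Finset.filter_subset _ _)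
    rcases 𝓑.eq_empty_or_nonempty with h0 | ⟨D, hD⟩
    · refine (hparts ∅ (by simp) (by simp) h1).exists_segInv fun D hD => ?_
      rw [hdd, h0] at hD
      simp at hD
    · have hD' := mem𝓑.1 hD
      obtain ⟨E, hE, hEc, hEs⟩ := h.exists_segment (F := ∅) hD'.1 (by simp)
        (hleaf D hD'.1 hD'.2.1) hD'.2.2
      have hpos := Finset.card_pos.2 ⟨D, hD⟩
      refine (hparts E (hE.trans Finset.sdiff_subset) (by omega) h1).exists_segInv fun X hX => ?_
      rw [hdd] at hX
      rwa [Finset.card_le_one.1 h1 X hX D hD]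

end Final

theorem stmt12 {V : Type*} [Fintype V] (G : SimpleGraph V)
    (htough : Tough 4.5 G) (hfree : P4P1Free G)
    (S : Set V) (hcut : IsCutset G S) (hmin : ∀ T : Set V, T ⊂ S → ¬ IsCutset G T) :
    ∃ (w : V) (C : G.Walk w w), C.IsCycle ∧ ∀ x ∉ S, x ∈ C.support := by
  classical
  have hcoe : ((S.toFinset : Finset V) : Set V) = S := Set.coe_toFinset S
  obtain ⟨𝒟, h⟩ := exists_setting htough hfree S.toFinset (by rwa [hcoe]) (by rwa [hcoe])
  obtain ⟨Fs, hFs⟩ := h.exists_segInv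
  obtain ⟨f, hf⟩ := hFs.exists_single h
  obtain ⟨w, C, hC, hcov⟩ := (hf.hasTour h).exists_isCycle h
  exact ⟨w, C, hC, fun x hx => hcov x (by simpa using hx)⟩
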